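/- There exist absolute constants c > 0 and c0 > 0 such that the following holds. Let x be sufficiently large and let q satisfy x·(log x)^{−5/9} ≤ q ≤ x/2 and q ≥ c0, and suppose q has no prime factor less than log x / log log x. Then there exist at least q^{1 − 1/log log q} integers a ∈ [1, q] such that S(x; q, a) ≥ c · 𝔖 · x / (φ_𝒮(q) · (x/q)^{9/10}). -/

import Mathlib

/-- `n` is a positive integer expressible as a sum of two squares. -/
def IsSumTwoSquares (n : ℕ) : Prop := 0 < n ∧ ∃ a b : ℕ, n = a ^ 2 + b ^ 2

/-- `SAP x q a` counts positive integers `n ≤ x` with `n ∈ 𝒮` and `n ≡ a (mod q)`. -/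
noncomputable def SAP (x : ℝ) (q a : ℕ) : ℕ :=
  {n : ℕ | (n : ℝ) ≤ x ∧ IsSumTwoSquares n ∧ n % q = a % q}.ncard

/-- The multiplicative function `φ_𝒮`, defined via the prime factorization. -/
noncomputable def phiS (q : ℕ) : ℝ :=
  ∏ p ∈ q.primeFactors,
    (if p = 2 then (if 2 ≤ q.factorization 2 then (2 : ℝ) ^ (q.factorization 2 - 1) else 2)
     else if p % 4 = 1 then (p : ℝ) ^ (q.factorization p)
     else (p : ℝ) ^ (q.factorization p + 1) / ((p : ℝ) + 1))

/-- The singular constant `𝔖 = 2^{-1/2} ∏_{p ≡ 3 (mod 4)} (1 - p^{-2})^{-1/2}`. -/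
noncomputable def frakS : ℝ :=
  (2 : ℝ) ^ (-(1 : ℝ) / 2) *
    ∏' p : {p : ℕ // p.Prime ∧ p % 4 = 3}, ((1 - ((p : ℕ) : ℝ) ^ (-(2 : ℝ))) ^ (-(1 : ℝ) / 2))

namespace STS
open Finset

/-- Abel summation bound. -/
lemma abel_bound (E f : ℕ → ℝ) (C : ℝ) (M N : ℕ) (hMN : M ≤ N)
    (hE : ∀ n, M ≤ n → |E n| ≤ C) (hf : ∀ n, M ≤ n → f (n + 1) ≤ f n)
    (hf0 : ∀ n, M ≤ n → 0 ≤ f n) :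
    |∑ n ∈ Ioc M N, (E n - E (n - 1)) * f n| ≤ 2 * C * f M := by
  have key : |∑ n ∈ Ioc M N, (E n - E (n - 1)) * f n - E N * f N + E M * f M|
      ≤ C * (f M - f N) := by
    induction N, hMN using Nat.le_induction with
    | base => simp
    | succ N hN ih =>
      rw [Finset.sum_Ioc_succ_top (by omega)]
      have h1 := hE N hN
      have h2 := hf N hN
      have h3 : |E N * (f N - f (N + 1))| ≤ C * (f N - f (N + 1)) := by
        rw [abs_mul, abs_of_nonneg (by linarith : 0 ≤ f N - f (N + 1))]
        exact mul_le_mul_of_nonneg_right h1 (by linarith)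
      simp only [Nat.add_sub_cancel]
      rw [abs_le] at ih h3 ⊢
      constructor <;> nlinarith [ih.1, ih.2, h3.1, h3.2]
  have a1 : |E N * f N| ≤ C * f N := by
    rw [abs_mul, abs_of_nonneg (hf0 N hMN)]
    exact mul_le_mul_of_nonneg_right (hE N hMN) (hf0 N hMN)
  have a2 : |E M * f M| ≤ C * f M := by
    rw [abs_mul, abs_of_nonneg (hf0 M le_rfl)]
    exact mul_le_mul_of_nonneg_right (hE M le_rfl) (hf0 M le_rfl)
  rw [abs_le] at key a1 a2 ⊢
  constructor <;> nlinarith [key.1, key.2, a1.1, a1.2, a2.1, a2.2]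

/-- real valued character mod 4 -/
noncomputable def chi (n : ℕ) : ℝ := ((ZMod.χ₄ (n : ZMod 4) : ℤ) : ℝ)

lemma chi_mul (m n : ℕ) : chi (m * n) = chi m * chi n := by
  rw [chi, chi, chi, Nat.cast_mul, map_mul, Int.cast_mul]

lemma chi_eq (n : ℕ) : chi n = if n % 2 = 0 then 0 else if n % 4 = 1 then 1 else -1 := by
  rw [chi, ZMod.χ₄_nat_eq_if_mod_four]
  split_ifs <;> simp

lemma chi_abs (n : ℕ) : |chi n| ≤ 1 := by
  rw [chi_eq]; split_ifs <;> simp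

/-- partial sums of `chi` -/
noncomputable def chiS (n : ℕ) : ℝ := if n % 4 = 1 ∨ n % 4 = 2 then 1 else 0

lemma chiS_abs (n : ℕ) : |chiS n| ≤ 1 := by
  rw [chiS]; split_ifs <;> simp

lemma chiS_sub (n : ℕ) (hn : 1 ≤ n) : chiS n - chiS (n - 1) = chi n := by
  rw [chiS, chiS, chi_eq]
  have : n % 4 = 0 ∨ n % 4 = 1 ∨ n % 4 = 2 ∨ n % 4 = 3 := by omega
  rcases this with h | h | h | h
  · have h1 : (n - 1) % 4 = 3 := by omega
    have h2 : n % 2 = 0 := by omega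
    simp [h, h1, h2]
  · have h1 : (n - 1) % 4 = 0 := by omega
    have h2 : n % 2 = 1 := by omega
    simp [h, h1, h2]
  · have h1 : (n - 1) % 4 = 1 := by omega
    have h2 : n % 2 = 0 := by omega
    simp [h, h1, h2]
  · have h1 : (n - 1) % 4 = 2 := by omega
    have h2 : n % 2 = 1 := by omega
    simp [h, h1, h2]

lemma chi_sum_bound (f : ℕ → ℝ) (M N : ℕ) (hMN : M ≤ N)
    (hf : ∀ n, M ≤ n → f (n + 1) ≤ f n) (hf0 : ∀ n, M ≤ n → 0 ≤ f n) :
    |∑ n ∈ Ioc M N, chi n * f n| ≤ 2 * f M := by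
  have := abel_bound chiS f 1 M N hMN (fun n _ => chiS_abs n) hf hf0
  rw [mul_one] at this
  convert this using 2
  apply Finset.sum_congr rfl
  intro n hn
  rw [chiS_sub n (by simp at hn; omega)]

/-- `L(M)` -/
noncomputable def Lsum (M : ℕ) : ℝ := ∑ n ∈ Ioc 0 M, chi n * (1 / (n : ℝ))

lemma Lsum_sub (M N : ℕ) (hM : 1 ≤ M) (h : M ≤ N) : |Lsum N - Lsum M| ≤ 2 / M := by
  have : Lsum N - Lsum M = ∑ n ∈ Ioc M N, chi n * (1 / (n : ℝ)) := by
    rw [Lsum, Lsum, ← Finset.sum_Ioc_consecutive _ (Nat.zero_le M) h]; ring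
  rw [this]
  have := chi_sum_bound (fun n => 1 / (n : ℝ)) M N h (fun n hn => by
    have : (0 : ℝ) < n := by exact_mod_cast (by omega : 0 < n)
    apply one_div_le_one_div_of_le this; push_cast; linarith) (fun n hn => by positivity)
  rwa [mul_one_div] at this

lemma Lsum_pos (N : ℕ) (hN : 1 ≤ N) : 1 / 6 ≤ Lsum N := by
  have h4 : Lsum 4 = 2 / 3 := by
    simp [Lsum, Finset.sum_Ioc_succ_top, chi_eq]; norm_num
  by_cases h : 4 ≤ N
  · have := Lsum_sub 4 N (by norm_num) h
    rw [abs_le, h4] at this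
    norm_num at this
    linarith [this.1]
  · have : N = 1 ∨ N = 2 ∨ N = 3 := by omega
    rcases this with rfl | rfl | rfl
    · simp [Lsum, chi_eq]; norm_num
    · simp [Lsum, Finset.sum_Ioc_succ_top, chi_eq]; norm_num
    · simp [Lsum, Finset.sum_Ioc_succ_top, chi_eq]; norm_num

open ArithmeticFunction in
lemma dsum (F : ℕ → ℝ) (N : ℕ) : ∑ n ∈ Ioc 0 N, F n * Real.log n =
    ∑ d ∈ Ioc 0 N, vonMangoldt d * ∑ m ∈ Ioc 0 (N / d), F (d * m) := by
  have h1 : ∀ n ∈ Ioc 0 N, F n * Real.log n =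
      ∑ d ∈ Ioc 0 N, if d ∣ n then F n * vonMangoldt d else 0 := by
    intro n hn
    simp only [mem_Ioc] at hn
    rw [← vonMangoldt_sum, Finset.mul_sum, ← Finset.sum_filter]
    apply Finset.sum_congr _ (fun _ _ => rfl)
    ext d
    simp only [Nat.mem_divisors, mem_filter, mem_Ioc]
    constructor
    · rintro ⟨h, h0⟩
      exact ⟨⟨Nat.pos_of_dvd_of_pos h (by omega), (Nat.le_of_dvd (by omega) h).trans hn.2⟩, h⟩
    · rintro ⟨_, h⟩
      exact ⟨h, by omega⟩
  rw [Finset.sum_congr rfl h1, Finset.sum_comm]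
  apply Finset.sum_congr rfl
  intro d hd
  simp only [mem_Ioc] at hd
  rw [← Finset.sum_filter, Finset.mul_sum]
  symm
  apply Finset.sum_nbij' (fun m => d * m) (fun n => n / d)
  · intro m hm
    simp only [mem_Ioc, mem_filter] at hm ⊢
    refine ⟨⟨Nat.mul_pos hd.1 hm.1, ?_⟩, dvd_mul_right _ _⟩
    calc d * m ≤ d * (N / d) := Nat.mul_le_mul_left _ hm.2
      _ ≤ N := Nat.mul_div_le _ _
  · intro n hn
    simp only [mem_Ioc, mem_filter] at hn ⊢
    exact ⟨Nat.div_pos (Nat.le_of_dvd hn.1.1 hn.2) hd.1, Nat.div_le_div_right hn.1.2⟩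
  · intro m hm
    exact Nat.mul_div_cancel_left _ hd.1
  · intro n hn
    simp only [mem_Ioc, mem_filter] at hn
    exact Nat.mul_div_cancel' hn.2
  · intro m hm
    ring

open ArithmeticFunction in
lemma psi_bound (N : ℕ) : ∑ d ∈ Ioc 0 N, vonMangoldt d ≤ 6 * N := by
  have h := Chebyshev.psi_le_const_mul_self (x := (N : ℝ)) (by positivity)
  have h4 : Real.log 4 ≤ 2 := by
    rw [show (4 : ℝ) = 2 ^ 2 by norm_num, Real.log_pow]
    have := Real.log_two_lt_d9
    push_cast; linarith
  rw [Chebyshev.psi] at h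
  simp only [Nat.floor_natCast] at h
  refine h.trans ?_
  have : (0 : ℝ) ≤ N := by positivity
  nlinarith

open ArithmeticFunction in
lemma mertens_chi : ∃ C : ℝ, ∀ N : ℕ, |∑ d ∈ Ioc 0 N, vonMangoldt d * chi d / d| ≤ C := by
  -- bound for the log sum
  have hlog : ∀ N : ℕ, |∑ n ∈ Ioc 0 N, chi n * (1 / (n : ℝ)) * Real.log n| ≤ 4 := by
    intro N
    have hf : ∀ n : ℕ, 3 ≤ n → Real.log (n + 1 : ℕ) / (n + 1 : ℕ) ≤ Real.log n / n := by
      intro n hn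
      have he := Real.exp_one_lt_d9
      have h3 : (3 : ℝ) ≤ n := by exact_mod_cast hn
      apply Real.log_div_self_antitoneOn
      · simp; linarith
      · simp; linarith
      · push_cast; linarith
    have h3 : Real.log 3 ≤ 2 := by
      have := Real.log_le_sub_one_of_pos (show (0 : ℝ) < 3 by norm_num)
      linarith
    have h3' : 0 ≤ Real.log 3 := Real.log_nonneg (by norm_num)
    by_cases h : 3 ≤ N
    · rw [← Finset.sum_Ioc_consecutive _ (Nat.zero_le 3) h]
      have e3 : ∑ n ∈ Ioc 0 3, chi n * (1 / (n : ℝ)) * Real.log n = -(Real.log 3 / 3) := by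
        simp [Finset.sum_Ioc_succ_top, chi_eq]; ring
      have b := chi_sum_bound (fun n => Real.log n / n) 3 N h hf (fun n hn => by positivity)
      have : ∑ n ∈ Ioc 3 N, chi n * (1 / (n : ℝ)) * Real.log n
          = ∑ n ∈ Ioc 3 N, chi n * (Real.log n / n) := by
        apply Finset.sum_congr rfl; intros; ring
      rw [e3, this]
      rw [abs_le] at b ⊢
      push_cast at b
      constructor <;> linarith [b.1, b.2]
    · have : N = 0 ∨ N = 1 ∨ N = 2 := by omega
      rcases this with rfl | rfl | rfl <;> simp [Finset.sum_Ioc_succ_top, chi_eq]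
  refine ⟨6 * (4 + 24), fun N => ?_⟩
  rcases Nat.eq_zero_or_pos N with rfl | hN
  · simp; norm_num
  have hNr : (0 : ℝ) < N := by exact_mod_cast hN
  have h1 := dsum (fun n => chi n * (1 / (n : ℝ))) N
  have h2 : ∑ d ∈ Ioc 0 N, vonMangoldt d * ∑ m ∈ Ioc 0 (N / d), chi (d * m) * (1 / ((d * m : ℕ) : ℝ))
      = ∑ d ∈ Ioc 0 N, vonMangoldt d * chi d / d * Lsum (N / d) := by
    apply Finset.sum_congr rfl
    intro d hd
    rw [Lsum, Finset.mul_sum, Finset.mul_sum]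
    apply Finset.sum_congr rfl
    intro m hm
    rw [chi_mul]; push_cast
    rw [one_div, mul_inv]
    ring
  rw [h2] at h1
  have h3 : ∑ d ∈ Ioc 0 N, vonMangoldt d * chi d / d * Lsum N =
      ∑ n ∈ Ioc 0 N, chi n * (1 / (n : ℝ)) * Real.log n +
      ∑ d ∈ Ioc 0 N, vonMangoldt d * chi d / d * (Lsum N - Lsum (N / d)) := by
    rw [h1, ← Finset.sum_add_distrib]
    apply Finset.sum_congr rfl; intros; ring
  have h4 : |∑ d ∈ Ioc 0 N, vonMangoldt d * chi d / d * (Lsum N - Lsum (N / d))| ≤ 24 := by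
    calc _ ≤ ∑ d ∈ Ioc 0 N, |vonMangoldt d * chi d / d * (Lsum N - Lsum (N / d))| :=
          Finset.abs_sum_le_sum_abs _ _
      _ ≤ ∑ d ∈ Ioc 0 N, vonMangoldt d * (4 / N) := by
          apply Finset.sum_le_sum
          intro d hd
          simp only [mem_Ioc] at hd
          have hdr : (0 : ℝ) < d := by exact_mod_cast hd.1
          have hq : 1 ≤ N / d := Nat.div_pos hd.2 hd.1
          have b := Lsum_sub (N / d) N hq (Nat.div_le_self _ _)
          have hq2 : N < 2 * (d * (N / d)) := by
            have e := Nat.div_add_mod N d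
            have e2 := Nat.mod_lt N hd.1
            have : d ≤ d * (N / d) := Nat.le_mul_of_pos_right _ hq
            omega
          have hq2' : (N : ℝ) ≤ 2 * (d * (N / d : ℕ)) := by exact_mod_cast hq2.le
          have hqr : (0 : ℝ) < (N / d : ℕ) := by exact_mod_cast hq
          rw [abs_mul, abs_div, abs_mul, abs_of_nonneg vonMangoldt_nonneg, abs_of_pos hdr]
          have : vonMangoldt d * |chi d| / d * |Lsum N - Lsum (N / d)| ≤
              vonMangoldt d * 1 / d * (2 / (N / d : ℕ)) := by
            have := chi_abs d
            have v : 0 ≤ vonMangoldt d := vonMangoldt_nonneg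
            gcongr
          refine this.trans ?_
          have v : 0 ≤ vonMangoldt d := vonMangoldt_nonneg
          rw [mul_one, div_mul_eq_mul_div, mul_div_assoc]
          apply mul_le_mul_of_nonneg_left _ v
          rw [div_div, div_le_div_iff₀ (by positivity) hNr]
          nlinarith
      _ ≤ 24 := by
          rw [← Finset.sum_mul]
          have := psi_bound N
          calc _ ≤ 6 * (N : ℝ) * (4 / N) := by gcongr
            _ = 24 := by field_simp; norm_num
  rw [← Finset.sum_mul] at h3
  have hL := Lsum_pos N hN
  have h5 : |∑ d ∈ Ioc 0 N, vonMangoldt d * chi d / d| * Lsum N ≤ 4 + 24 := by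
    rw [← abs_of_pos (by linarith : 0 < Lsum N), ← abs_mul, h3]
    exact (abs_add_le _ _).trans (add_le_add (hlog N) h4)
  nlinarith [abs_nonneg (∑ d ∈ Ioc 0 N, vonMangoldt d * chi d / d)]

open ArithmeticFunction in
lemma mertens_one : ∃ C : ℝ, ∀ N : ℕ, 1 ≤ N →
    |∑ d ∈ Ioc 0 N, vonMangoldt d / d - Real.log N| ≤ C := by
  refine ⟨6, fun N hN => ?_⟩
  have hNr : (0 : ℝ) < N := by exact_mod_cast hN
  have h1 := dsum (fun n => 1) N
  simp only [one_mul, sum_const, Nat.card_Ioc, Nat.sub_zero, nsmul_eq_mul, mul_one] at h1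
  have hfac : ∑ n ∈ Ioc 0 N, Real.log n = Real.log (N.factorial) := by
    clear h1 hNr
    induction N, hN using Nat.le_induction with
    | base => simp
    | succ n hn ih =>
      rw [Finset.sum_Ioc_succ_top (by omega), ih, Nat.factorial_succ, Nat.cast_mul,
        Real.log_mul (by positivity) (by positivity)]
      ring
  have hub : Real.log (N.factorial) ≤ N * Real.log N := by
    rw [← Real.log_pow]
    apply Real.log_le_log (by positivity)
    exact_mod_cast Nat.factorial_le_pow N
  have hlb : N * Real.log N - N ≤ Real.log (N.factorial) := by
    have h : (N : ℝ) ^ N / N.factorial ≤ Real.exp N := Real.pow_div_factorial_le_exp N (by positivity) N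
    have h2 : (N : ℝ) ^ N ≤ Real.exp N * N.factorial := by
      rwa [div_le_iff₀ (by positivity)] at h
    have h3 := Real.log_le_log (by positivity) h2
    rw [Real.log_pow, Real.log_mul (by positivity) (by positivity), Real.log_exp] at h3
    linarith
  have u : ∑ d ∈ Ioc 0 N, vonMangoldt d * ((N / d : ℕ) : ℝ) ≤ N * ∑ d ∈ Ioc 0 N, vonMangoldt d / d := by
    rw [Finset.mul_sum]
    apply Finset.sum_le_sum
    intro d hd
    have v : 0 ≤ vonMangoldt d := vonMangoldt_nonneg
    calc _ ≤ vonMangoldt d * ((N : ℝ) / d) := by gcongr; exact Nat.cast_div_le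
      _ = _ := by ring
  have l : N * ∑ d ∈ Ioc 0 N, vonMangoldt d / d - ∑ d ∈ Ioc 0 N, vonMangoldt d ≤
      ∑ d ∈ Ioc 0 N, vonMangoldt d * ((N / d : ℕ) : ℝ) := by
    rw [Finset.mul_sum, ← Finset.sum_sub_distrib]
    apply Finset.sum_le_sum
    intro d hd
    simp only [mem_Ioc] at hd
    have hdr : (0 : ℝ) < d := by exact_mod_cast hd.1
    have v : 0 ≤ vonMangoldt d := vonMangoldt_nonneg
    have : (N : ℝ) / d ≤ (N / d : ℕ) + 1 := by
      rw [div_le_iff₀ hdr]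
      have e : N ≤ (N / d + 1) * d := by
        have e := Nat.div_add_mod N d
        have e2 := Nat.mod_lt N hd.1
        nlinarith
      exact_mod_cast e
    calc _ = vonMangoldt d * ((N : ℝ) / d - 1) := by ring
      _ ≤ _ := by gcongr; linarith
  have p := psi_bound N
  rw [← h1, hfac] at u l
  rw [abs_le]
  constructor
  · have : N * (-6) ≤ N * (∑ d ∈ Ioc 0 N, vonMangoldt d / d - Real.log N) := by linarith
    exact le_of_mul_le_mul_left this hNr
  · have : N * (∑ d ∈ Ioc 0 N, vonMangoldt d / d - Real.log N) ≤ N * 6 := by linarith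
    exact le_of_mul_le_mul_left this hNr
end STS

namespace STS
open Finset

open ArithmeticFunction in
lemma nonprime_bound : ∃ C : ℝ, ∀ N : ℕ,
    ∑ n ∈ Ioc 0 N, (if n.Prime then 0 else vonMangoldt n) / n ≤ C := by
  have h := vonMangoldt.summable_residueClass_non_primes_div (q := 1) (0 : ZMod 1)
  have e : (fun n : ℕ ↦ (if n.Prime then 0 else vonMangoldt.residueClass (0 : ZMod 1) n) / (n : ℝ)) =
      fun n : ℕ => (if n.Prime then 0 else vonMangoldt n) / (n : ℝ) := by
    funext n
    have : vonMangoldt.residueClass (0 : ZMod 1) n = vonMangoldt n := by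
      rw [vonMangoldt.residueClass, Set.indicator_of_mem]
      exact Subsingleton.elim _ _
    rw [this]
  rw [e] at h
  refine ⟨∑' n : ℕ, (if n.Prime then 0 else vonMangoldt n) / (n : ℝ), fun N => ?_⟩
  apply h.sum_le_tsum
  intro n _
  have : 0 ≤ vonMangoldt n := vonMangoldt_nonneg
  split_ifs <;> positivity

open ArithmeticFunction in
lemma prime_first (c : ℕ → ℝ) (hc : ∀ n, |c n| ≤ 1) (α C : ℝ)
    (h : ∀ N : ℕ, 1 ≤ N → |∑ d ∈ Ioc 0 N, vonMangoldt d * c d / d - α * Real.log N| ≤ C) :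
    ∃ C' : ℝ, ∀ N : ℕ, 1 ≤ N →
      |∑ n ∈ Ioc 0 N, (if n.Prime then Real.log n * c n / n else 0) - α * Real.log N| ≤ C' := by
  obtain ⟨C0, h0⟩ := nonprime_bound
  refine ⟨C + C0, fun N hN => ?_⟩
  have e : ∑ n ∈ Ioc 0 N, (if n.Prime then Real.log n * c n / n else 0) - α * Real.log N =
      (∑ d ∈ Ioc 0 N, vonMangoldt d * c d / d - α * Real.log N) -
      ∑ n ∈ Ioc 0 N, (if n.Prime then 0 else vonMangoldt n) / n * c n := by
    rw [sub_right_comm, ← Finset.sum_sub_distrib]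
    congr 1
    apply Finset.sum_congr rfl
    intro n _
    by_cases hp : n.Prime
    · simp [hp, vonMangoldt_apply_prime hp]
    · simp [hp]; ring
  rw [e]
  refine (abs_sub _ _).trans (add_le_add (h N hN) ?_)
  refine (Finset.abs_sum_le_sum_abs _ _).trans (le_trans ?_ (h0 N))
  apply Finset.sum_le_sum
  intro n _
  have : 0 ≤ (if n.Prime then 0 else vonMangoldt n) / (n : ℝ) := by
    have : 0 ≤ vonMangoldt n := vonMangoldt_nonneg
    split_ifs <;> positivity
  rw [abs_mul, abs_of_nonneg this]
  exact mul_le_of_le_one_right this (hc n)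

lemma prime_second (c : ℕ → ℝ) (α C : ℝ)
    (h : ∀ N : ℕ, 1 ≤ N →
      |∑ n ∈ Ioc 0 N, (if n.Prime then Real.log n * c n / n else 0) - α * Real.log N| ≤ C)
    (M N : ℕ) (hM : 2 ≤ M) (hMN : M ≤ N) :
    |∑ n ∈ Ioc M N, (if n.Prime then c n / n else 0) -
      α * ∑ n ∈ Ioc M N, (Real.log n - Real.log (n - 1 : ℕ)) / Real.log n| ≤ 2 * C * (1 / Real.log M) := by
  have hlog : ∀ n : ℕ, 2 ≤ n → 0 < Real.log n := fun n hn =>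
    Real.log_pos (by exact_mod_cast (by omega : 1 < n))
  have := abel_bound
    (fun N => ∑ n ∈ Ioc 0 N, (if n.Prime then Real.log n * c n / n else 0) - α * Real.log N)
    (fun n => 1 / Real.log n) C M N hMN (fun n hn => h n (by omega))
    (fun n hn => by
      apply one_div_le_one_div_of_le (hlog n (by omega))
      apply Real.log_le_log
      · exact_mod_cast (by omega : 0 < n)
      · push_cast; linarith)
    (fun n hn => (one_div_pos.mpr (hlog n (by omega))).le)
  convert this using 2
  rw [Finset.mul_sum, ← Finset.sum_sub_distrib]
  apply Finset.sum_congr rfl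
  intro n hn
  simp only [mem_Ioc] at hn
  obtain ⟨k, rfl⟩ : ∃ k, n = k + 1 := ⟨n - 1, by omega⟩
  rw [Nat.add_sub_cancel, Finset.sum_Ioc_succ_top (Nat.zero_le k)]
  have := hlog (k + 1) (by omega)
  by_cases hp : (k + 1).Prime
  · simp only [hp, if_true]
    field_simp
    ring
  · simp only [hp, if_false]
    field_simp
    ring

lemma loglog_sum (M N : ℕ) (hM : 2 ≤ M) (hMN : M ≤ N) :
    ∑ n ∈ Ioc M N, (Real.log n - Real.log (n - 1 : ℕ)) / Real.log n ≤
      Real.log (Real.log N) - Real.log (Real.log M) := by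
  induction N, hMN using Nat.le_induction with
  | base => simp
  | succ N hN ih =>
    rw [Finset.sum_Ioc_succ_top (by omega), Nat.add_sub_cancel]
    have h1 : 0 < Real.log N := Real.log_pos (by exact_mod_cast (by omega : 1 < N))
    have h2 : 0 < Real.log (N + 1 : ℕ) := Real.log_pos (by exact_mod_cast (by omega : 1 < N + 1))
    have h3 := Real.log_le_sub_one_of_pos (div_pos h1 h2)
    rw [Real.log_div h1.ne' h2.ne'] at h3
    have : (Real.log (N + 1 : ℕ) - Real.log N) / Real.log (N + 1 : ℕ) =
      1 - Real.log N / Real.log (N + 1 : ℕ) := by field_simp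
    rw [this]; linarith

/-- primes in the real interval `(a, b]` -/
noncomputable def Pr (a b : ℝ) : Finset ℕ := (Ioc ⌊a⌋₊ ⌊b⌋₊).filter Nat.Prime

lemma mem_Pr {a b : ℝ} (ha : 0 ≤ a) (hb : 0 ≤ b) {p : ℕ} :
    p ∈ Pr a b ↔ (a < p ∧ (p : ℝ) ≤ b) ∧ p.Prime := by
  rw [Pr, mem_filter, mem_Ioc, Nat.floor_lt ha, Nat.le_floor_iff hb]

lemma Pr_sum (c : ℕ → ℝ) (a b : ℝ) : ∑ p ∈ Pr a b, c p / p =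
    ∑ n ∈ Ioc ⌊a⌋₊ ⌊b⌋₊, (if n.Prime then c n / n else 0) := by
  rw [Pr, Finset.sum_filter]

lemma mertens2_one : ∃ C : ℝ, 0 < C ∧ ∀ a b : ℝ, 2 ≤ a → a ≤ b →
    ∑ p ∈ Pr a b, 1 / (p : ℝ) ≤ Real.log (Real.log b / Real.log a) + C := by
  obtain ⟨C, hC⟩ := mertens_one
  obtain ⟨C', hC'⟩ := prime_first (fun _ => 1) (by simp) 1 C (by simpa using hC)
  have hC0 : 0 ≤ C' := (abs_nonneg _).trans (hC' 1 le_rfl)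
  have hl2 : 0 < Real.log 2 := Real.log_pos (by norm_num)
  refine ⟨2 * C' * (1 / Real.log 2) + Real.log 2, by positivity, fun a b ha hab => ?_⟩
  have hM : 2 ≤ ⌊a⌋₊ := Nat.le_floor (by exact_mod_cast ha)
  have hMN : ⌊a⌋₊ ≤ ⌊b⌋₊ := Nat.floor_mono hab
  have h := prime_second (fun _ => 1) 1 C' hC' _ _ hM hMN
  rw [← Pr_sum, one_mul] at h
  have h2 := loglog_sum _ _ hM hMN
  have hMr : (2 : ℝ) ≤ ⌊a⌋₊ := by exact_mod_cast hM
  have hNr : (2 : ℝ) ≤ ⌊b⌋₊ := by exact_mod_cast hM.trans hMN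
  have hlM : Real.log 2 ≤ Real.log ⌊a⌋₊ := Real.log_le_log (by norm_num) hMr
  have hlN : Real.log 2 ≤ Real.log ⌊b⌋₊ := Real.log_le_log (by norm_num) hNr
  have hla : 0 < Real.log a := Real.log_pos (by linarith)
  have hlb : 0 < Real.log b := Real.log_pos (by linarith)
  have h3 : Real.log (Real.log ⌊b⌋₊) ≤ Real.log (Real.log b) := by
    apply Real.log_le_log (by linarith)
    exact Real.log_le_log (by linarith) (Nat.floor_le (by linarith))
  have h4 : Real.log (Real.log a) ≤ Real.log (Real.log ⌊a⌋₊) + Real.log 2 := by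
    rw [← Real.log_mul (by linarith) (by norm_num)]
    apply Real.log_le_log hla
    rw [mul_comm, ← Nat.cast_two, ← Real.log_pow]
    apply Real.log_le_log (by linarith)
    have := Nat.lt_floor_add_one a
    nlinarith
  have h5 : 2 * C' * (1 / Real.log ⌊a⌋₊) ≤ 2 * C' * (1 / Real.log 2) := by
    gcongr
  rw [Real.log_div hlb.ne' hla.ne']
  have := (abs_le.mp h).2
  linarith

lemma mertens2_chi : ∃ C : ℝ, 0 < C ∧ ∀ a b : ℝ, 2 ≤ a → a ≤ b →
    |∑ p ∈ Pr a b, chi p / (p : ℝ)| ≤ C := by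
  obtain ⟨C, hC⟩ := mertens_chi
  obtain ⟨C', hC'⟩ := prime_first chi chi_abs 0 C (by simpa using fun N _ => hC N)
  have hC0 : 0 ≤ C' := (abs_nonneg _).trans (hC' 1 le_rfl)
  have hl2 : 0 < Real.log 2 := Real.log_pos (by norm_num)
  refine ⟨2 * C' * (1 / Real.log 2) + Real.log 2, by positivity, fun a b ha hab => ?_⟩
  have hM : 2 ≤ ⌊a⌋₊ := Nat.le_floor (by exact_mod_cast ha)
  have hMN : ⌊a⌋₊ ≤ ⌊b⌋₊ := Nat.floor_mono hab
  have h := prime_second chi 0 C' hC' _ _ hM hMN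
  rw [← Pr_sum, zero_mul, sub_zero] at h
  have hMr : (2 : ℝ) ≤ ⌊a⌋₊ := by exact_mod_cast hM
  have hlM : Real.log 2 ≤ Real.log ⌊a⌋₊ := Real.log_le_log (by norm_num) hMr
  have h5 : 2 * C' * (1 / Real.log ⌊a⌋₊) ≤ 2 * C' * (1 / Real.log 2) := by
    gcongr
  linarith
end STS

namespace STS
open Finset

/-- elementary symmetric sums -/
noncomputable def es (g : ℕ → ℝ) (k : ℕ) (P : Finset ℕ) : ℝ := ∑ T ∈ powersetCard k P, ∏ p ∈ T, g p

lemma es_zero (g : ℕ → ℝ) (P : Finset ℕ) : es g 0 P = 1 := by simp [es]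

lemma es_succ_insert (g : ℕ → ℝ) (k : ℕ) (P : Finset ℕ) (p : ℕ) (hp : p ∉ P) :
    es g (k + 1) (insert p P) = es g (k + 1) P + g p * es g k P := by
  rw [es, powersetCard_succ_insert hp, sum_union, sum_image]
  · congr 1
    rw [es, mul_sum]
    apply sum_congr rfl
    intro T hT
    rw [prod_insert]
    exact fun h => hp ((mem_powersetCard.mp hT).1 h)
  · intro T hT T' hT' h
    have h1 : p ∉ T := fun h => hp ((mem_powersetCard.mp hT).1 h)
    have h2 : p ∉ T' := fun h => hp ((mem_powersetCard.mp hT').1 h)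
    rw [← erase_insert h1, h, erase_insert h2]
  · rw [disjoint_left]
    intro T hT hT'
    obtain ⟨T', _, rfl⟩ := mem_image.mp hT'
    exact hp ((mem_powersetCard.mp hT).1 (mem_insert_self _ _))

lemma pc_empty (k : ℕ) : powersetCard (k + 1) (∅ : Finset ℕ) = ∅ :=
  powersetCard_eq_empty.mpr (by simp)

lemma es_nonneg (g : ℕ → ℝ) (k : ℕ) (P : Finset ℕ) (hg : ∀ p ∈ P, 0 ≤ g p) : 0 ≤ es g k P :=
  sum_nonneg fun _ hT => prod_nonneg fun p hp => hg p ((mem_powersetCard.mp hT).1 hp)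

lemma pow_add_le (G b : ℝ) (hG : 0 ≤ G) (hb : 0 ≤ b) (k : ℕ) :
    G ^ (k + 1) + (k + 1) * b * G ^ k ≤ (G + b) ^ (k + 1) := by
  induction k with
  | zero => simp
  | succ k ih =>
    have h1 : (G ^ (k + 1) + (k + 1) * b * G ^ k) * (G + b) ≤ (G + b) ^ (k + 1) * (G + b) :=
      mul_le_mul_of_nonneg_right ih (by linarith)
    have h2 : 0 ≤ (k + 1) * b * G ^ k * b := by positivity
    rw [pow_succ (G + b) (k + 1)]
    push_cast
    have e : G ^ (k + 1 + 1) + (k + 1 + 1) * b * G ^ (k + 1) =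
      (G ^ (k + 1) + (k + 1) * b * G ^ k) * (G + b) - (k + 1) * b * G ^ k * b := by ring
    linarith

lemma es_le (g : ℕ → ℝ) (P : Finset ℕ) (hg : ∀ p ∈ P, 0 ≤ g p) (k : ℕ) :
    es g k P ≤ (∑ p ∈ P, g p) ^ k / k.factorial := by
  induction P using Finset.induction_on generalizing k with
  | empty =>
    cases k with
    | zero => simp [es]
    | succ k => simp [es, pc_empty]
  | insert p P hp ih =>
    have hg' : ∀ p ∈ P, 0 ≤ g p := fun p h => hg p (mem_insert_of_mem h)
    have hgp := hg p (mem_insert_self _ _)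
    cases k with
    | zero => simp [es]
    | succ k =>
      rw [es_succ_insert g k P p hp, sum_insert hp]
      have h1 := ih hg' (k + 1)
      have h2 := ih hg' k
      have h3 := pow_add_le (∑ p ∈ P, g p) (g p) (sum_nonneg hg') hgp k
      have h4 := mul_le_mul_of_nonneg_left h2 hgp
      have hf : (0 : ℝ) < k.factorial := by positivity
      have e : ((k + 1).factorial : ℝ) = (k + 1) * k.factorial := by
        rw [Nat.factorial_succ]; push_cast; ring
      rw [e] at h1 ⊢
      calc _ ≤ (∑ p ∈ P, g p) ^ (k + 1) / ((k + 1) * k.factorial) +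
            g p * ((∑ p ∈ P, g p) ^ k / k.factorial) := add_le_add h1 h4
        _ = ((∑ p ∈ P, g p) ^ (k + 1) + (k + 1) * g p * (∑ p ∈ P, g p) ^ k) /
            ((k + 1) * k.factorial) := by field_simp
        _ ≤ _ := by
            rw [add_comm (g p)]
            gcongr

/-- truncated inclusion-exclusion -/
noncomputable def pe (g : ℕ → ℝ) (r : ℕ) (P : Finset ℕ) : ℝ :=
  ∑ k ∈ range (r + 1), (-1 : ℝ) ^ k * es g k P

lemma pe_succ (g : ℕ → ℝ) (r : ℕ) (P : Finset ℕ) :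
    pe g (r + 1) P = pe g r P + (-1 : ℝ) ^ (r + 1) * es g (r + 1) P := by
  rw [pe, sum_range_succ, ← pe]

lemma pe_insert (g : ℕ → ℝ) (r : ℕ) (P : Finset ℕ) (p : ℕ) (hp : p ∉ P) :
    pe g (r + 1) (insert p P) = pe g (r + 1) P - g p * pe g r P := by
  induction r with
  | zero =>
    rw [pe_succ, pe_succ, es_succ_insert g 0 P p hp]
    simp [pe, es_zero]
    ring
  | succ r ih =>
    rw [pe_succ, ih, pe_succ g (r + 1) P, es_succ_insert _ _ _ _ hp, pe_succ g r P]
    ring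

lemma bonf (g : ℕ → ℝ) (P : Finset ℕ) (hg : ∀ p ∈ P, 0 ≤ g p) (r : ℕ) :
    (∀ p ∈ P, g p ≤ 1) →
    0 ≤ (-1 : ℝ) ^ r * (pe g r P - ∏ p ∈ P, (1 - g p)) ∧
    (-1 : ℝ) ^ r * (pe g r P - ∏ p ∈ P, (1 - g p)) ≤ es g (r + 1) P := by
  induction P using Finset.induction_on generalizing r with
  | empty =>
    intro _
    have h : pe g r ∅ = 1 := by
      induction r with
      | zero => simp [pe, es]
      | succ r ih => rw [pe_succ, ih]; simp [es, pc_empty]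
    rw [h]; simp [es, pc_empty]
  | insert p P hp ih =>
    intro hg1
    have hg' : ∀ p ∈ P, 0 ≤ g p := fun p h => hg p (mem_insert_of_mem h)
    have hg1' : ∀ p ∈ P, g p ≤ 1 := fun p h => hg1 p (mem_insert_of_mem h)
    have hgp := hg p (mem_insert_self _ _)
    rw [prod_insert hp, es_succ_insert _ _ _ _ hp]
    cases r with
    | zero =>
      have h := ih hg' 0 hg1'
      have e : pe g 0 (insert p P) = 1 := by simp [pe, es_zero]
      have e' : pe g 0 P = 1 := by simp [pe, es_zero]
      rw [e] ; rw [e'] at h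
      rw [es_zero]
      have v0 : 0 ≤ ∏ p ∈ P, (1 - g p) := prod_nonneg fun p h => by linarith [hg1' p h]
      have v1 : ∏ p ∈ P, (1 - g p) ≤ 1 := prod_le_one (fun p h => by linarith [hg1' p h])
        (fun p h => by linarith [hg' p h])
      simp only [pow_zero, one_mul] at h ⊢
      constructor <;> nlinarith [h.1, h.2]
    | succ r =>
      have h1 := ih hg' (r + 1) hg1'
      have h2 := ih hg' r hg1'
      rw [pe_insert g r P p hp]
      have e : (-1 : ℝ) ^ (r + 1) * (pe g (r + 1) P - g p * pe g r P - (1 - g p) * ∏ p ∈ P, (1 - g p))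
        = (-1 : ℝ) ^ (r + 1) * (pe g (r + 1) P - ∏ p ∈ P, (1 - g p)) +
          g p * ((-1 : ℝ) ^ r * (pe g r P - ∏ p ∈ P, (1 - g p))) := by ring
      rw [e]
      constructor
      · exact add_nonneg h1.1 (mul_nonneg hgp h2.1)
      · exact add_le_add h1.2 (mul_le_mul_of_nonneg_left h2.2 hgp)

/-- admissible subsets -/
def Qs (r : ℕ) (P : Finset ℕ) : Finset (Finset ℕ) := P.powerset.filter (fun T => T.card ≤ r + 1)

/-- upper coefficients -/
noncomputable def cU (r : ℕ) (T : Finset ℕ) : ℝ := if T.card ≤ r then (-1 : ℝ) ^ T.card else 0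
/-- remainder coefficients -/
noncomputable def cW (r : ℕ) (T : Finset ℕ) : ℝ := if T.card = r + 1 then 1 else 0

lemma sum_cU (g : ℕ → ℝ) (r : ℕ) (P : Finset ℕ) :
    ∑ T ∈ Qs r P, cU r T * ∏ p ∈ T, g p = pe g r P := by
  have : ∑ T ∈ Qs r P, cU r T * ∏ p ∈ T, g p =
      ∑ T ∈ P.powerset.filter (fun T => T.card ≤ r), (-1 : ℝ) ^ T.card * ∏ p ∈ T, g p := by
    rw [Qs, sum_filter, sum_filter]
    apply sum_congr rfl
    intro T _
    rw [cU]
    split_ifs <;> first | rfl | omega | simp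
  rw [this, ← sum_fiberwise_of_maps_to (t := range (r + 1)) (g := Finset.card)]
  · rw [pe]
    apply sum_congr rfl
    intro k hk
    rw [es, mul_sum]
    have hk' := mem_range.mp hk
    rw [powersetCard_eq_filter, filter_filter]
    apply sum_congr
    · apply filter_congr
      intro T _
      constructor
      · exact fun h => h.2
      · exact fun h => ⟨by omega, h⟩
    · intro T hT
      rw [(mem_filter.mp hT).2]
  · intro T hT
    simp only [mem_filter] at hT
    exact mem_range.mpr (by omega)

lemma sum_cW (g : ℕ → ℝ) (r : ℕ) (P : Finset ℕ) :
    ∑ T ∈ Qs r P, cW r T * ∏ p ∈ T, g p = es g (r + 1) P := by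
  rw [Qs, sum_filter, es, powersetCard_eq_filter, sum_filter]
  apply sum_congr rfl
  intro T _
  rw [cW]
  split_ifs <;> first | rfl | omega | simp

lemma prod_hooley {ι : Type*} [DecidableEq ι] (s : Finset ι) (a U W : ι → ℝ)
    (h0 : ∀ i ∈ s, 0 ≤ a i) (h1 : ∀ i ∈ s, a i ≤ U i) (h2 : ∀ i ∈ s, U i ≤ a i + W i) :
    ∏ i ∈ s, U i ≤ ∏ i ∈ s, a i + ∑ i ∈ s, ∏ l ∈ s, (if l = i then W l else U l) := by
  induction s using Finset.induction_on with
  | empty => simp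
  | insert j s hj ih =>
    have ih' := ih (fun i hi => h0 i (mem_insert_of_mem hi)) (fun i hi => h1 i (mem_insert_of_mem hi))
      (fun i hi => h2 i (mem_insert_of_mem hi))
    have k0 := h0 j (mem_insert_self _ _)
    have k1 := h1 j (mem_insert_self _ _)
    have k2 := h2 j (mem_insert_self _ _)
    have hU : 0 ≤ ∏ i ∈ s, U i := prod_nonneg fun i hi =>
      (h0 i (mem_insert_of_mem hi)).trans (h1 i (mem_insert_of_mem hi))
    have hF : 0 ≤ ∑ i ∈ s, ∏ l ∈ s, (if l = i then W l else U l) := by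
      apply sum_nonneg; intro i hi
      apply prod_nonneg; intro l hl
      have := h0 l (mem_insert_of_mem hl)
      have := h1 l (mem_insert_of_mem hl)
      have := h2 l (mem_insert_of_mem hl)
      split_ifs <;> linarith
    rw [prod_insert hj, prod_insert hj, sum_insert hj, prod_insert hj, if_pos rfl]
    have e1 : ∏ l ∈ s, (if l = j then W l else U l) = ∏ l ∈ s, U l := by
      apply prod_congr rfl
      intro l hl
      rw [if_neg]; rintro rfl; exact hj hl
    have e2 : ∑ i ∈ s, ∏ l ∈ insert j s, (if l = i then W l else U l) =
        U j * ∑ i ∈ s, ∏ l ∈ s, (if l = i then W l else U l) := by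
      rw [mul_sum]
      apply sum_congr rfl
      intro i hi
      rw [prod_insert hj, if_neg]
      rintro rfl; exact hj hi
    rw [e1, e2]
    nlinarith [mul_le_mul_of_nonneg_left ih' k0, mul_le_mul_of_nonneg_right k2 hU,
      mul_le_mul_of_nonneg_right k1 hF]

section sieve
open Classical
variable {α ι : Type*} [Fintype ι]

lemma expand (Pts : Finset α) (bad : α → ℕ → Prop) (Pb : ι → Finset ℕ) (r : ι → ℕ) (g : ℕ → ℝ)
    (Y R : ℝ)
    (hcount : ∀ τ ∈ Fintype.piFinset (fun i => Qs (r i) (Pb i)),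
      |((Pts.filter (fun w => ∀ i, ∀ p ∈ τ i, bad w p)).card : ℝ) - Y * ∏ i, ∏ p ∈ τ i, g p| ≤ R)
    (c : ι → Finset ℕ → ℝ) (hc : ∀ i T, |c i T| ≤ 1) :
    |∑ w ∈ Pts, ∏ i, ∑ T ∈ Qs (r i) (Pb i), c i T * ∏ p ∈ T, (if bad w p then 1 else 0) -
      Y * ∏ i, ∑ T ∈ Qs (r i) (Pb i), c i T * ∏ p ∈ T, g p| ≤
    (∏ i, ((Qs (r i) (Pb i)).card : ℝ)) * R := by
  have h1 : ∑ w ∈ Pts, ∏ i, ∑ T ∈ Qs (r i) (Pb i), c i T * ∏ p ∈ T, (if bad w p then 1 else 0) =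
      ∑ τ ∈ Fintype.piFinset (fun i => Qs (r i) (Pb i)), (∏ i, c i (τ i)) *
        ((Pts.filter (fun w => ∀ i, ∀ p ∈ τ i, bad w p)).card : ℝ) := by
    simp_rw [prod_univ_sum]
    rw [sum_comm]
    apply sum_congr rfl
    intro τ _
    simp_rw [prod_mul_distrib]
    rw [← mul_sum]
    congr 1
    rw [card_filter]
    push_cast
    apply sum_congr rfl
    intro w _
    split_ifs with h
    · apply prod_eq_one
      intro i _
      apply prod_eq_one
      intro p hp
      rw [if_pos (h i p hp)]
    · push Not at h
      obtain ⟨i, p, hp, hb⟩ := h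
      apply prod_eq_zero (mem_univ i)
      apply prod_eq_zero hp
      rw [if_neg hb]
  have h2 : Y * ∏ i, ∑ T ∈ Qs (r i) (Pb i), c i T * ∏ p ∈ T, g p =
      ∑ τ ∈ Fintype.piFinset (fun i => Qs (r i) (Pb i)), (∏ i, c i (τ i)) *
        (Y * ∏ i, ∏ p ∈ τ i, g p) := by
    rw [prod_univ_sum, mul_sum]
    apply sum_congr rfl
    intro τ _
    rw [prod_mul_distrib]; ring
  rw [h1, h2, ← sum_sub_distrib]
  refine (abs_sum_le_sum_abs _ _).trans ?_
  calc _ ≤ ∑ τ ∈ Fintype.piFinset (fun i => Qs (r i) (Pb i)), R := by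
        apply sum_le_sum
        intro τ hτ
        rw [← mul_sub, abs_mul]
        have : |∏ i, c i (τ i)| ≤ 1 := by
          rw [abs_prod]
          exact prod_le_one (fun _ _ => abs_nonneg _) (fun i _ => hc i _)
        calc _ ≤ 1 * R := mul_le_mul this (hcount τ hτ) (abs_nonneg _) zero_le_one
          _ = R := one_mul R
    _ = _ := by
        rw [sum_const, nsmul_eq_mul, Fintype.card_piFinset]
        push_cast; rfl

lemma cU_abs (r : ℕ) (T : Finset ℕ) : |cU r T| ≤ 1 := by
  rw [cU]; split_ifs <;> simp
lemma cW_abs (r : ℕ) (T : Finset ℕ) : |cW r T| ≤ 1 := by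
  rw [cW]; split_ifs <;> simp

lemma good_eq (bad : α → ℕ → Prop) (Pb : ι → Finset ℕ) (w : α) :
    ∏ i, ∏ p ∈ Pb i, (1 - (if bad w p then (1 : ℝ) else 0)) =
      if (∀ i, ∀ p ∈ Pb i, ¬ bad w p) then 1 else 0 := by
  split_ifs with h
  · apply prod_eq_one; intro i _
    apply prod_eq_one; intro p hp
    rw [if_neg (h i p hp)]; simp
  · push Not at h
    obtain ⟨i, p, hp, hb⟩ := h
    apply prod_eq_zero (mem_univ i)
    apply prod_eq_zero hp
    rw [if_pos hb]; simp

theorem brun_upper (Pts : Finset α) (bad : α → ℕ → Prop) (Pb : ι → Finset ℕ) (r : ι → ℕ) (g : ℕ → ℝ)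
    (Y R : ℝ) (hY : 0 ≤ Y) (hr : ∀ i, Even (r i))
    (hg0 : ∀ i, ∀ p ∈ Pb i, 0 ≤ g p) (hg1 : ∀ i, ∀ p ∈ Pb i, g p ≤ 1)
    (hcount : ∀ τ ∈ Fintype.piFinset (fun i => Qs (r i) (Pb i)),
      |((Pts.filter (fun w => ∀ i, ∀ p ∈ τ i, bad w p)).card : ℝ) - Y * ∏ i, ∏ p ∈ τ i, g p| ≤ R)
    (ε : ι → ℝ) (hε : ∀ i, es g (r i + 1) (Pb i) ≤ ε i * ∏ p ∈ Pb i, (1 - g p)) :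
    ((Pts.filter (fun w => ∀ i, ∀ p ∈ Pb i, ¬ bad w p)).card : ℝ) ≤
      Y * (∏ i, ∏ p ∈ Pb i, (1 - g p)) * ∏ i, (1 + ε i) +
      (∏ i, ((Qs (r i) (Pb i)).card : ℝ)) * R := by
  have hex := expand Pts bad Pb r g Y R hcount (fun i => cU (r i)) (fun i => cU_abs (r i))
  simp_rw [sum_cU] at hex
  have h1 : ((Pts.filter (fun w => ∀ i, ∀ p ∈ Pb i, ¬ bad w p)).card : ℝ) ≤
      ∑ w ∈ Pts, ∏ i, pe (fun p => if bad w p then 1 else 0) (r i) (Pb i) := by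
    rw [card_filter]
    push_cast
    apply sum_le_sum
    intro w _
    rw [← good_eq bad Pb w]
    apply prod_le_prod
    · intro i _
      apply prod_nonneg; intro p _; split_ifs <;> simp
    · intro i _
      have := (bonf (fun p => if bad w p then (1 : ℝ) else 0) (Pb i)
        (fun p _ => by split_ifs <;> simp) (r i) (fun p _ => by split_ifs <;> simp)).1
      rw [(hr i).neg_one_pow, one_mul] at this
      linarith
  have h2 : ∏ i, pe g (r i) (Pb i) ≤ (∏ i, ∏ p ∈ Pb i, (1 - g p)) * ∏ i, (1 + ε i) := by
    rw [← prod_mul_distrib]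
    have hv : ∀ i, 0 ≤ ∏ p ∈ Pb i, (1 - g p) := fun i =>
      prod_nonneg fun p hp => by linarith [hg1 i p hp]
    apply prod_le_prod
    · intro i _
      have := (bonf g (Pb i) (hg0 i) (r i) (hg1 i)).1
      rw [(hr i).neg_one_pow, one_mul] at this
      linarith [hv i]
    · intro i _
      have := (bonf g (Pb i) (hg0 i) (r i) (hg1 i)).2
      rw [(hr i).neg_one_pow, one_mul] at this
      linarith [hε i]
  have h3 := mul_le_mul_of_nonneg_left h2 hY
  have h4 := (abs_le.mp hex).2
  rw [mul_assoc]
  linarith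

theorem brun_lower (Pts : Finset α) (bad : α → ℕ → Prop) (Pb : ι → Finset ℕ) (r : ι → ℕ) (g : ℕ → ℝ)
    (Y R : ℝ) (hY : 0 ≤ Y) (hr : ∀ i, Even (r i))
    (hg0 : ∀ i, ∀ p ∈ Pb i, 0 ≤ g p) (hg1 : ∀ i, ∀ p ∈ Pb i, g p ≤ 1)
    (hcount : ∀ τ ∈ Fintype.piFinset (fun i => Qs (r i) (Pb i)),
      |((Pts.filter (fun w => ∀ i, ∀ p ∈ τ i, bad w p)).card : ℝ) - Y * ∏ i, ∏ p ∈ τ i, g p| ≤ R)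
    (ε : ι → ℝ) (hε0 : ∀ i, 0 ≤ ε i)
    (hε : ∀ i, es g (r i + 1) (Pb i) ≤ ε i * ∏ p ∈ Pb i, (1 - g p)) :
    Y * (∏ i, ∏ p ∈ Pb i, (1 - g p)) * (1 - (∑ i, ε i) * ∏ i, (1 + ε i)) -
      (Fintype.card ι + 1) * ((∏ i, ((Qs (r i) (Pb i)).card : ℝ)) * R) ≤
    ((Pts.filter (fun w => ∀ i, ∀ p ∈ Pb i, ¬ bad w p)).card : ℝ) := by
  have hv : ∀ i, 0 ≤ ∏ p ∈ Pb i, (1 - g p) := fun i =>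
      prod_nonneg fun p hp => by linarith [hg1 i p hp]
  have hex := expand Pts bad Pb r g Y R hcount (fun i => cU (r i)) (fun i => cU_abs (r i))
  have hexW : ∀ i0, _ := fun i0 => expand Pts bad Pb r g Y R hcount
    (fun i => if i = i0 then cW (r i) else cU (r i))
    (fun i T => by split_ifs; exacts [cW_abs _ _, cU_abs _ _])
  simp_rw [sum_cU] at hex
  have conv : ∀ (f : ℕ → ℝ) (i0 i : ι),
      ∑ T ∈ Qs (r i) (Pb i), (if i = i0 then cW (r i) else cU (r i)) T * ∏ p ∈ T, f p =
      if i = i0 then es f (r i + 1) (Pb i) else pe f (r i) (Pb i) := by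
    intro f i0 i
    split_ifs
    · exact sum_cW _ _ _
    · exact sum_cU _ _ _
  simp_rw [conv] at hexW
  set N := ∏ i, ((Qs (r i) (Pb i)).card : ℝ)
  have h1 : ∑ w ∈ Pts, ∏ i, pe (fun p => if bad w p then 1 else 0) (r i) (Pb i) ≤
     ((Pts.filter (fun w => ∀ i, ∀ p ∈ Pb i, ¬ bad w p)).card : ℝ) +
     ∑ i0, ∑ w ∈ Pts, ∏ i, (if i = i0 then es (fun p => if bad w p then 1 else 0) (r i + 1) (Pb i)
       else pe (fun p => if bad w p then 1 else 0) (r i) (Pb i)) := by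
    rw [card_filter, sum_comm]
    push_cast
    rw [← sum_add_distrib]
    apply sum_le_sum
    intro w _
    rw [← good_eq bad Pb w]
    apply prod_hooley
    · intro i _
      apply prod_nonneg; intro p _; split_ifs <;> simp
    · intro i _
      have := (bonf (fun p => if bad w p then (1 : ℝ) else 0) (Pb i)
        (fun p _ => by split_ifs <;> simp) (r i) (fun p _ => by split_ifs <;> simp)).1
      rw [(hr i).neg_one_pow, one_mul] at this
      linarith
    · intro i _
      have := (bonf (fun p => if bad w p then (1 : ℝ) else 0) (Pb i)
        (fun p _ => by split_ifs <;> simp) (r i) (fun p _ => by split_ifs <;> simp)).2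
      rw [(hr i).neg_one_pow, one_mul] at this
      linarith
  have hpe0 : ∀ i, ∏ p ∈ Pb i, (1 - g p) ≤ pe g (r i) (Pb i) := by
    intro i
    have := (bonf g (Pb i) (hg0 i) (r i) (hg1 i)).1
    rw [(hr i).neg_one_pow, one_mul] at this
    linarith
  have hpe1 : ∀ i, pe g (r i) (Pb i) ≤ (∏ p ∈ Pb i, (1 - g p)) * (1 + ε i) := by
    intro i
    have := (bonf g (Pb i) (hg0 i) (r i) (hg1 i)).2
    rw [(hr i).neg_one_pow, one_mul] at this
    linarith [hε i]
  have h2 : ∏ i, ∏ p ∈ Pb i, (1 - g p) ≤ ∏ i, pe g (r i) (Pb i) :=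
    prod_le_prod (fun i _ => hv i) (fun i _ => hpe0 i)
  have h3 : ∀ i0, ∏ i, (if i = i0 then es g (r i + 1) (Pb i) else pe g (r i) (Pb i)) ≤
      (∏ i, ∏ p ∈ Pb i, (1 - g p)) * (ε i0 * ∏ i, (1 + ε i)) := by
    intro i0
    calc _ ≤ ∏ i, ((∏ p ∈ Pb i, (1 - g p)) * ((if i = i0 then ε i0 else 1) * (1 + ε i))) := by
          apply prod_le_prod
          · intro i _
            split_ifs
            · exact es_nonneg _ _ _ (hg0 i)
            · exact (hv i).trans (hpe0 i)
          · intro i _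
            split_ifs with h
            · subst h
              have a := hε i
              have b := hv i
              have c := hε0 i
              nlinarith [mul_nonneg b (mul_nonneg c c)]
            · rw [one_mul]; exact hpe1 i
      _ = _ := by
          rw [prod_mul_distrib, prod_mul_distrib, Fintype.prod_ite_eq']
  have h4 : ∑ i0, ∑ w ∈ Pts, ∏ i, (if i = i0 then es (fun p => if bad w p then 1 else 0) (r i + 1) (Pb i)
       else pe (fun p => if bad w p then 1 else 0) (r i) (Pb i)) ≤
      ∑ i0 : ι, (Y * ((∏ i, ∏ p ∈ Pb i, (1 - g p)) * (ε i0 * ∏ i, (1 + ε i))) + N * R) := by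
    apply sum_le_sum
    intro i0 _
    have := (abs_le.mp (hexW i0)).2
    have := mul_le_mul_of_nonneg_left (h3 i0) hY
    linarith
  rw [sum_add_distrib, sum_const, ← mul_sum, ← mul_sum, ← sum_mul, nsmul_eq_mul, card_univ] at h4
  have h5 := (abs_le.mp hex).1
  have h6 := mul_le_mul_of_nonneg_left h2 hY
  have e : Y * (∏ i, ∏ p ∈ Pb i, (1 - g p)) * (1 - (∑ i, ε i) * ∏ i, (1 + ε i)) =
    Y * (∏ i, ∏ p ∈ Pb i, (1 - g p)) -
     Y * ((∏ i, ∏ p ∈ Pb i, (1 - g p)) * ((∑ i, ε i) * ∏ i, (1 + ε i))) := by ring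
  rw [e]
  linarith
end sieve
end STS

namespace STS
open Finset
section count
open Classical

/-- periodicity of a family of conditions -/
def Per (C : ℕ → ℕ → ℕ → Prop) : Prop :=
  ∀ p u v u' v', u ≡ u' [MOD p] → v ≡ v' [MOD p] → (C p u v ↔ C p u' v')

/-- number of residue pairs satisfying the condition -/
noncomputable def kap (C : ℕ → ℕ → ℕ → Prop) (p : ℕ) : ℕ :=
  ((range p ×ˢ range p).filter (fun w => C p w.1 w.2)).card

/-- residue pairs mod `d` satisfying all conditions -/
noncomputable def SS (C : ℕ → ℕ → ℕ → Prop) (d : ℕ) (T : Finset ℕ) : Finset (ℕ × ℕ) :=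
  (range d ×ˢ range d).filter (fun w => ∀ p ∈ T, C p w.1 w.2)

lemma kap_le (C : ℕ → ℕ → ℕ → Prop) (p : ℕ) : kap C p ≤ p ^ 2 := by
  refine (card_filter_le _ _).trans ?_
  simp [sq]

lemma SS_card (C : ℕ → ℕ → ℕ → Prop) (hC : Per C) (T : Finset ℕ) (hT : ∀ p ∈ T, p.Prime) :
    (SS C (∏ p ∈ T, p) T).card = ∏ p ∈ T, kap C p := by
  induction T using Finset.induction_on with
  | empty => simp [SS]
  | insert p T hp ih =>
    have hpp := hT p (mem_insert_self _ _)
    have hT' : ∀ q ∈ T, q.Prime := fun q hq => hT q (mem_insert_of_mem hq)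
    rw [prod_insert hp, prod_insert hp, ← ih hT', kap, ← card_product]
    set d := ∏ q ∈ T, q with hd
    have hd0 : 0 < d := prod_pos fun q hq => (hT' q hq).pos
    have hcop : Nat.Coprime p d := by
      apply Nat.Coprime.prod_right
      intro q hq
      rw [Nat.coprime_primes hpp (hT' q hq)]
      rintro rfl; exact hp hq
    have hdvd : ∀ q ∈ T, q ∣ d := fun q hq => dvd_prod_of_mem _ hq
    apply card_bij (fun w _ => ((w.1 % p, w.2 % p), (w.1 % d, w.2 % d)))
    · rintro ⟨a, b⟩ hw
      simp only [SS, mem_filter, mem_product, mem_range, mem_insert, forall_eq_or_imp] at hw ⊢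
      refine ⟨⟨⟨Nat.mod_lt _ hpp.pos, Nat.mod_lt _ hpp.pos⟩, ?_⟩,
        ⟨Nat.mod_lt _ hd0, Nat.mod_lt _ hd0⟩, ?_⟩
      · exact (hC p _ _ _ _ (Nat.mod_modEq a p) (Nat.mod_modEq b p)).mpr hw.2.1
      · intro q hq
        exact (hC q _ _ _ _ ((Nat.mod_modEq a d).of_dvd (hdvd q hq))
          ((Nat.mod_modEq b d).of_dvd (hdvd q hq))).mpr (hw.2.2 q hq)
    · rintro ⟨a, b⟩ hw ⟨a', b'⟩ hw' h
      simp only [SS, mem_filter, mem_product, mem_range] at hw hw'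
      simp only [Prod.mk.injEq] at h
      obtain ⟨⟨h1, h2⟩, h3, h4⟩ := h
      have ha : a ≡ a' [MOD p * d] := (Nat.modEq_and_modEq_iff_modEq_mul hcop).mp ⟨h1, h3⟩
      have hb : b ≡ b' [MOD p * d] := (Nat.modEq_and_modEq_iff_modEq_mul hcop).mp ⟨h2, h4⟩
      rw [Nat.ModEq.eq_of_lt_of_lt ha hw.1.1 hw'.1.1, Nat.ModEq.eq_of_lt_of_lt hb hw.1.2 hw'.1.2]
    · rintro ⟨⟨a1, b1⟩, ⟨a2, b2⟩⟩ hw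
      simp only [SS, mem_filter, mem_product, mem_range] at hw
      obtain ⟨⟨⟨ha1, hb1⟩, hc1⟩, ⟨ha2, hb2⟩, hc2⟩ := hw
      have hpd : p * d ≠ 0 := (Nat.mul_pos hpp.pos hd0).ne'
      refine ⟨((Nat.chineseRemainder hcop a1 a2).1, (Nat.chineseRemainder hcop b1 b2).1), ?_, ?_⟩
      · simp only [SS, mem_filter, mem_product, mem_range, mem_insert, forall_eq_or_imp]
        refine ⟨⟨Nat.chineseRemainder_lt_mul hcop _ _ hpp.pos.ne' hd0.ne',
          Nat.chineseRemainder_lt_mul hcop _ _ hpp.pos.ne' hd0.ne'⟩, ?_, ?_⟩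
        · exact (hC p _ _ _ _ (Nat.chineseRemainder hcop a1 a2).2.1
            (Nat.chineseRemainder hcop b1 b2).2.1).mpr hc1
        · intro q hq
          exact (hC q _ _ _ _ ((Nat.chineseRemainder hcop a1 a2).2.2.of_dvd (hdvd q hq))
            ((Nat.chineseRemainder hcop b1 b2).2.2.of_dvd (hdvd q hq))).mpr (hc2 q hq)
      · have e1 := (Nat.chineseRemainder hcop a1 a2).2
        have e2 := (Nat.chineseRemainder hcop b1 b2).2
        simp only [Prod.mk.injEq]
        refine ⟨⟨?_, ?_⟩, ?_, ?_⟩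
        · exact Eq.trans e1.1 (Nat.mod_eq_of_lt ha1)
        · exact Eq.trans e2.1 (Nat.mod_eq_of_lt hb1)
        · exact Eq.trans e1.2 (Nat.mod_eq_of_lt ha2)
        · exact Eq.trans e2.2 (Nat.mod_eq_of_lt hb2)

lemma interval_count (a L d c : ℕ) (hd : 0 < d) (hc : c < d) :
    |(((Ico a (a + L)).filter (fun v => v % d = c)).card : ℝ) - L / d| ≤ 1 := by
  have h := Nat.Ico_filter_modEq_card (a := a) (b := a + L) (r := d) hd c
  have e : (Ico a (a + L)).filter (fun v => v % d = c) = (Ico a (a + L)).filter (fun v => v ≡ c [MOD d]) := by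
    apply filter_congr
    intro v _
    rw [Nat.ModEq, Nat.mod_eq_of_lt hc]
  rw [e]
  have hdQ : (0 : ℚ) < d := by exact_mod_cast hd
  have h1 := Int.ceil_lt_add_one (((a + L : ℕ) - c : ℚ) / d)
  have h2 := Int.le_ceil (((a + L : ℕ) - c : ℚ) / d)
  have h3 := Int.ceil_lt_add_one (((a : ℕ) - c : ℚ) / d)
  have h4 := Int.le_ceil (((a : ℕ) - c : ℚ) / d)
  have e2 : (((a + L : ℕ) - c : ℚ) / d) = ((a : ℕ) - c : ℚ) / d + L / d := by push_cast; ring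
  have hL : (0 : ℚ) ≤ L / d := by positivity
  have key : |(((Ico a (a + L)).filter (fun v => v ≡ c [MOD d])).card : ℚ) - L / d| ≤ 1 := by
    have h' : (((Ico a (a + L)).filter (fun v => v ≡ c [MOD d])).card : ℚ) = 
      ((max (⌈((a + L : ℕ) - c : ℚ) / d⌉ - ⌈((a : ℕ) - c : ℚ) / d⌉) 0 : ℤ) : ℚ) := by
      rw [← h]; simp
    rw [h']
    push_cast at *
    rcases max_cases ((⌈((a : ℚ) + L - c) / d⌉ : ℚ) - ⌈((a : ℚ) - c) / d⌉) 0 with hm | hm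
    · rw [hm.1, abs_le]; constructor <;> linarith
    · rw [hm.1, abs_le]; constructor <;> linarith
  have : ((|(((Ico a (a + L)).filter (fun v => v ≡ c [MOD d])).card : ℚ) - L / d| : ℚ) : ℝ) ≤ ((1 : ℚ) : ℝ) := by
    exact_mod_cast key
  simpa using this

/-- region of points -/
def Reg (u0 U : ℕ) (V : ℕ → ℕ) (L : ℕ) : Finset (Σ _ : ℕ, ℕ) :=
  (Ico u0 (u0 + U)).sigma (fun u => Ico (V u) (V u + L))

lemma mem_Reg (u0 U : ℕ) (V : ℕ → ℕ) (L : ℕ) (w : Σ _ : ℕ, ℕ) :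
    w ∈ Reg u0 U V L ↔ (u0 ≤ w.1 ∧ w.1 < u0 + U) ∧ V w.1 ≤ w.2 ∧ w.2 < V w.1 + L := by
  simp [Reg]

lemma Reg_card (u0 U : ℕ) (V : ℕ → ℕ) (L : ℕ) : (Reg u0 U V L).card = U * L := by
  simp [Reg]

lemma class_count (u0 U : ℕ) (V : ℕ → ℕ) (L d a b : ℕ) (hd : 0 < d) (ha : a < d) (hb : b < d) :
    |(((Reg u0 U V L).filter (fun w => w.1 % d = a ∧ w.2 % d = b)).card : ℝ) - U * L / d ^ 2| ≤ U + L + 1 := by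
  have e : (Reg u0 U V L).filter (fun w => w.1 % d = a ∧ w.2 % d = b) =
    ((Ico u0 (u0 + U)).filter (fun u => u % d = a)).sigma
      (fun u => (Ico (V u) (V u + L)).filter (fun v => v % d = b)) := by
    ext ⟨u, v⟩
    simp only [Reg, mem_filter, mem_sigma]
    tauto
  rw [e, card_sigma]
  push_cast
  set I := (Ico u0 (u0 + U)).filter (fun u => u % d = a)
  have h1 := interval_count u0 U d a hd ha
  have h2 : |∑ u ∈ I, (((Ico (V u) (V u + L)).filter (fun v => v % d = b)).card : ℝ) - I.card * (L / d)| ≤ I.card := by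
    have : (I.card : ℝ) * (L / d) = ∑ u ∈ I, (L / d : ℝ) := by rw [sum_const, nsmul_eq_mul]
    rw [this, ← sum_sub_distrib]
    refine (abs_sum_le_sum_abs _ _).trans ?_
    refine (sum_le_sum fun u _ => interval_count (V u) L d b hd hb).trans ?_
    simp
  have hd1 : (1 : ℝ) ≤ d := by exact_mod_cast hd
  have hU : (U : ℝ) / d ≤ U := div_le_self (by positivity) hd1
  have hL : (L : ℝ) / d ≤ L := div_le_self (by positivity) hd1
  have hL0 : 0 ≤ (L : ℝ) / d := by positivity
  have e2 : (U * L / d ^ 2 : ℝ) = U / d * (L / d) := by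
    field_simp
  rw [e2]
  rw [abs_le] at h1 h2 ⊢
  constructor <;> nlinarith [mul_le_mul_of_nonneg_right h1.1 hL0, mul_le_mul_of_nonneg_right h1.2 hL0]

theorem crt_count (C : ℕ → ℕ → ℕ → Prop) (hC : Per C) (T : Finset ℕ) (hT : ∀ p ∈ T, p.Prime)
    (u0 U : ℕ) (V : ℕ → ℕ) (L : ℕ) :
    |(((Reg u0 U V L).filter (fun w => ∀ p ∈ T, C p w.1 w.2)).card : ℝ) -
      U * L * ∏ p ∈ T, ((kap C p : ℝ) / p ^ 2)| ≤ (∏ p ∈ T, (kap C p : ℝ)) * (U + L + 1) := by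
  have hd0 : 0 < ∏ p ∈ T, p := prod_pos fun q hq => (hT q hq).pos
  have hdvd : ∀ q ∈ T, q ∣ ∏ p ∈ T, p := fun q hq => dvd_prod_of_mem _ hq
  have hS := SS_card C hC T hT
  have e1 : ((Reg u0 U V L).filter (fun w => ∀ p ∈ T, C p w.1 w.2)).card =
      ∑ s ∈ SS C (∏ p ∈ T, p) T, ((Reg u0 U V L).filter
        (fun w => w.1 % (∏ p ∈ T, p) = s.1 ∧ w.2 % (∏ p ∈ T, p) = s.2)).card := by
    rw [card_eq_sum_card_fiberwise (t := SS C (∏ p ∈ T, p) T)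
      (f := fun w => (w.1 % (∏ p ∈ T, p), w.2 % (∏ p ∈ T, p)))]
    · apply sum_congr rfl
      rintro ⟨a, b⟩ hs
      rw [filter_filter]
      congr 1
      apply filter_congr
      rintro ⟨u, v⟩ _
      simp only [SS, mem_filter, mem_product, mem_range] at hs
      simp only [Prod.mk.injEq]
      constructor
      · exact fun h => h.2
      · intro h
        refine ⟨fun p hp => ?_, h⟩
        refine (hC p a b u v ?_ ?_).mp (hs.2 p hp)
        · rw [← h.1]; exact (Nat.mod_modEq _ _).of_dvd (hdvd p hp)
        · rw [← h.2]; exact (Nat.mod_modEq _ _).of_dvd (hdvd p hp)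
    · intro w hw
      simp only [coe_filter, Set.mem_setOf_eq] at hw
      simp only [SS, coe_filter, Set.mem_setOf_eq, mem_product, mem_range]
      refine ⟨⟨Nat.mod_lt _ hd0, Nat.mod_lt _ hd0⟩, fun p hp => ?_⟩
      exact (hC p _ _ _ _ ((Nat.mod_modEq _ _).of_dvd (hdvd p hp))
        ((Nat.mod_modEq _ _).of_dvd (hdvd p hp))).mpr (hw.2 p hp)
  have e2 : (U * L * ∏ p ∈ T, ((kap C p : ℝ) / p ^ 2) : ℝ) =
      ∑ s ∈ SS C (∏ p ∈ T, p) T, ((U * L / ((∏ p ∈ T, p : ℕ) : ℝ) ^ 2 : ℝ)) := by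
    rw [sum_const, nsmul_eq_mul, hS, prod_div_distrib, prod_pow]
    push_cast
    ring
  rw [e1, e2]
  push_cast
  rw [← sum_sub_distrib]
  refine (abs_sum_le_sum_abs _ _).trans ?_
  have : (∏ p ∈ T, (kap C p : ℝ)) * (U + L + 1) = ∑ s ∈ SS C (∏ p ∈ T, p) T, (U + L + 1 : ℝ) := by
    rw [sum_const, nsmul_eq_mul, hS]; push_cast; rfl
  rw [this]
  apply sum_le_sum
  rintro ⟨a, b⟩ hs
  simp only [SS, mem_filter, mem_product, mem_range] at hs
  have := class_count u0 U V L _ a b hd0 hs.1.1 hs.1.2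
  push_cast at this
  exact this

end count
end STS

namespace STS
open Finset
section loc

lemma two_aux : (∀ c : ZMod 2, (univ.filter (fun w : ZMod 2 × ZMod 2 => w.1 ^ 2 + w.2 ^ 2 = c)).card = 2) ∧
    (4 : ZMod 2) = 0 ∧ ¬ (0 : ZMod 2) = 1 := by decide

lemma fib_sq (p : ℕ) [Fact p.Prime] (hp : p ≠ 2) (a : ZMod p) :
    ((univ.filter (fun x : ZMod p => x ^ 2 = a)).card : ℤ) = quadraticChar (ZMod p) a + 1 := by
  have hF : ringChar (ZMod p) ≠ 2 := by rwa [ZMod.ringChar_zmod_n]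
  rw [← quadraticChar_card_sqrts hF a]
  congr 2
  ext x; simp

lemma two_sq_count (p : ℕ) [Fact p.Prime] (hp : p ≠ 2) (c : ZMod p) :
    ((univ.filter (fun w : ZMod p × ZMod p => w.1 ^ 2 + w.2 ^ 2 = c)).card : ℤ) =
      if c = 0 then p + ZMod.χ₄ p * (p - 1) else p - ZMod.χ₄ p := by
  have hF : ringChar (ZMod p) ≠ 2 := by rwa [ZMod.ringChar_zmod_n]
  set χ := quadraticChar (ZMod p) with hχ
  have hm1 : χ (-1) = ZMod.χ₄ p := by
    rw [hχ, quadraticChar_neg_one hF, ZMod.card]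
  have hsum : ∑ a : ZMod p, χ a = 0 := quadraticChar_sum_zero hF
  have e1 : ((univ.filter (fun w : ZMod p × ZMod p => w.1 ^ 2 + w.2 ^ 2 = c)).card : ℤ) =
      ∑ t : ZMod p, (χ t + 1) * (χ (c - t) + 1) := by
    have : (univ.filter (fun w : ZMod p × ZMod p => w.1 ^ 2 + w.2 ^ 2 = c)).card =
        ∑ t : ZMod p, ((univ.filter (fun x : ZMod p => x ^ 2 = t)) ×ˢ
          (univ.filter (fun x : ZMod p => x ^ 2 = c - t))).card := by
      rw [card_eq_sum_card_fiberwise (t := univ) (f := fun w => w.1 ^ 2) (by simp)]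
      apply sum_congr rfl
      intro t _
      congr 1
      ext ⟨u, v⟩
      simp only [mem_filter, mem_univ, true_and, mem_product]
      constructor
      · rintro ⟨h1, h2⟩; refine ⟨h2, ?_⟩; rw [← h1, ← h2]; ring
      · rintro ⟨h1, h2⟩; refine ⟨?_, h1⟩; rw [h1, h2]; ring
    rw [this]
    push_cast
    apply sum_congr rfl
    intro t _
    rw [card_product]
    push_cast
    rw [fib_sq p hp, fib_sq p hp]
  have e2 : ∑ t : ZMod p, χ (c - t) = 0 := by
    rw [← hsum]
    exact Fintype.sum_equiv (Equiv.subLeft c) _ _ (fun _ => rfl)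
  have e3 : ∑ t : ZMod p, (χ t + 1) * (χ (c - t) + 1) = p + ∑ t : ZMod p, χ t * χ (c - t) := by
    have : ∀ t : ZMod p, (χ t + 1) * (χ (c - t) + 1) = χ t * χ (c - t) + χ t + χ (c - t) + 1 := by
      intro t; ring
    simp_rw [this, sum_add_distrib]
    rw [hsum, e2]; simp [ZMod.card]; ring
  rw [e1, e3]
  split_ifs with h
  · subst h
    have : ∀ t : ZMod p, χ t * χ (0 - t) = χ (-1) * (if t = 0 then 0 else 1) := by
      intro t
      split_ifs with ht
      · simp [ht, MulChar.map_zero]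
      · have h1 : (0 - t : ZMod p) = -1 * t := by ring
        have h2 := quadraticChar_sq_one ht
        rw [h1, map_mul, ← hχ] at *
        linear_combination (χ (-1)) * h2
    simp_rw [this]
    rw [← mul_sum, hm1]
    congr 2
    have : ∑ t : ZMod p, (if t = 0 then (0 : ℤ) else 1) = ∑ t : ZMod p, (1 - if t = 0 then (1 : ℤ) else 0) := by
      apply sum_congr rfl; intro t _; split_ifs <;> simp
    rw [this, sum_sub_distrib]
    simp [ZMod.card]
  · have hJ : ∑ t : ZMod p, χ t * χ (c - t) = jacobiSum χ χ := by
      rw [jacobiSum]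
      symm
      apply Fintype.sum_equiv (Equiv.mulLeft₀ c h)
      intro s
      have h2 := quadraticChar_sq_one h
      have e : (c - c * s) = c * (1 - s) := by ring
      change χ s * χ (1 - s) = χ (c * s) * χ (c - c * s)
      rw [e, map_mul, map_mul]
      rw [← hχ] at h2
      linear_combination (-χ s * χ (1 - s)) * h2
    have hinv : χ⁻¹ = χ := MulChar.IsQuadratic.inv (quadraticChar_isQuadratic (ZMod p))
    have := jacobiSum_nontrivial_inv (quadraticChar_ne_one hF)
    rw [← hχ, hinv] at this
    rw [hJ, this, hm1]; ring

lemma two_sq_count_real (p : ℕ) [Fact p.Prime] (c : ZMod p) :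
    ((univ.filter (fun w : ZMod p × ZMod p => w.1 ^ 2 + w.2 ^ 2 = c)).card : ℝ) =
      if c = 0 then p + chi p * (p - 1) else p - chi p := by
  by_cases hp : p = 2
  · subst hp
    have hc : chi 2 = 0 := by rw [chi_eq]; simp
    rw [hc]
    have : ∀ c : ZMod 2, (univ.filter (fun w : ZMod 2 × ZMod 2 => w.1 ^ 2 + w.2 ^ 2 = c)).card = 2 := by
      intro c
      convert two_aux.1 c
    rw [this]; simp
  · have := two_sq_count p hp c
    have h2 : (((univ.filter (fun w : ZMod p × ZMod p => w.1 ^ 2 + w.2 ^ 2 = c)).card : ℤ) : ℝ) = 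
      ((if c = 0 then p + ZMod.χ₄ p * (p - 1) else p - ZMod.χ₄ p : ℤ) : ℝ) := by rw [this]
    rw [Int.cast_natCast] at h2
    rw [h2, chi]
    split_ifs <;> push_cast <;> rfl

lemma kap_zmod (C : ℕ → ℕ → ℕ → Prop) (p : ℕ) [NeZero p] (C' : ZMod p → ZMod p → Prop)
    [DecidablePred fun w : ZMod p × ZMod p => C' w.1 w.2]
    (h : ∀ u v : ℕ, C p u v ↔ C' u v) :
    kap C p = (univ.filter (fun w : ZMod p × ZMod p => C' w.1 w.2)).card := by
  rw [kap]
  apply card_bij (fun w _ => ((w.1 : ZMod p), (w.2 : ZMod p)))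
  · rintro ⟨u, v⟩ hw
    simp only [mem_filter, mem_univ, true_and] at hw ⊢
    exact (h u v).mp hw.2
  · rintro ⟨u, v⟩ hw ⟨u', v'⟩ hw' he
    simp only [mem_filter, mem_product, mem_range] at hw hw'
    simp only [Prod.mk.injEq, ZMod.natCast_eq_natCast_iff] at he
    rw [Nat.ModEq.eq_of_lt_of_lt he.1 hw.1.1 hw'.1.1, Nat.ModEq.eq_of_lt_of_lt he.2 hw.1.2 hw'.1.2]
  · rintro ⟨a, b⟩ hw
    simp only [mem_filter, mem_univ, true_and] at hw
    refine ⟨(a.val, b.val), ?_, ?_⟩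
    · simp only [mem_filter, mem_product, mem_range]
      refine ⟨⟨ZMod.val_lt a, ZMod.val_lt b⟩, ?_⟩
      rw [h]; simpa using hw
    · simp

/-- sieve condition for `a` -/
def CA (q k : ℕ) (p a _v : ℕ) : Prop := ∃ i < k, p ∣ a + 4 * i ^ 2 * q
/-- sieve condition for `(u,v)` -/
def CB (q k i0 : ℕ) (p u v : ℕ) : Prop :=
  ∃ i < k, (p : ℤ) ∣ (u : ℤ) ^ 2 + (v : ℤ) ^ 2 + 4 * (i : ℤ) ^ 2 * q - 4 * (i0 : ℤ) ^ 2 * q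
/-- divisibility condition -/
def C0 (p u v : ℕ) : Prop := p ∣ u ^ 2 + v ^ 2
/-- number of excluded classes -/
noncomputable def kappa (q k p : ℕ) : ℕ := ((range k).image (fun i : ℕ => (-(4 * (i : ZMod p) ^ 2 * q) : ZMod p))).card

lemma kappa_le (q k p : ℕ) : kappa q k p ≤ k := by
  refine card_image_le.trans ?_
  simp

lemma kappa_lt (q k p : ℕ) (hp : p.Prime) : kappa q k p + 1 ≤ p := by
  have := Fact.mk hp
  have h : ∃ c : ZMod p, ∀ i : ℕ, -(4 * (i : ZMod p) ^ 2 * q) ≠ c := by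
    by_contra hcon
    push Not at hcon
    have hs : Function.Surjective (fun i : ZMod p => -(4 * i ^ 2 * (q : ZMod p))) := by
      intro c
      obtain ⟨i, hi⟩ := hcon c
      exact ⟨i, hi⟩
    have hinj := Finite.injective_iff_surjective.mpr hs
    by_cases h2 : p = 2
    · subst h2
      have : (0 : ZMod 2) = 1 := hinj (by
        have := two_aux.2.1
        simp [this])
      exact two_aux.2.2 this
    · have h1 : (1 : ZMod p) = -1 := hinj (by simp)
      have hF : ringChar (ZMod p) ≠ 2 := by rwa [ZMod.ringChar_zmod_n]
      exact Ring.neg_one_ne_one_of_char_ne_two hF h1.symm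
  obtain ⟨c, hc⟩ := h
  have : kappa q k p < (univ : Finset (ZMod p)).card := by
    apply card_lt_card
    rw [ssubset_univ_iff]
    intro he
    have : c ∈ (range k).image (fun i : ℕ => (-(4 * (i : ZMod p) ^ 2 * q) : ZMod p)) := by rw [he]; simp
    obtain ⟨i, _, hi⟩ := mem_image.mp this
    exact hc i hi
  rw [card_univ, ZMod.card] at this
  exact this

lemma CA_per (q k : ℕ) : Per (CA q k) := by
  intro p u v u' v' hu hv
  simp only [CA]
  refine exists_congr fun i => and_congr_right fun _ => ?_
  exact (hu.add_right _).dvd_iff (dvd_refl p)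

lemma C0_per : Per C0 := by
  intro p u v u' v' hu hv
  exact ((hu.pow 2).add (hv.pow 2)).dvd_iff (dvd_refl p)

lemma CB_iff (q k i0 p u v : ℕ) : CB q k i0 p u v ↔ ∃ i < k, (u : ZMod p) ^ 2 + (v : ZMod p) ^ 2 +
    4 * (i : ZMod p) ^ 2 * q - 4 * (i0 : ZMod p) ^ 2 * q = 0 := by
  simp only [CB]
  refine exists_congr fun i => and_congr_right fun _ => ?_
  rw [← ZMod.intCast_zmod_eq_zero_iff_dvd]
  push_cast; rfl

lemma CB_per (q k i0 : ℕ) : Per (CB q k i0) := by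
  intro p u v u' v' hu hv
  rw [CB_iff, CB_iff, (ZMod.natCast_eq_natCast_iff u u' p).mpr hu, (ZMod.natCast_eq_natCast_iff v v' p).mpr hv]

lemma kap_CA (q k p : ℕ) (hp : p.Prime) : kap (CA q k) p = kappa q k p * p := by
  have := Fact.mk hp
  rw [kap_zmod (CA q k) p (fun a _ => ∃ i < k, a = -(4 * (i : ZMod p) ^ 2 * q))]
  · have : univ.filter (fun w : ZMod p × ZMod p => ∃ i < k, w.1 = -(4 * (i : ZMod p) ^ 2 * q)) =
      ((range k).image (fun i : ℕ => (-(4 * (i : ZMod p) ^ 2 * q) : ZMod p))) ×ˢ univ := by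
      ext ⟨a, b⟩
      simp only [mem_filter, mem_univ, true_and, mem_product, mem_image, mem_range, and_true]
      refine exists_congr fun i => and_congr_right fun _ => eq_comm
    rw [this, card_product, kappa, card_univ, ZMod.card]
  · intro u v
    simp only [CA]
    refine exists_congr fun i => and_congr_right fun _ => ?_
    rw [← ZMod.natCast_eq_zero_iff, eq_neg_iff_add_eq_zero]
    push_cast; rfl

lemma kap_C0 (p : ℕ) (hp : p.Prime) : (kap C0 p : ℝ) = p + chi p * (p - 1) := by
  have := Fact.mk hp
  rw [kap_zmod C0 p (fun a b => a ^ 2 + b ^ 2 = 0)]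
  · rw [two_sq_count_real, if_pos rfl]
  · intro u v
    rw [C0, ← ZMod.natCast_eq_zero_iff]; push_cast; rfl

lemma kap_CB (q k i0 p : ℕ) (hp : p.Prime) (hi : i0 < k) :
    (kap (CB q k i0) p : ℝ) = kappa q k p * (p - chi p) + chi p * p := by
  have := Fact.mk hp
  set B : Finset (ZMod p) := (range k).image (fun i : ℕ => (-(4 * (i : ZMod p) ^ 2 * q) : ZMod p)) with hB
  set s : ZMod p := 4 * (i0 : ZMod p) ^ 2 * q with hs
  have h0 : -s ∈ B := mem_image.mpr ⟨i0, mem_range.mpr hi, rfl⟩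
  rw [kap_zmod (CB q k i0) p (fun a b => a ^ 2 + b ^ 2 - s ∈ B)]
  · rw [card_eq_sum_card_fiberwise (t := B) (f := fun w : ZMod p × ZMod p => w.1 ^ 2 + w.2 ^ 2 - s)
      (by intro w hw; simpa using hw)]
    have : ∀ b ∈ B, (((univ.filter (fun w : ZMod p × ZMod p => w.1 ^ 2 + w.2 ^ 2 - s ∈ B)).filter
        (fun w => w.1 ^ 2 + w.2 ^ 2 - s = b)).card : ℝ) = (p - chi p) + if b = -s then chi p * p else 0 := by
      intro b hb
      rw [filter_filter]
      have e : univ.filter (fun w : ZMod p × ZMod p => w.1 ^ 2 + w.2 ^ 2 - s ∈ B ∧ w.1 ^ 2 + w.2 ^ 2 - s = b)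
        = univ.filter (fun w : ZMod p × ZMod p => w.1 ^ 2 + w.2 ^ 2 = b + s) := by
        apply filter_congr
        intro w _
        rw [sub_eq_iff_eq_add]
        constructor
        · exact fun h => h.2
        · intro h; refine ⟨?_, h⟩; rw [h]; simpa using hb
      rw [e, two_sq_count_real]
      by_cases hbs : b = -s
      · rw [if_pos (by rw [hbs]; ring), if_pos hbs]; ring
      · rw [if_neg (by rwa [← eq_neg_iff_add_eq_zero]), if_neg hbs, add_zero]
    push_cast
    rw [sum_congr rfl this, sum_add_distrib, sum_const, nsmul_eq_mul, sum_ite_eq' B (-s), if_pos h0]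
    rfl
  · intro u v
    rw [CB_iff, hB, mem_image]
    simp only [mem_range]
    refine exists_congr fun i => and_congr_right fun _ => ?_
    constructor
    · intro h; linear_combination -h
    · intro h; linear_combination -h

lemma one_sub_CB (q k i0 p : ℕ) (hp : p.Prime) (hi : i0 < k) :
    1 - (kap (CB q k i0) p : ℝ) / p ^ 2 = (1 - (kap (CA q k) p : ℝ) / p ^ 2) * (1 - chi p / p) := by
  rw [kap_CB q k i0 p hp hi, kap_CA q k p hp]
  have : (p : ℝ) ≠ 0 := by exact_mod_cast hp.pos.ne'
  push_cast
  field_simp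
  ring

end loc
end STS

namespace STS
open Finset

/-- Gaussian integers of norm `n` -/
def GN (n : ℕ) : Set GaussianInt := {α | Zsqrtd.norm α = (n : ℤ)}

lemma GN_one : GN 1 ⊆ (↑({⟨1, 0⟩, ⟨-1, 0⟩, ⟨0, 1⟩, ⟨0, -1⟩} : Finset GaussianInt) : Set GaussianInt) := by
  rintro ⟨a, b⟩ h
  have h : Zsqrtd.norm (⟨a, b⟩ : GaussianInt) = ((1 : ℕ) : ℤ) := h
  rw [Zsqrtd.norm_def] at h
  simp only at h
  have h' : a * a + b * b = 1 := by push_cast at h; linarith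
  have ha : -1 ≤ a ∧ a ≤ 1 := ⟨by nlinarith, by nlinarith⟩
  have hb : -1 ≤ b ∧ b ≤ 1 := ⟨by nlinarith, by nlinarith⟩
  obtain ⟨ha1, ha2⟩ := ha
  obtain ⟨hb1, hb2⟩ := hb
  interval_cases a <;> interval_cases b <;> simp_all

lemma GN_bound (n : ℕ) (hn : 0 < n) : (GN n).Finite ∧ (GN n).ncard ≤ 4 * 2 ^ (ArithmeticFunction.cardFactors n) := by
  induction n using Nat.strong_induction_on with
  | _ n ih =>
  by_cases h1 : n = 1
  · subst h1
    refine ⟨Set.Finite.subset (Finset.finite_toSet _) GN_one, ?_⟩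
    refine (Set.ncard_le_ncard GN_one (Finset.finite_toSet _)).trans ?_
    rw [Set.ncard_coe_finset]
    refine (card_le_four).trans ?_
    simp
  by_cases hemp : GN n = ∅
  · rw [hemp]; simp
  have hp := Nat.minFac_prime h1
  set p := n.minFac
  have hpn : p ∣ n := Nat.minFac_dvd n
  have hpu : ¬ IsUnit (p : GaussianInt) := by
    rw [← Zsqrtd.norm_eq_one_iff, Zsqrtd.norm_natCast]
    intro h
    have : p * p = 1 := by simpa [Int.natAbs_mul] using h
    have := hp.two_le
    nlinarith
  have hp0 : (p : GaussianInt) ≠ 0 := by exact_mod_cast hp.ne_zero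
  obtain ⟨π, hπ, hπp⟩ := WfDvdMonoid.exists_irreducible_factor hpu hp0
  have hprime : Prime π := hπ.prime
  set e := (Zsqrtd.norm π).natAbs with he
  have henorm : Zsqrtd.norm π = (e : ℤ) := by
    rw [he, Int.natAbs_of_nonneg (GaussianInt.norm_nonneg π)]
  have he1 : e ≠ 1 := by
    intro h
    exact hπ.not_isUnit (Zsqrtd.norm_eq_one_iff.mp h)
  have he0 : e ≠ 0 := by
    intro h
    rw [he, Int.natAbs_eq_zero, GaussianInt.norm_eq_zero] at h
    exact hπ.ne_zero h
  have key : ∀ α ∈ GN n, ∃ m β, n = e * m ∧ β ∈ GN m ∧ (α = π * β ∨ α = star π * β) := by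
    intro α hα
    have hα' : Zsqrtd.norm α = (n : ℤ) := hα
    have hd : π ∣ α * star α := by
      have : (p : GaussianInt) ∣ α * star α := by
        rw [← Zsqrtd.norm_eq_mul_conj, hα']
        have h2 : (p : GaussianInt) ∣ (n : GaussianInt) := Nat.cast_dvd_cast hpn
        simpa only [Int.cast_natCast] using h2
      exact hπp.trans this
    have fin : ∀ π' β : GaussianInt, Zsqrtd.norm π' = (e : ℤ) → α = π' * β → ∃ m : ℕ, n = e * m ∧ β ∈ GN m := by
      intro π' β h1 h2
      refine ⟨(Zsqrtd.norm β).natAbs, ?_, ?_⟩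
      · have : (n : ℤ) = e * Zsqrtd.norm β := by rw [← hα', h2, Zsqrtd.norm_mul, h1]
        zify
        rw [this, abs_of_nonneg (GaussianInt.norm_nonneg β)]
      · change Zsqrtd.norm β = _
        rw [Int.natAbs_of_nonneg (GaussianInt.norm_nonneg β)]
    rcases hprime.dvd_or_dvd hd with h | h
    · obtain ⟨β, hβ⟩ := h
      obtain ⟨m, hm, hb⟩ := fin π β henorm hβ
      exact ⟨m, β, hm, hb, Or.inl hβ⟩
    · obtain ⟨β, hβ⟩ := h
      have h2 : α = star π * star β := by
        rw [← star_star α, hβ, star_mul, mul_comm]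
      obtain ⟨m, hm, hb⟩ := fin (star π) (star β) (by rw [Zsqrtd.norm_conj, henorm]) h2
      exact ⟨m, star β, hm, hb, Or.inr h2⟩
  obtain ⟨α0, hα0⟩ := Set.nonempty_iff_ne_empty.mpr hemp
  obtain ⟨m, _, hm, _⟩ := key α0 hα0
  have hm0 : 0 < m := by
    rcases Nat.eq_zero_or_pos m with h | h
    · subst h; simp at hm; omega
    · exact h
  have hmn : m < n := by
    rw [hm]
    have : 2 ≤ e := by omega
    nlinarith
  obtain ⟨hf, hc⟩ := ih m hmn hm0
  have hsub : GN n ⊆ (fun β => π * β) '' GN m ∪ (fun β => star π * β) '' GN m := by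
    intro α hα
    obtain ⟨m', β, hm', hβ, h⟩ := key α hα
    have : m' = m := by
      rw [hm] at hm'
      exact (Nat.eq_of_mul_eq_mul_left (Nat.pos_of_ne_zero he0) hm').symm
    subst this
    rcases h with h | h
    · exact Or.inl ⟨β, hβ, h.symm⟩
    · exact Or.inr ⟨β, hβ, h.symm⟩
  have hfin := (hf.image (fun β => π * β)).union (hf.image (fun β => star π * β))
  refine ⟨hfin.subset hsub, ?_⟩
  have h3 := Set.ncard_le_ncard hsub hfin
  have h4 := Set.ncard_union_le ((fun β => π * β) '' GN m) ((fun β => star π * β) '' GN m)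
  have h5 := Set.ncard_image_le (f := fun β => π * β) hf
  have h6 := Set.ncard_image_le (f := fun β => star π * β) hf
  have hO : ArithmeticFunction.cardFactors m + 1 ≤ ArithmeticFunction.cardFactors n := by
    rw [hm, ArithmeticFunction.cardFactors_mul he0 hm0.ne']
    have : ArithmeticFunction.cardFactors e ≠ 0 := by
      rw [Ne, ArithmeticFunction.cardFactors_eq_zero_iff_eq_zero_or_one]
      omega
    omega
  calc (GN n).ncard ≤ 2 * (4 * 2 ^ (ArithmeticFunction.cardFactors m)) := by omega
    _ = 4 * 2 ^ (ArithmeticFunction.cardFactors m + 1) := by ring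
    _ ≤ _ := by gcongr; norm_num

lemma rep_bound (n : ℕ) (hn : 0 < n) (F : Finset (Σ _ : ℕ, ℕ)) (hF : ∀ w ∈ F, w.1 ^ 2 + w.2 ^ 2 = n) :
    F.card ≤ 4 * 2 ^ (ArithmeticFunction.cardFactors n) := by
  obtain ⟨hf, hc⟩ := GN_bound n hn
  refine le_trans ?_ hc
  rw [← Set.ncard_coe_finset]
  apply Set.ncard_le_ncard_of_injOn (fun w : (Σ _ : ℕ, ℕ) => (⟨w.1, w.2⟩ : GaussianInt)) _ _ hf
  · intro w hw
    have := hF w hw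
    change Zsqrtd.norm (⟨w.1, w.2⟩ : GaussianInt) = _
    rw [Zsqrtd.norm_def, ← this]
    push_cast; ring
  · rintro ⟨a, b⟩ _ ⟨c, d⟩ _ h
    simp only [Zsqrtd.mk.injEq, Nat.cast_inj] at h
    rw [h.1, h.2]

end STS

namespace STS
open Finset

lemma Pr_union (a b c : ℝ) (ha : 0 ≤ a) (hab : a ≤ b) (hbc : b ≤ c) : Pr a c = Pr a b ∪ Pr b c := by
  ext p
  rw [mem_union, mem_Pr ha (by linarith), mem_Pr ha (by linarith), mem_Pr (by linarith) (by linarith)]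
  constructor
  · rintro ⟨⟨h1, h2⟩, h3⟩
    rcases le_or_gt (p : ℝ) b with h | h
    · exact Or.inl ⟨⟨h1, h⟩, h3⟩
    · exact Or.inr ⟨⟨h, h2⟩, h3⟩
  · rintro (⟨⟨h1, h2⟩, h3⟩ | ⟨⟨h1, h2⟩, h3⟩)
    · exact ⟨⟨h1, by linarith⟩, h3⟩
    · exact ⟨⟨by linarith, h2⟩, h3⟩

lemma Pr_disj (a b c d : ℝ) (ha : 0 ≤ a) (hb : 0 ≤ b) (hbc : b ≤ c) (hd : 0 ≤ d) : Disjoint (Pr a b) (Pr c d) := by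
  rw [disjoint_left]
  intro p h1 h2
  rw [mem_Pr ha hb] at h1
  rw [mem_Pr (by linarith) hd] at h2
  linarith [h1.1.2, h2.1.1]

lemma one_sub_ge_exp (g : ℝ) (h0 : 0 ≤ g) (h1 : g ≤ 1 / 2) : Real.exp (-2 * g) ≤ 1 - g := by
  have h := Real.add_one_le_exp (2 * g)
  have e : Real.exp (-2 * g) = 1 / Real.exp (2 * g) := by rw [one_div, ← Real.exp_neg]; ring_nf
  rw [e, div_le_iff₀ (Real.exp_pos _)]
  nlinarith

lemma prod_ge_exp (g : ℕ → ℝ) (P : Finset ℕ) (h0 : ∀ p ∈ P, 0 ≤ g p) (h1 : ∀ p ∈ P, g p ≤ 1 / 2) :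
    Real.exp (-2 * ∑ p ∈ P, g p) ≤ ∏ p ∈ P, (1 - g p) := by
  rw [mul_sum, Real.exp_sum]
  exact prod_le_prod (fun _ _ => (Real.exp_pos _).le) (fun p hp => one_sub_ge_exp _ (h0 p hp) (h1 p hp))

lemma blk (g : ℕ → ℝ) (P : Finset ℕ) (K B : ℝ) (hK : 0 < K) (hP : ∀ p ∈ P, 8 * K ≤ (p : ℝ))
    (h0 : ∀ p ∈ P, 0 ≤ g p) (h1 : ∀ p ∈ P, g p ≤ 2 * K / p) (hB : ∑ p ∈ P, 1 / (p : ℝ) ≤ B)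
    (l : ℕ) (j : ℝ) (hl : (10 * B + 1) * K + j ≤ l) :
    es g l P ≤ Real.exp (-K - j) * ∏ p ∈ P, (1 - g p) := by
  set G := ∑ p ∈ P, g p with hG
  have hG0 : 0 ≤ G := sum_nonneg h0
  have hGB : G ≤ 2 * K * B := by
    calc G ≤ ∑ p ∈ P, 2 * K * (1 / (p : ℝ)) := by
          apply sum_le_sum; intro p hp
          rw [mul_one_div]; exact h1 p hp
      _ = 2 * K * ∑ p ∈ P, 1 / (p : ℝ) := by rw [mul_sum]
      _ ≤ _ := by gcongr
  have hhalf : ∀ p ∈ P, g p ≤ 1 / 2 := by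
    intro p hp
    refine (h1 p hp).trans ?_
    have := hP p hp
    rw [div_le_iff₀ (by linarith)]; linarith
  have hprod := prod_ge_exp g P h0 hhalf
  rw [← hG] at hprod
  have h2 : es g l P ≤ G ^ l / l.factorial := es_le g P h0 l
  have h3 := Real.pow_div_factorial_le_exp (Real.exp 1 * G) (by positivity) l
  have h4 : G ^ l / l.factorial ≤ Real.exp (3 * G - l) := by
    have e : (Real.exp 1 * G) ^ l / l.factorial = Real.exp l * (G ^ l / l.factorial) := by
      rw [mul_pow, ← Real.exp_nat_mul, mul_one, mul_div_assoc]
    rw [e] at h3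
    have h5 : Real.exp (Real.exp 1 * G) ≤ Real.exp (3 * G) := by
      apply Real.exp_le_exp.mpr
      have := Real.exp_one_lt_d9
      nlinarith
    rw [Real.exp_sub, le_div_iff₀ (Real.exp_pos _)]
    linarith
  calc es g l P ≤ Real.exp (3 * G - l) := h2.trans h4
    _ ≤ Real.exp (-K - j) * Real.exp (-2 * G) := by
        rw [← Real.exp_add]; apply Real.exp_le_exp.mpr; nlinarith
    _ ≤ _ := by gcongr

lemma geo_sum (a : ℝ) (m : ℕ) : ∑ j ∈ range m, (a + 2 * j) / 2 ^ j = 2 * a + 4 - (2 * a + 4 * m + 4) / 2 ^ m := by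
  induction m with
  | zero => simp
  | succ m ih =>
    rw [sum_range_succ, ih]
    push_cast
    field_simp
    ring

lemma fam_card (F : Finset (Finset ℕ)) (M : ℝ) (hM : 0 ≤ M) (h1 : ∀ T ∈ F, ∀ p ∈ T, p.Prime)
    (h2 : ∀ T ∈ F, ((∏ p ∈ T, p : ℕ) : ℝ) ≤ M) : (F.card : ℝ) ≤ M := by
  have : F.card ≤ (Icc 1 ⌊M⌋₊).card := by
    apply card_le_card_of_injOn (fun T => ∏ p ∈ T, p)
    · intro T hT
      simp only [coe_Icc, Set.mem_Icc]
      refine ⟨Nat.one_le_iff_ne_zero.mpr (prod_pos fun p hp => (h1 T hT p hp).pos).ne', ?_⟩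
      exact Nat.le_floor (h2 T hT)
    · intro T hT T' hT' h
      simp only at h
      rw [← Nat.primeFactors_prod (h1 T hT), ← Nat.primeFactors_prod (h1 T' hT'), h]
  rw [Nat.card_Icc] at this
  calc (F.card : ℝ) ≤ (⌊M⌋₊ : ℝ) := by exact_mod_cast this
    _ ≤ M := Nat.floor_le hM

end STS

namespace STS
open Finset

/-- block endpoints -/
def Zn (K m j : ℕ) : ℕ := (8 * K) ^ 2 ^ (m - j)

lemma Zn_anti (K m j j' : ℕ) (hK : 1 ≤ K) (h : j ≤ j') : Zn K m j' ≤ Zn K m j := by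
  apply Nat.pow_le_pow_right (by omega)
  apply Nat.pow_le_pow_right (by omega)
  omega

lemma Zn_top (K m : ℕ) : Zn K m m = 8 * K := by simp [Zn]

lemma Zn_sq (K m j : ℕ) (h : j < m) : Zn K m j = Zn K m (j + 1) ^ 2 := by
  rw [Zn, Zn, ← pow_mul]
  congr 1
  rw [← pow_succ]
  congr 1
  omega

lemma Zn_ge (K m j : ℕ) (hK : 1 ≤ K) : 8 * K ≤ Zn K m j := by
  apply Nat.le_self_pow
  positivity

lemma Zn_log (K m j : ℕ) (h : j ≤ m) : Real.log (Zn K m j) = Real.log (Zn K m 0) / 2 ^ j := by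
  have e : m - 0 = (m - j) + j := by omega
  rw [Zn, Zn, e, pow_add]
  push_cast
  rw [Real.log_pow, Real.log_pow]
  push_cast
  field_simp

/-- sieve blocks -/
noncomputable def PbF (K m : ℕ) : Option (Fin m) → Finset ℕ
  | none => Pr 0 (8 * K : ℕ)
  | some j => Pr (Zn K m (j + 1)) (Zn K m j)

/-- truncation parameters -/
def rF (C1 K m : ℕ) : Option (Fin m) → ℕ
  | none => 2 * (8 * K)
  | some j => 2 * (C1 * K + j)

lemma Pb_disj (K m : ℕ) (hK : 1 ≤ K) (i i' : Option (Fin m)) (h : i ≠ i') :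
    Disjoint (PbF K m i) (PbF K m i') := by
  have key : ∀ j j' : Fin m, j < j' → Disjoint (PbF K m (some j')) (PbF K m (some j)) := by
    intro j j' hj
    apply Pr_disj _ _ _ _ (by positivity) (by positivity) _ (by positivity)
    exact_mod_cast Zn_anti K m _ _ hK hj
  have key2 : ∀ j : Fin m, Disjoint (PbF K m none) (PbF K m (some j)) := by
    intro j
    apply Pr_disj _ _ _ _ (by positivity) (by positivity) _ (by positivity)
    exact_mod_cast Zn_ge K m (j + 1) hK
  match i, i' with
  | none, none => exact absurd rfl h
  | none, some j => exact key2 j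
  | some j, none => exact (key2 j).symm
  | some j, some j' =>
    rcases lt_trichotomy j j' with h1 | h1 | h1
    · exact (key j j' h1).symm
    · exact absurd (by rw [h1]) h
    · exact key j' j h1

lemma Pb_union_aux (K m : ℕ) (hK : 1 ≤ K) (s : ℕ) :
    Pr 0 (Zn K m 0) = Pr 0 (Zn K m s) ∪ (range s).biUnion (fun j => Pr (Zn K m (j + 1)) (Zn K m j)) := by
  induction s with
  | zero => simp
  | succ s ih =>
    have h1 : (Zn K m (s + 1) : ℝ) ≤ Zn K m s := by exact_mod_cast Zn_anti K m s (s + 1) hK (by omega)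
    rw [ih, Pr_union 0 (Zn K m (s + 1)) (Zn K m s) le_rfl (by positivity) h1, range_add_one, biUnion_insert,
      union_assoc]

lemma Pb_union (K m : ℕ) (hK : 1 ≤ K) : Pr 0 (Zn K m 0) = univ.biUnion (PbF K m) := by
  rw [Pb_union_aux K m hK m, Zn_top]
  ext p
  simp only [mem_union, mem_biUnion, mem_range, mem_univ, true_and, Option.exists, PbF]
  constructor
  · rintro (h | ⟨j, hj, h⟩)
    · exact Or.inl h
    · exact Or.inr ⟨⟨j, hj⟩, h⟩
  · rintro (h | ⟨j, h⟩)
    · exact Or.inl h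
    · exact Or.inr ⟨j, j.2, h⟩

lemma Pb_prime (K m : ℕ) (i : Option (Fin m)) (p : ℕ) (hp : p ∈ PbF K m i) : p.Prime := by
  cases i with
  | none => exact (mem_filter.mp hp).2
  | some j => exact (mem_filter.mp hp).2

/-- bounds for the products -/
noncomputable def MF (C1 K m : ℕ) : Option (Fin m) → ℝ
  | none => 4 ^ (8 * K)
  | some j => (Zn K m j : ℝ) ^ (2 * (C1 * K + j) + 1)

lemma MF_nonneg (C1 K m : ℕ) (i : Option (Fin m)) : 0 ≤ MF C1 K m i := by
  cases i <;> simp only [MF] <;> positivity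

lemma MF_bound (C1 K m : ℕ) (hK : 1 ≤ K) (i : Option (Fin m)) (T : Finset ℕ) (hT : T ∈ Qs (rF C1 K m i) (PbF K m i)) :
    ((∏ p ∈ T, p : ℕ) : ℝ) ≤ MF C1 K m i := by
  rw [Qs, mem_filter, mem_powerset] at hT
  cases i with
  | none =>
    simp only [MF]
    have h1 : ∏ p ∈ T, p ≤ primorial (8 * K) := by
      rw [primorial]
      apply prod_le_prod_of_subset_of_one_le'
      · intro p hp
        have := hT.1 hp
        simp only [PbF] at this
        rw [mem_Pr le_rfl (by positivity)] at this
        rw [mem_filter, mem_range]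
        refine ⟨?_, this.2⟩
        have : p ≤ 8 * K := by exact_mod_cast this.1.2
        omega
      · intro p hp _
        exact (mem_filter.mp hp).2.one_le
    have := h1.trans (primorial_le_four_pow (8 * K))
    exact_mod_cast this
  | some j =>
    simp only [MF]
    have h1 : ∏ p ∈ T, p ≤ (Zn K m j) ^ T.card := by
      apply prod_le_pow_card
      intro p hp
      have := hT.1 hp
      simp only [PbF] at this
      rw [mem_Pr (by positivity) (by positivity)] at this
      exact_mod_cast this.1.2
    have h2 : (Zn K m j) ^ T.card ≤ (Zn K m j) ^ (2 * (C1 * K + j) + 1) := by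
      apply Nat.pow_le_pow_right
      · have := Zn_ge K m j hK; omega
      · exact hT.2
    exact_mod_cast h1.trans h2

lemma MF_prod (C1 K m : ℕ) (hC : 1 ≤ C1) (hK : 1 ≤ K) : ∏ i, MF C1 K m i ≤ (Zn K m 0 : ℝ) ^ (20 * C1 * K) := by
  have hZ : ∀ j, (8 : ℝ) ≤ Zn K m j := by
    intro j
    have h1 := Zn_ge K m j hK
    have : 8 ≤ Zn K m j := by omega
    exact_mod_cast this
  rw [Fintype.prod_option]
  have hpos : 0 < ∏ j : Fin m, MF C1 K m (some j) := by
    apply prod_pos; intro j _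
    simp only [MF]
    have := hZ j
    positivity
  have hpos0 : 0 < MF C1 K m none := by simp only [MF]; positivity
  rw [← Real.log_le_log_iff (mul_pos hpos0 hpos) (by have := hZ 0; positivity),
    Real.log_mul hpos0.ne' hpos.ne', Real.log_pow, Real.log_prod]
  swap
  · intro j _
    simp only [MF]
    have := hZ j
    positivity
  set l := Real.log (Zn K m 0) with hl
  have hl2 : 2 ≤ l := by
    have h1 : Real.log 8 ≤ l := Real.log_le_log (by norm_num) (hZ 0)
    have h2 : Real.log 8 = 3 * Real.log 2 := by
      rw [show (8 : ℝ) = 2 ^ 3 by norm_num, Real.log_pow]; norm_num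
    have := Real.log_two_gt_d9
    linarith
  have e1 : ∑ j : Fin m, Real.log (MF C1 K m (some j)) = l * ∑ j ∈ range m, ((2 * C1 * K + 1 : ℝ) + 2 * j) / 2 ^ j := by
    rw [mul_sum, ← Fin.sum_univ_eq_sum_range (fun j => l * (((2 * C1 * K + 1 : ℝ) + 2 * j) / 2 ^ j))]
    apply sum_congr rfl
    intro j _
    simp only [MF]
    rw [Real.log_pow, Zn_log K m j j.2.le, ← hl]
    push_cast; ring
  have e2 : Real.log (MF C1 K m none) = 16 * K * Real.log 2 := by
    simp only [MF]
    rw [Real.log_pow, show (4 : ℝ) = 2 ^ 2 by norm_num, Real.log_pow]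
    push_cast; ring
  rw [e1, e2, geo_sum]
  have hC' : (1 : ℝ) ≤ C1 := by exact_mod_cast hC
  have hK' : (1 : ℝ) ≤ K := by exact_mod_cast hK
  have hCK : (1 : ℝ) ≤ C1 * K := by nlinarith
  have hKCK : (K : ℝ) ≤ C1 * K := by nlinarith
  have h3 : 0 ≤ (2 * (2 * C1 * K + 1 : ℝ) + 4 * m + 4) / 2 ^ m := by positivity
  have h4 : l * (2 * (2 * C1 * K + 1 : ℝ) + 4 - (2 * (2 * C1 * K + 1 : ℝ) + 4 * m + 4) / 2 ^ m) ≤ l * (10 * (C1 * K)) := by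
    apply mul_le_mul_of_nonneg_left _ (by linarith)
    linarith
  have h5 : 16 * K * Real.log 2 ≤ 6 * l * (C1 * K) := by
    have := Real.log_two_lt_d9
    nlinarith
  push_cast
  nlinarith

lemma Pb_card0 (K m : ℕ) : (PbF K m none).card ≤ 8 * K := by
  simp only [PbF, Pr]
  refine (card_filter_le _ _).trans ?_
  rw [Nat.card_Ioc, Nat.floor_natCast]
  omega

lemma eps_sum (K : ℝ) (m : ℕ) : ∑ j : Fin m, Real.exp (-K - (j : ℕ)) ≤ 2 * Real.exp (-K) := by
  rw [Fin.sum_univ_eq_sum_range (fun j : ℕ => Real.exp (-K - j))]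
  have : ∀ j : ℕ, Real.exp (-K - j) = Real.exp (-K) * (Real.exp (-1)) ^ j := by
    intro j
    rw [← Real.exp_nat_mul, ← Real.exp_add]; ring_nf
  simp_rw [this]
  rw [← mul_sum, mul_comm]
  apply mul_le_mul_of_nonneg_right _ (Real.exp_pos _).le
  have hlt : Real.exp (-1) ≤ 1 / 2 := by
    rw [Real.exp_neg, inv_eq_one_div]
    apply one_div_le_one_div_of_le (by norm_num)
    have := Real.exp_one_gt_d9
    linarith
  calc ∑ j ∈ range m, Real.exp (-1) ^ j ≤ ∑ j ∈ range m, (1 / 2 : ℝ) ^ j := by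
        apply sum_le_sum; intro j _
        exact pow_le_pow_left₀ (Real.exp_pos _).le hlt j
    _ ≤ 2 := sum_geometric_two_le m

end STS

namespace STS
open Finset
section
open Classical


lemma brun_both {α ι : Type*} [Fintype ι] (Pts : Finset α) (bad : α → ℕ → Prop) (Pb : ι → Finset ℕ) (r : ι → ℕ)
    (g : ℕ → ℝ) (Y R D : ℝ) (hY : 0 ≤ Y) (hR : 0 ≤ R) (hD1 : 1 ≤ D) (hr : ∀ i, Even (r i))
    (hg0 : ∀ i, ∀ p ∈ Pb i, 0 ≤ g p) (hg1 : ∀ i, ∀ p ∈ Pb i, g p ≤ 1)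
    (hcount : ∀ τ : ι → Finset ℕ, (∀ i, τ i ∈ Qs (r i) (Pb i)) →
      |((Pts.filter (fun w => ∀ i, ∀ p ∈ τ i, bad w p)).card : ℝ) - Y * ∏ i, ∏ p ∈ τ i, g p| ≤ R)
    (ε : ι → ℝ) (hε0 : ∀ i, 0 ≤ ε i)
    (hε : ∀ i, es g (r i + 1) (Pb i) ≤ ε i * ∏ p ∈ Pb i, (1 - g p))
    (hεs : ∑ i, ε i ≤ 1 / 500) (hN : ∏ i, ((Qs (r i) (Pb i)).card : ℝ) ≤ D)
    (hm : (Fintype.card ι : ℝ) + 1 ≤ D) (VV : ℝ) (hVV : ∏ i, ∏ p ∈ Pb i, (1 - g p) = VV) (S : Finset α)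
    (hS : Pts.filter (fun w => ∀ i, ∀ p ∈ Pb i, ¬ bad w p) = S) :
    (S.card : ℝ) ≤ (1 + 1 / 100) * Y * VV + D * D * R ∧
    (1 - 1 / 100) * Y * VV - D * D * R ≤ (S.card : ℝ) := by
  have hup := brun_upper Pts bad Pb r g Y R hY hr hg0 hg1
    (fun τ hτ => hcount τ (Fintype.mem_piFinset.mp hτ)) ε hε
  have hlo := brun_lower Pts bad Pb r g Y R hY hr hg0 hg1
    (fun τ hτ => hcount τ (Fintype.mem_piFinset.mp hτ)) ε hε0 hε
  rw [hS, hVV] at hup hlo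
  have hVV0 : 0 ≤ VV := by
    rw [← hVV]
    exact prod_nonneg fun i _ => prod_nonneg fun p hp => by linarith [hg1 i p hp]
  have hN0 : 0 ≤ ∏ i, ((Qs (r i) (Pb i)).card : ℝ) := prod_nonneg fun i _ => Nat.cast_nonneg _
  have hεs0 : 0 ≤ ∑ i, ε i := sum_nonneg fun i _ => hε0 i
  have hεp : ∏ i, (1 + ε i) ≤ 1 + 1 / 250 := by
    calc ∏ i, (1 + ε i) ≤ ∏ i, Real.exp (ε i) := by
          apply prod_le_prod
          · intro i _; linarith [hε0 i]
          · intro i _; linarith [Real.add_one_le_exp (ε i)]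
      _ = Real.exp (∑ i, ε i) := by rw [Real.exp_sum]
      _ ≤ Real.exp (1 / 500) := Real.exp_le_exp.mpr hεs
      _ ≤ 1 + 1 / 250 := by
          have h1 := Real.add_one_le_exp (-(1 / 500 : ℝ))
          have e : Real.exp (1 / 500) = 1 / Real.exp (-(1 / 500)) := by rw [Real.exp_neg]; simp
          rw [e, div_le_iff₀ (Real.exp_pos _)]
          linarith
  have hεp0 : 0 ≤ ∏ i, (1 + ε i) := prod_nonneg fun i _ => by linarith [hε0 i]
  have hYV : 0 ≤ Y * VV := mul_nonneg hY hVV0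
  generalize (∏ i, ((Qs (r i) (Pb i)).card : ℝ)) = N at *
  generalize ∏ i, (1 + ε i) = Pε at *
  generalize ∑ i, ε i = Sε at *
  generalize (Fintype.card ι : ℝ) = cι at *
  have hNR : N * R ≤ D * R := mul_le_mul_of_nonneg_right hN hR
  have hNR0 : 0 ≤ N * R := mul_nonneg hN0 hR
  have hDR : 0 ≤ D * R := by positivity
  constructor
  · have h1 : Y * VV * Pε ≤ Y * VV * (1 + 1 / 250) := mul_le_mul_of_nonneg_left hεp hYV
    have h2 : D * R ≤ D * D * R := by nlinarith
    linarith
  · have h1 : (cι + 1) * (N * R) ≤ D * (D * R) := mul_le_mul hm hNR hNR0 (by linarith)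
    have h2 : Sε * Pε ≤ 1 / 500 * (1 + 1 / 250) := mul_le_mul hεs hεp hεp0 (by norm_num)
    have h3 : Y * VV * (1 - 1 / 100) ≤ Y * VV * (1 - Sε * Pε) := mul_le_mul_of_nonneg_left (by linarith) hYV
    linarith

/-- block errors -/
noncomputable def epsF (K m : ℕ) : Option (Fin m) → ℝ
  | none => 0
  | some j => Real.exp (-(K : ℝ) - (j : ℕ))

lemma epsF_nonneg (K m : ℕ) (i : Option (Fin m)) : 0 ≤ epsF K m i := by
  cases i with
  | none => exact le_rfl
  | some j => exact (Real.exp_pos _).le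

lemma epsF_sum (K m : ℕ) (hK : 7 ≤ K) : ∑ i, epsF K m i ≤ 1 / 500 := by
  have hKr : (7 : ℝ) ≤ K := by exact_mod_cast hK
  have hδ : Real.exp (-(K : ℝ)) ≤ 1 / 1000 := by
    have h1 : Real.exp (-(K : ℝ)) ≤ Real.exp (-7) := Real.exp_le_exp.mpr (by linarith)
    have h2 : (1000 : ℝ) ≤ Real.exp 7 := by
      have := Real.exp_one_gt_d9
      have e : Real.exp 7 = Real.exp 1 ^ 7 := by rw [← Real.exp_nat_mul]; norm_num
      rw [e]
      calc (1000 : ℝ) ≤ 2.7 ^ 7 := by norm_num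
        _ ≤ Real.exp 1 ^ 7 := by gcongr; linarith
    have h3 : Real.exp (-7) ≤ 1 / 1000 := by
      rw [Real.exp_neg, inv_eq_one_div]
      exact one_div_le_one_div_of_le (by norm_num) h2
    linarith
  rw [Fintype.sum_option]
  have h1 := eps_sum K m
  simp only [epsF]
  linarith

set_option maxHeartbeats 1000000 in
theorem sieve : ∃ C1 : ℕ, 1 ≤ C1 ∧ ∀ (K m : ℕ) (D : ℝ), 7 ≤ K → (Zn K m 0 : ℝ) ^ (20 * C1 * K) ≤ D →
    ∀ C : ℕ → ℕ → ℕ → Prop, Per C → (∀ p, p.Prime → p ≤ Zn K m 0 → kap C p ≤ 2 * K * p) →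
    (∀ p, p.Prime → p ≤ Zn K m 0 → kap C p + 1 ≤ p ^ 2) →
    ∀ E : Finset ℕ, (∀ p ∈ E, p.Prime ∧ Zn K m 0 < p) → ((∏ p ∈ E, p : ℕ) : ℝ) ≤ D →
    ∀ (u0 U : ℕ) (V : ℕ → ℕ) (L : ℕ),
    (((Reg u0 U V L).filter (fun w => (∀ p ∈ E, C p w.1 w.2) ∧ ∀ p ∈ Pr 0 (Zn K m 0), ¬ C p w.1 w.2)).card : ℝ) ≤
      (1 + 1 / 100) * (U * L * ∏ p ∈ E, ((kap C p : ℝ) / p ^ 2)) * (∏ p ∈ Pr 0 (Zn K m 0), (1 - (kap C p : ℝ) / p ^ 2))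
        + D ^ 6 * (U + L + 1) ∧
    (1 - 1 / 100) * (U * L * ∏ p ∈ E, ((kap C p : ℝ) / p ^ 2)) * (∏ p ∈ Pr 0 (Zn K m 0), (1 - (kap C p : ℝ) / p ^ 2))
        - D ^ 6 * (U + L + 1) ≤
    (((Reg u0 U V L).filter (fun w => (∀ p ∈ E, C p w.1 w.2) ∧ ∀ p ∈ Pr 0 (Zn K m 0), ¬ C p w.1 w.2)).card : ℝ) := by
  obtain ⟨Cm, hCm0, hCm⟩ := mertens2_one
  set B := Real.log 2 + Cm with hB
  have hB0 : 0 ≤ B := by have := Real.log_nonneg (x := 2) (by norm_num); linarith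
  obtain ⟨C1, hC1⟩ := exists_nat_ge (10 * B + 1)
  have hC1' : (1 : ℝ) ≤ C1 := by linarith
  refine ⟨C1, by exact_mod_cast hC1', ?_⟩
  intro K m D hK hD C hC hk1 hk2 E hE hED u0 U V L
  have hK1 : 1 ≤ K := by omega
  have hKr : (7 : ℝ) ≤ K := by exact_mod_cast hK
  have hZ8 : ∀ j, (8 : ℝ) * K ≤ Zn K m j := by
    intro j
    exact_mod_cast Zn_ge K m j hK1
  set g : ℕ → ℝ := fun p => (kap C p : ℝ) / p ^ 2 with hg
  have hPb : ∀ i, ∀ p ∈ PbF K m i, p ∈ Pr 0 (Zn K m 0) := by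
    intro i p hp
    rw [Pb_union K m hK1]
    exact mem_biUnion.mpr ⟨i, mem_univ _, hp⟩
  have hPz : ∀ p ∈ Pr 0 (Zn K m 0), p.Prime ∧ p ≤ Zn K m 0 := by
    intro p hp
    rw [mem_Pr le_rfl (by positivity)] at hp
    exact ⟨hp.2, by exact_mod_cast hp.1.2⟩
  have hg0 : ∀ p, 0 ≤ g p := fun p => by simp only [hg]; positivity
  have hg1 : ∀ p ∈ Pr 0 (Zn K m 0), g p ≤ 1 := by
    intro p hp
    obtain ⟨h1, h2⟩ := hPz p hp
    have h3 := hk2 p h1 h2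
    have h4 : (kap C p : ℝ) ≤ (p : ℝ) ^ 2 := by exact_mod_cast (by omega : kap C p ≤ p ^ 2)
    exact div_le_one_of_le₀ h4 (by positivity)
  have hg2 : ∀ p ∈ Pr 0 (Zn K m 0), g p ≤ 2 * K / p := by
    intro p hp
    obtain ⟨h1, h2⟩ := hPz p hp
    have h3 : (kap C p : ℝ) ≤ 2 * K * p := by exact_mod_cast hk1 p h1 h2
    have hp0 : (0 : ℝ) < p := by exact_mod_cast h1.pos
    simp only [hg]
    rw [div_le_div_iff₀ (by positivity) hp0]
    nlinarith [mul_le_mul_of_nonneg_right h3 hp0.le]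
  set Y : ℝ := U * L * ∏ p ∈ E, g p with hY
  have hY0 : 0 ≤ Y := by
    have : 0 ≤ ∏ p ∈ E, g p := prod_nonneg fun p _ => hg0 p
    positivity
  have hM := (MF_prod C1 K m (by exact_mod_cast hC1') hK1).trans hD
  have hD1 : 1 ≤ D := by
    refine le_trans ?_ hD
    apply one_le_pow₀
    linarith [hZ8 0]
  set R : ℝ := D ^ 4 * (U + L + 1) with hR
  have hR0 : 0 ≤ R := by positivity
  set Pts := (Reg u0 U V L).filter (fun w => ∀ p ∈ E, C p w.1 w.2) with hPts
  have hcount : ∀ τ : Option (Fin m) → Finset ℕ, (∀ i, τ i ∈ Qs (rF C1 K m i) (PbF K m i)) →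
      |((Pts.filter (fun w => ∀ i, ∀ p ∈ τ i, C p w.1 w.2)).card : ℝ) - Y * ∏ i, ∏ p ∈ τ i, g p| ≤ R := by
    intro τ hτ
    have hsub : ∀ i, τ i ⊆ PbF K m i := fun i => by
      have := hτ i
      rw [Qs, mem_filter, mem_powerset] at this
      exact this.1
    have hdj : ∀ i ∈ (univ : Finset (Option (Fin m))), ∀ i' ∈ (univ : Finset (Option (Fin m))), i ≠ i' →
        Disjoint (τ i) (τ i') := fun i _ i' _ h =>
      (Pb_disj K m hK1 i i' h).mono (hsub i) (hsub i')
    set T := E ∪ univ.biUnion τ with hT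
    have hdE : Disjoint E (univ.biUnion τ) := by
      rw [disjoint_left]
      intro p hp hp'
      obtain ⟨i, _, hi⟩ := mem_biUnion.mp hp'
      have h1 := (hPz p (hPb i p (hsub i hi))).2
      have h2 := (hE p hp).2
      omega
    have hTp : ∀ p ∈ T, p.Prime := by
      intro p hp
      rcases mem_union.mp hp with h | h
      · exact (hE p h).1
      · obtain ⟨i, _, hi⟩ := mem_biUnion.mp h
        exact Pb_prime K m i p (hsub i hi)
    have hprod : ∀ f : ℕ → ℝ, ∏ p ∈ T, f p = (∏ p ∈ E, f p) * ∏ i, ∏ p ∈ τ i, f p := by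
      intro f
      rw [hT, prod_union hdE, prod_biUnion hdj]
    have h1 := crt_count C hC T hTp u0 U V L
    have e1 : (Reg u0 U V L).filter (fun w => ∀ p ∈ T, C p w.1 w.2) =
        Pts.filter (fun w => ∀ i, ∀ p ∈ τ i, C p w.1 w.2) := by
      rw [hPts, filter_filter]
      apply filter_congr
      intro w _
      rw [hT]
      simp only [mem_union, mem_biUnion, mem_univ, true_and]
      constructor
      · exact fun h => ⟨fun p hp => h p (Or.inl hp), fun i p hp => h p (Or.inr ⟨i, hp⟩)⟩
      · rintro ⟨ha, hb⟩ p (hp | ⟨i, hp⟩)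
        · exact ha p hp
        · exact hb i p hp
    rw [e1, hprod g, ← mul_assoc] at h1
    refine h1.trans ?_
    rw [hR]
    apply mul_le_mul_of_nonneg_right _ (by positivity)
    have hd : ∏ p ∈ T, (p : ℝ) ≤ D * D := by
      rw [hprod]
      apply mul_le_mul
      · have := hED
        push_cast at this
        exact this
      · refine le_trans ?_ hM
        apply prod_le_prod
        · intro i _; exact prod_nonneg fun p _ => Nat.cast_nonneg _
        · intro i _
          have := MF_bound C1 K m hK1 i (τ i) (hτ i)
          push_cast at this
          exact this
      · exact prod_nonneg fun i _ => prod_nonneg fun p _ => Nat.cast_nonneg _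
      · linarith
    calc ∏ p ∈ T, (kap C p : ℝ) ≤ ∏ p ∈ T, (p : ℝ) ^ 2 := by
          apply prod_le_prod
          · intro p _; positivity
          · intro p _; exact_mod_cast kap_le C p
      _ = (∏ p ∈ T, (p : ℝ)) ^ 2 := by rw [prod_pow]
      _ ≤ (D * D) ^ 2 := by gcongr
      _ = D ^ 4 := by ring
  have hr : ∀ i, Even (rF C1 K m i) := by
    intro i; cases i <;> simp [rF]
  have hε : ∀ i, es g (rF C1 K m i + 1) (PbF K m i) ≤ epsF K m i * ∏ p ∈ PbF K m i, (1 - g p) := by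
    intro i
    cases i with
    | none =>
      have : es g (rF C1 K m none + 1) (PbF K m none) = 0 := by
        rw [es, powersetCard_eq_empty.mpr, sum_empty]
        have := Pb_card0 K m
        simp only [rF]; omega
      rw [this]; simp [epsF]
    | some j =>
      apply blk g _ K B (by linarith)
      · intro p hp
        simp only [PbF] at hp
        rw [mem_Pr (by positivity) (by positivity)] at hp
        linarith [hp.1.1, hZ8 (j + 1)]
      · exact fun p _ => hg0 p
      · exact fun p hp => hg2 p (hPb _ p hp)
      · simp only [PbF]
        have hle : (Zn K m (j + 1) : ℝ) ≤ Zn K m j := by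
          exact_mod_cast Zn_anti K m j (j + 1) hK1 (by omega)
        have h1 := hCm (Zn K m (j + 1)) (Zn K m j) (by linarith [hZ8 (j + 1)]) hle
        refine h1.trans (le_of_eq ?_)
        rw [hB, Zn_sq K m j j.2]
        push_cast
        rw [Real.log_pow]
        have : Real.log (Zn K m (j + 1)) ≠ 0 := (Real.log_pos (by linarith [hZ8 (j + 1)])).ne'
        push_cast
        rw [mul_div_assoc, div_self this, mul_one]
      · simp only [rF]
        push_cast
        have : (0 : ℝ) ≤ ((j : ℕ) : ℝ) := by positivity
        nlinarith
  have hset : Pts.filter (fun w => ∀ i, ∀ p ∈ PbF K m i, ¬ C p w.1 w.2) =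
      (Reg u0 U V L).filter (fun w => (∀ p ∈ E, C p w.1 w.2) ∧ ∀ p ∈ Pr 0 (Zn K m 0), ¬ C p w.1 w.2) := by
    rw [hPts, filter_filter]
    apply filter_congr
    intro w _
    rw [Pb_union K m hK1]
    simp only [mem_biUnion, mem_univ, true_and]
    constructor
    · rintro ⟨h1, h2⟩; exact ⟨h1, fun p ⟨i, hi⟩ => h2 i p hi⟩
    · rintro ⟨h1, h2⟩; exact ⟨h1, fun i p hi => h2 p ⟨i, hi⟩⟩
  have hprodV : ∏ i, ∏ p ∈ PbF K m i, (1 - g p) = ∏ p ∈ Pr 0 (Zn K m 0), (1 - g p) := by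
    rw [Pb_union K m hK1, prod_biUnion]
    intro i _ i' _ h
    exact Pb_disj K m hK1 i i' h
  have hN : ∏ i, ((Qs (rF C1 K m i) (PbF K m i)).card : ℝ) ≤ D := by
    refine le_trans ?_ hM
    apply prod_le_prod
    · intro i _; exact Nat.cast_nonneg _
    · intro i _
      apply fam_card _ _ (MF_nonneg C1 K m i)
      · intro T hT p hp
        rw [Qs, mem_filter, mem_powerset] at hT
        exact Pb_prime K m i p (hT.1 hp)
      · exact fun T hT => MF_bound C1 K m hK1 i T hT
  have hm : (Fintype.card (Option (Fin m)) : ℝ) + 1 ≤ D := by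
    rw [Fintype.card_option, Fintype.card_fin]
    have h2 : m < 2 ^ m := Nat.lt_two_pow_self
    have h2' : 2 ^ m < 2 ^ 2 ^ m := Nat.lt_two_pow_self
    have h3 : 2 ^ 2 ^ m ≤ Zn K m 0 := by
      rw [Zn]; exact Nat.pow_le_pow_left (by omega) _
    have h4 : m + 2 ≤ Zn K m 0 := by omega
    have h5 : (Zn K m 0 : ℝ) ≤ D := by
      refine le_trans ?_ hD
      apply le_self_pow₀
      · linarith [hZ8 0]
      · have : 1 ≤ C1 := by exact_mod_cast hC1'
        positivity
    have h6 : ((m + 2 : ℕ) : ℝ) ≤ D := le_trans (by exact_mod_cast h4) h5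
    push_cast at h6 ⊢
    linarith
  have hfin := brun_both Pts (fun w p => C p w.1 w.2) (PbF K m) (rF C1 K m) g Y R D hY0 hR0 hD1 hr
    (fun i p _ => hg0 p) (fun i p hp => hg1 p (hPb i p hp)) hcount (epsF K m) (epsF_nonneg K m) hε
    (epsF_sum K m hK) hN hm _ hprodV _ hset
  have e : D * D * R = D ^ 6 * (U + L + 1) := by rw [hR]; ring
  rw [e] at hfin
  exact hfin

end
end STS

namespace STS
open Finset

lemma sq_dvd_cases (p u v v0 : ℕ) (hp : p.Prime) (h2 : 2 < p) (hu : ¬ p ∣ u)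
    (hv : p ^ 2 ∣ u ^ 2 + v ^ 2) (hv0 : p ^ 2 ∣ u ^ 2 + v0 ^ 2) :
    v % p ^ 2 = v0 % p ^ 2 ∨ v % p ^ 2 = (p ^ 2 - v0 % p ^ 2) % p ^ 2 := by
  have hpZ : Prime (p : ℤ) := Nat.prime_iff_prime_int.mp hp
  have h1 : ((p : ℤ) ^ 2) ∣ ((v : ℤ) - v0) * ((v : ℤ) + v0) := by
    have a : ((p : ℤ) ^ 2) ∣ (u : ℤ) ^ 2 + (v : ℤ) ^ 2 := by exact_mod_cast hv
    have b : ((p : ℤ) ^ 2) ∣ (u : ℤ) ^ 2 + (v0 : ℤ) ^ 2 := by exact_mod_cast hv0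
    have := dvd_sub a b
    have e : (u : ℤ) ^ 2 + (v : ℤ) ^ 2 - ((u : ℤ) ^ 2 + (v0 : ℤ) ^ 2) = ((v : ℤ) - v0) * ((v : ℤ) + v0) := by ring
    rwa [e] at this
  have hpv : ¬ (p : ℤ) ∣ v0 := by
    intro h
    have h' : p ∣ v0 := by exact_mod_cast h
    have a : p ∣ u ^ 2 + v0 ^ 2 := (dvd_pow_self p (by norm_num)).trans hv0
    have b : p ∣ v0 ^ 2 := h'.trans (dvd_pow_self _ (by norm_num))
    exact hu (hp.dvd_of_dvd_pow ((Nat.dvd_add_left b).mp a))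
  have hnot : ¬ ((p : ℤ) ∣ (v : ℤ) - v0 ∧ (p : ℤ) ∣ (v : ℤ) + v0) := by
    rintro ⟨a, b⟩
    have c := dvd_sub b a
    have e : (v : ℤ) + v0 - (v - v0) = 2 * v0 := by ring
    rw [e] at c
    rcases hpZ.dvd_or_dvd c with d | d
    · have : p ∣ 2 := by exact_mod_cast d
      have := Nat.le_of_dvd (by norm_num) this
      omega
    · exact hpv d
  have hpos : 0 < p ^ 2 := by have := hp.pos; positivity
  by_cases h : (p : ℤ) ∣ (v : ℤ) - v0
  · left
    have h' : ¬ (p : ℤ) ∣ (v : ℤ) + v0 := fun h3 => hnot ⟨h, h3⟩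
    have hc : IsCoprime ((p : ℤ) ^ 2) ((v : ℤ) + v0) :=
      IsCoprime.pow_left ((Prime.coprime_iff_not_dvd hpZ).mpr h')
    have h3 := hc.dvd_of_dvd_mul_right h1
    have h4 : ((p ^ 2 : ℕ) : ℤ) ∣ (v : ℤ) - v0 := by push_cast; exact h3
    exact ((Nat.modEq_iff_dvd).mpr h4).symm
  · right
    have hc : IsCoprime ((p : ℤ) ^ 2) ((v : ℤ) - v0) :=
      IsCoprime.pow_left ((Prime.coprime_iff_not_dvd hpZ).mpr h)
    have h3 := hc.dvd_of_dvd_mul_left h1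
    have hlt := Nat.mod_lt v0 hpos
    have h4 : ((p ^ 2 : ℕ) : ℤ) ∣ (v : ℤ) - ((p ^ 2 - v0 % p ^ 2 : ℕ) : ℤ) := by
      rw [Nat.cast_sub hlt.le]
      have e : (v : ℤ) - (((p ^ 2 : ℕ) : ℤ) - ((v0 % p ^ 2 : ℕ) : ℤ)) =
        (v + v0) - ((p ^ 2 : ℕ) : ℤ) * (1 + ((v0 / p ^ 2 : ℕ) : ℤ)) := by
        have := Nat.mod_add_div v0 (p ^ 2)
        have h5 : ((v0 % p ^ 2 : ℕ) : ℤ) + ((p ^ 2 : ℕ) : ℤ) * ((v0 / p ^ 2 : ℕ) : ℤ) = v0 := by exact_mod_cast this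
        linarith
      rw [e]
      apply dvd_sub
      · push_cast; exact h3
      · exact dvd_mul_right _ _
    exact ((Nat.modEq_iff_dvd).mpr h4).symm

lemma interval_le (a L d c : ℕ) (hd : 0 < d) :
    (((Ico a (a + L)).filter (fun v => v % d = c)).card : ℝ) ≤ L / d + 1 := by
  by_cases hc : c < d
  · have := interval_count a L d c hd hc
    rw [abs_le] at this
    linarith
  · have : (Ico a (a + L)).filter (fun v => v % d = c) = ∅ := by
      apply filter_false_of_mem
      intro v _ h
      exact hc (h ▸ Nat.mod_lt v hd)
    rw [this, card_empty]
    push_cast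
    positivity

lemma sq_row (p u a L : ℕ) (hp : p.Prime) (h2 : 2 < p) :
    (((Ico a (a + L)).filter (fun v => p ^ 2 ∣ u ^ 2 + v ^ 2)).card : ℝ) ≤
      2 * ((L : ℝ) / p ^ 2 + 1) + if u % p = 0 then (L : ℝ) / p + 1 else 0 := by
  have hpos : 0 < p ^ 2 := by have := hp.pos; positivity
  by_cases hu : p ∣ u
  · rw [if_pos (Nat.mod_eq_zero_of_dvd hu)]
    have hs : (Ico a (a + L)).filter (fun v => p ^ 2 ∣ u ^ 2 + v ^ 2) ⊆ (Ico a (a + L)).filter (fun v => v % p = 0) := by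
      intro v hv
      rw [mem_filter] at hv ⊢
      refine ⟨hv.1, Nat.mod_eq_zero_of_dvd ?_⟩
      have a : p ∣ u ^ 2 + v ^ 2 := (dvd_pow_self p (by norm_num)).trans hv.2
      exact hp.dvd_of_dvd_pow ((Nat.dvd_add_right (hu.trans (dvd_pow_self _ (by norm_num)))).mp a)
    have h1 : (((Ico a (a + L)).filter (fun v => p ^ 2 ∣ u ^ 2 + v ^ 2)).card : ℝ) ≤
      ((Ico a (a + L)).filter (fun v => v % p = 0)).card := by exact_mod_cast card_le_card hs
    have h3 := interval_le a L p 0 hp.pos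
    have : (0 : ℝ) ≤ 2 * ((L : ℝ) / p ^ 2 + 1) := by positivity
    linarith
  · rw [if_neg (fun h => hu (Nat.dvd_of_mod_eq_zero h)), add_zero]
    rcases ((Ico a (a + L)).filter (fun v => p ^ 2 ∣ u ^ 2 + v ^ 2)).eq_empty_or_nonempty with h | ⟨v0, hv0⟩
    · rw [h, card_empty]; push_cast; positivity
    · rw [mem_filter] at hv0
      have hs : (Ico a (a + L)).filter (fun v => p ^ 2 ∣ u ^ 2 + v ^ 2) ⊆
        (Ico a (a + L)).filter (fun v => v % p ^ 2 = v0 % p ^ 2) ∪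
        (Ico a (a + L)).filter (fun v => v % p ^ 2 = (p ^ 2 - v0 % p ^ 2) % p ^ 2) := by
        intro v hv
        rw [mem_filter] at hv
        rw [mem_union, mem_filter, mem_filter]
        rcases sq_dvd_cases p u v v0 hp h2 hu hv.2 hv0.2 with h | h
        · exact Or.inl ⟨hv.1, h⟩
        · exact Or.inr ⟨hv.1, h⟩
      have h1 : (((Ico a (a + L)).filter (fun v => p ^ 2 ∣ u ^ 2 + v ^ 2)).card : ℝ) ≤
        ((Ico a (a + L)).filter (fun v => v % p ^ 2 = v0 % p ^ 2)).card +
        ((Ico a (a + L)).filter (fun v => v % p ^ 2 = (p ^ 2 - v0 % p ^ 2) % p ^ 2)).card := by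
        exact_mod_cast (card_le_card hs).trans (card_union_le _ _)
      have h3 := interval_le a L (p ^ 2) (v0 % p ^ 2) hpos
      have h4 := interval_le a L (p ^ 2) ((p ^ 2 - v0 % p ^ 2) % p ^ 2) hpos
      push_cast at h3 h4
      linarith

lemma sqdiv_count (p : ℕ) (hp : p.Prime) (h2 : 2 < p) (u0 U : ℕ) (V : ℕ → ℕ) (L : ℕ) :
    (((Reg u0 U V L).filter (fun w => p ^ 2 ∣ w.1 ^ 2 + w.2 ^ 2)).card : ℝ) ≤
      3 * (U * L) / p ^ 2 + 3 * (U + L + 1) := by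
  have e : (Reg u0 U V L).filter (fun w => p ^ 2 ∣ w.1 ^ 2 + w.2 ^ 2) =
      (Ico u0 (u0 + U)).sigma (fun u => (Ico (V u) (V u + L)).filter (fun v => p ^ 2 ∣ u ^ 2 + v ^ 2)) := by
    ext ⟨u, v⟩
    simp only [Reg, mem_filter, mem_sigma, and_assoc]
  rw [e, card_sigma]
  push_cast
  have h1 : ∑ u ∈ Ico u0 (u0 + U), (((Ico (V u) (V u + L)).filter (fun v => p ^ 2 ∣ u ^ 2 + v ^ 2)).card : ℝ) ≤
      ∑ u ∈ Ico u0 (u0 + U), (2 * ((L : ℝ) / p ^ 2 + 1) + if u % p = 0 then (L : ℝ) / p + 1 else 0) :=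
    sum_le_sum fun u _ => sq_row p u (V u) L hp h2
  refine h1.trans ?_
  rw [sum_add_distrib, sum_const, Nat.card_Ico, ← sum_filter, sum_const]
  simp only [nsmul_eq_mul, Nat.add_sub_cancel_left]
  have h3 := interval_le u0 U p 0 hp.pos
  have hp1 : (1 : ℝ) ≤ p := by exact_mod_cast hp.pos
  have hLp : (0 : ℝ) ≤ (L : ℝ) / p + 1 := by positivity
  have h4 := mul_le_mul_of_nonneg_right h3 hLp
  have e5 : ((U : ℝ) / p + 1) * ((L : ℝ) / p + 1) = U * L / p ^ 2 + U / p + L / p + 1 := by field_simp; ring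
  have h6 : (U : ℝ) / p ≤ U := div_le_self (by positivity) hp1
  have h7 : (L : ℝ) / p ≤ L := div_le_self (by positivity) hp1
  have e8 : (U : ℝ) * (2 * ((L : ℝ) / p ^ 2 + 1)) = 2 * (U * L / p ^ 2) + 2 * U := by ring
  have e9 : 3 * ((U : ℝ) * L) / p ^ 2 = 3 * (U * L / p ^ 2) := by ring
  rw [e8, e9]
  have : (0 : ℝ) ≤ U := by positivity
  have : (0 : ℝ) ≤ L := by positivity
  linarith

lemma sum_inv_sq_aux (a n : ℕ) (ha : 1 ≤ a) : ∑ i ∈ Ioc a (a + n), 1 / (i : ℝ) ^ 2 ≤ 1 / (a : ℝ) - 1 / ((a + n : ℕ) : ℝ) := by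
  induction n with
  | zero => simp
  | succ n ih =>
    rw [← add_assoc, sum_Ioc_succ_top (by omega)]
    have h : 1 / ((a + n + 1 : ℕ) : ℝ) ^ 2 ≤ 1 / ((a + n : ℕ) : ℝ) - 1 / ((a + n + 1 : ℕ) : ℝ) := by
      have : (0 : ℝ) < (a + n : ℕ) := by exact_mod_cast (by omega)
      push_cast at this ⊢
      set t : ℝ := (a : ℝ) + n
      rw [div_sub_div _ _ this.ne' (by linarith : t + 1 ≠ 0), div_le_div_iff₀ (by positivity) (by positivity)]
      nlinarith
    linarith

lemma sum_Pr_inv_sq (a b : ℝ) (ha : 1 ≤ a) : ∑ p ∈ Pr a b, 1 / (p : ℝ) ^ 2 ≤ 2 / a := by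
  have h1 : ∑ p ∈ Pr a b, 1 / (p : ℝ) ^ 2 ≤ ∑ i ∈ Ioc ⌊a⌋₊ (⌊a⌋₊ + ⌊b⌋₊), 1 / (i : ℝ) ^ 2 := by
    apply sum_le_sum_of_subset_of_nonneg
    · intro p hp
      rw [Pr, mem_filter, mem_Ioc] at hp
      rw [mem_Ioc]; omega
    · intros; positivity
  have hf : 1 ≤ ⌊a⌋₊ := Nat.le_floor (by exact_mod_cast ha)
  have h2 := sum_inv_sq_aux ⌊a⌋₊ ⌊b⌋₊ hf
  have h3 : (0 : ℝ) ≤ 1 / ((⌊a⌋₊ + ⌊b⌋₊ : ℕ) : ℝ) := by positivity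
  have h4 : 1 / (⌊a⌋₊ : ℝ) ≤ 2 / a := by
    have hf' : (1 : ℝ) ≤ ⌊a⌋₊ := by exact_mod_cast hf
    have := Nat.lt_floor_add_one a
    rw [div_le_div_iff₀ (by linarith) (by linarith)]
    linarith
  linarith

lemma one_sub_ge (t : ℝ) (h : |t| ≤ 1 / 2) : Real.exp (-t - t ^ 2) ≤ 1 - t := by
  rw [abs_le] at h
  have e : Real.exp (-t - t ^ 2) = 1 / Real.exp (t + t ^ 2) := by rw [one_div, ← Real.exp_neg]; ring_nf
  rw [e, div_le_iff₀ (Real.exp_pos _)]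
  have h2 : 0 < 1 - t := by linarith
  by_cases ht : 0 ≤ t
  · have h1 := Real.quadratic_le_exp_of_nonneg (by positivity : 0 ≤ t + t ^ 2)
    refine le_trans ?_ (mul_le_mul_of_nonneg_left h1 h2.le)
    have h4 : 0 ≤ 1 - t - t ^ 2 - t ^ 3 := by nlinarith [mul_nonneg ht ht, mul_nonneg (mul_nonneg ht ht) (by linarith : (0:ℝ) ≤ 1/2 - t)]
    nlinarith [mul_nonneg (mul_nonneg ht ht) h4]
  · push Not at ht
    have h1 := Real.add_one_le_exp (t + t ^ 2)
    refine le_trans ?_ (mul_le_mul_of_nonneg_left h1 h2.le)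
    nlinarith [mul_nonneg (mul_self_nonneg t) (by linarith : (0:ℝ) ≤ -t)]

lemma chi_prod : ∃ c1 : ℝ, 0 < c1 ∧ ∀ z : ℝ, 2 ≤ z → c1 ≤ ∏ p ∈ Pr 0 z, (1 - chi p / p) := by
  obtain ⟨C, hC, h⟩ := mertens2_chi
  refine ⟨Real.exp (-C - 2), Real.exp_pos _, ?_⟩
  intro z hz
  have h0 : (0 : ℝ) ≤ 2 := by norm_num
  have e2 : ∀ p ∈ Pr 0 2, chi p = 0 := by
    intro p hp
    rw [mem_Pr le_rfl h0] at hp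
    have : p = 2 := by
      have h1 : p ≤ 2 := by exact_mod_cast hp.1.2
      have := hp.2.two_le
      omega
    rw [this, chi_eq]; simp
  have hsum : ∑ p ∈ Pr 0 z, chi p / (p : ℝ) = ∑ p ∈ Pr 2 z, chi p / (p : ℝ) := by
    rw [Pr_union 0 2 z le_rfl h0 hz, sum_union (Pr_disj _ _ _ _ le_rfl h0 le_rfl (by linarith)),
      sum_eq_zero (fun p hp => by rw [e2 p hp, zero_div]), zero_add]
  have h1 := h 2 z le_rfl hz
  rw [← hsum, abs_le] at h1
  have h2 : ∑ p ∈ Pr 0 z, 1 / (p : ℝ) ^ 2 ≤ 2 := by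
    have : Pr 0 z ⊆ Pr 1 z := by
      intro p hp
      rw [mem_Pr le_rfl (by linarith)] at hp
      rw [mem_Pr zero_le_one (by linarith)]
      exact ⟨⟨by exact_mod_cast hp.2.one_lt, hp.1.2⟩, hp.2⟩
    have h3 := sum_Pr_inv_sq 1 z le_rfl
    have h4 : ∑ p ∈ Pr 0 z, 1 / (p : ℝ) ^ 2 ≤ ∑ p ∈ Pr 1 z, 1 / (p : ℝ) ^ 2 :=
      sum_le_sum_of_subset_of_nonneg this (fun _ _ _ => by positivity)
    linarith
  have h5 : ∀ p ∈ Pr 0 z, (chi p / (p : ℝ)) ^ 2 ≤ 1 / (p : ℝ) ^ 2 := by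
    intro p hp
    rw [div_pow]
    have := chi_abs p
    have : chi p ^ 2 ≤ 1 := by rw [← sq_abs]; exact pow_le_one₀ (abs_nonneg _) this
    gcongr
  calc Real.exp (-C - 2) ≤ Real.exp (∑ p ∈ Pr 0 z, (-(chi p / (p : ℝ)) - (chi p / (p : ℝ)) ^ 2)) := by
        apply Real.exp_le_exp.mpr
        rw [sum_sub_distrib, sum_neg_distrib]
        have := sum_le_sum h5
        linarith
    _ = ∏ p ∈ Pr 0 z, Real.exp (-(chi p / (p : ℝ)) - (chi p / (p : ℝ)) ^ 2) := by rw [Real.exp_sum]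
    _ ≤ _ := by
        apply prod_le_prod
        · intros; exact (Real.exp_pos _).le
        · intro p hp
          apply one_sub_ge
          rw [mem_Pr le_rfl (by linarith)] at hp
          have h2 : (2 : ℝ) ≤ p := by exact_mod_cast hp.2.two_le
          rw [abs_div, abs_of_nonneg (by linarith : (0 : ℝ) ≤ p)]
          rw [div_le_div_iff₀ (by linarith) (by norm_num)]
          have := chi_abs p
          linarith

lemma jensen {α : Type*} (G : Finset α) (f : α → ℝ) (μ : ℝ) (h : ∑ w ∈ G, f w ≤ μ * G.card) :
    (G.card : ℝ) * Real.exp (-(μ * Real.log 2)) ≤ ∑ w ∈ G, Real.exp (-(f w * Real.log 2)) := by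
  have hl : 0 < Real.log 2 := Real.log_pos (by norm_num)
  have h1 : ∀ w ∈ G, Real.exp (-(μ * Real.log 2)) * (1 - (f w - μ) * Real.log 2) ≤ Real.exp (-(f w * Real.log 2)) := by
    intro w _
    have e : Real.exp (-(f w * Real.log 2)) = Real.exp (-(μ * Real.log 2)) * Real.exp (-((f w - μ) * Real.log 2)) := by
      rw [← Real.exp_add]; ring_nf
    rw [e]
    apply mul_le_mul_of_nonneg_left _ (Real.exp_pos _).le
    have := Real.add_one_le_exp (-((f w - μ) * Real.log 2))
    linarith
  refine le_trans ?_ (sum_le_sum h1)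
  rw [← mul_sum, sum_sub_distrib, ← sum_mul, sum_sub_distrib]
  simp only [sum_const, nsmul_eq_mul, mul_one]
  rw [mul_comm]
  apply mul_le_mul_of_nonneg_left _ (Real.exp_pos _).le
  nlinarith

lemma Omega_bound (n z : ℕ) (D : ℝ) (hn : 0 < n) (hD : 1 < D) (hnD : (n : ℝ) ≤ D ^ 100)
    (h1 : ∀ p ∈ Pr 0 z, ¬ p ∣ n) (h2 : ∀ p ∈ Pr z D, ¬ p ^ 2 ∣ n) :
    ArithmeticFunction.cardFactors n ≤ ((Pr z D).filter (fun p => p ∣ n)).card + 100 := by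
  have hz : (0 : ℝ) ≤ z := by positivity
  have hD0 : 0 ≤ D := by linarith
  rw [ArithmeticFunction.cardFactors_eq_sum_factorization, Finsupp.sum]
  have hsup : n.factorization.support = n.primeFactors := rfl
  rw [hsup, ← sum_filter_add_sum_filter_not n.primeFactors (fun p : ℕ => (p : ℝ) ≤ D)]
  apply Nat.add_le_add
  · calc ∑ p ∈ n.primeFactors.filter (fun p : ℕ => (p : ℝ) ≤ D), n.factorization p
        ≤ ∑ p ∈ n.primeFactors.filter (fun p : ℕ => (p : ℝ) ≤ D), 1 := by
          apply sum_le_sum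
          intro p hp
          rw [mem_filter, Nat.mem_primeFactors] at hp
          by_contra hcon
          push Not at hcon
          have hpz : (z : ℝ) < p := by
            by_contra h
            push Not at h
            exact h1 p ((mem_Pr le_rfl hz).mpr ⟨⟨by exact_mod_cast hp.1.1.pos, h⟩, hp.1.1⟩) hp.1.2.1
          exact h2 p ((mem_Pr hz hD0).mpr ⟨⟨hpz, hp.2⟩, hp.1.1⟩)
            ((hp.1.1.pow_dvd_iff_le_factorization hn.ne').mpr hcon)
      _ = (n.primeFactors.filter (fun p : ℕ => (p : ℝ) ≤ D)).card := by simp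
      _ ≤ _ := by
          apply card_le_card
          intro p hp
          rw [mem_filter, Nat.mem_primeFactors] at hp
          rw [mem_filter]
          have hpz : (z : ℝ) < p := by
            by_contra h
            push Not at h
            exact h1 p ((mem_Pr le_rfl hz).mpr ⟨⟨by exact_mod_cast hp.1.1.pos, h⟩, hp.1.1⟩) hp.1.2.1
          exact ⟨(mem_Pr hz hD0).mpr ⟨⟨hpz, hp.2⟩, hp.1.1⟩, hp.1.2.1⟩
  · set S := n.primeFactors.filter (fun p : ℕ => ¬ (p : ℝ) ≤ D) with hS
    have hprod : ((∏ p ∈ S, p ^ n.factorization p : ℕ) : ℝ) ≤ n := by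
      have : ∏ p ∈ S, p ^ n.factorization p ≤ n := by
        conv_rhs => rw [← Nat.prod_factorization_pow_eq_self hn.ne']
        rw [Finsupp.prod, hsup]
        apply prod_le_prod_of_subset_of_one_le' (filter_subset _ _)
        intro p hp _
        exact Nat.one_le_pow _ _ (Nat.mem_primeFactors.mp hp).1.pos
      exact_mod_cast this
    have h3 : D ^ (∑ p ∈ S, n.factorization p) ≤ ((∏ p ∈ S, p ^ n.factorization p : ℕ) : ℝ) := by
      rw [← prod_pow_eq_pow_sum]
      push_cast
      apply prod_le_prod
      · intros; positivity
      · intro p hp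
        rw [hS, mem_filter] at hp
        push Not at hp
        exact pow_le_pow_left₀ hD0 hp.2.le _
    exact (pow_le_pow_iff_right₀ hD).mp (h3.trans (hprod.trans hnD))

end STS

namespace STS
open Finset

/-- starting point of the column -/
def Vst (q j0 u : ℕ) : ℕ := Nat.sqrt (j0 * q - u ^ 2) + 1

lemma region_geom (q j0 : ℕ) (s : ℝ) (hq : 1 ≤ q) (hs : 0 < s) (hs2 : s ^ 2 = ((j0 : ℝ) + 1) * q) (h8 : 8 * s ≤ q) :
    (∀ w ∈ Reg 1 ⌊s / 2⌋₊ (Vst q j0) ⌊(q : ℝ) / (4 * s)⌋₊,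
      j0 * q < w.1 ^ 2 + w.2 ^ 2 ∧ w.1 ^ 2 + w.2 ^ 2 ≤ (j0 + 1) * q) ∧
    (q : ℝ) / 32 ≤ (⌊s / 2⌋₊ : ℝ) * ⌊(q : ℝ) / (4 * s)⌋₊ ∧
    (⌊s / 2⌋₊ : ℝ) + ⌊(q : ℝ) / (4 * s)⌋₊ + 1 ≤ 2 * s := by
  have hqr : (1 : ℝ) ≤ q := by exact_mod_cast hq
  have hj0 : (0 : ℝ) ≤ j0 := by positivity
  have hqs : (q : ℝ) ≤ s ^ 2 := by rw [hs2]; nlinarith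
  have hs8 : 8 ≤ s := by nlinarith
  set Uf := s / 2 with hU
  set Lf := (q : ℝ) / (4 * s) with hL
  have hLs : Lf * s = q / 4 := by rw [hL]; field_simp
  have hL2 : 2 ≤ Lf := by rw [hL, le_div_iff₀ (by positivity)]; linarith
  have hL4 : Lf ≤ s / 4 := by
    rw [hL, div_le_iff₀ (by positivity)]; nlinarith
  have hLsq : Lf ^ 2 ≤ q / 16 := by nlinarith
  have hU1 := Nat.floor_le (by positivity : 0 ≤ Uf)
  have hU2 := Nat.lt_floor_add_one Uf
  have hL1 := Nat.floor_le (by positivity : 0 ≤ Lf)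
  have hL3 := Nat.lt_floor_add_one Lf
  refine ⟨?_, ?_, ?_⟩
  · intro w hw
    rw [mem_Reg] at hw
    obtain ⟨⟨hu1, hu2⟩, hv1, hv2⟩ := hw
    obtain ⟨u, v⟩ := w
    simp only [Vst] at *
    set t := j0 * q - u ^ 2 with ht
    have hr1 : Nat.sqrt t ^ 2 ≤ t := Nat.sqrt_le' t
    have hr2 : t < (Nat.sqrt t + 1) ^ 2 := Nat.lt_succ_sqrt' t
    constructor
    · have h1 : (Nat.sqrt t + 1) ^ 2 ≤ v ^ 2 := Nat.pow_le_pow_left hv1 2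
      omega
    · have hu3 : (u : ℝ) ≤ Uf := le_trans (by exact_mod_cast (by omega : u ≤ ⌊Uf⌋₊)) hU1
      have hv3 : (v : ℝ) ≤ Nat.sqrt t + Lf := by
        have : v ≤ Nat.sqrt t + ⌊Lf⌋₊ := by omega
        have : (v : ℝ) ≤ Nat.sqrt t + (⌊Lf⌋₊ : ℝ) := by exact_mod_cast this
        linarith
      have hv0 : (0 : ℝ) ≤ v := by positivity
      have hu0 : (0 : ℝ) ≤ u := by positivity
      have hru : (u : ℝ) ^ 2 ≤ s ^ 2 / 4 := by rw [hU] at hu3; nlinarith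
      have hgoal : (u : ℝ) ^ 2 + (v : ℝ) ^ 2 ≤ ((j0 : ℝ) + 1) * q := by
        rcases le_total (u ^ 2) (j0 * q) with h | h
        · have hr3 : ((Nat.sqrt t : ℕ) : ℝ) ^ 2 ≤ j0 * q - (u : ℝ) ^ 2 := by
            have h5 : ((Nat.sqrt t : ℕ) : ℝ) ^ 2 ≤ (t : ℝ) := by exact_mod_cast hr1
            rw [ht, Nat.cast_sub h] at h5
            push_cast at h5
            exact h5
          set r : ℝ := ((Nat.sqrt t : ℕ) : ℝ) with hr
          have hr0 : 0 ≤ r := by positivity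
          have hrs : r ≤ s := by
            refine (pow_le_pow_iff_left₀ hr0 hs.le two_ne_zero).mp ?_
            rw [hs2]
            have := sq_nonneg (u : ℝ)
            linarith
          have : (v : ℝ) ^ 2 ≤ (r + Lf) ^ 2 := by gcongr
          have h6 : r * Lf ≤ s * Lf := mul_le_mul_of_nonneg_right hrs (by linarith)
          have h7 : (r + Lf) ^ 2 = r ^ 2 + 2 * (r * Lf) + Lf ^ 2 := by ring
          linarith
        · have ht0 : t = 0 := by omega
          rw [ht0] at hv3
          simp at hv3
          have : (v : ℝ) ^ 2 ≤ Lf ^ 2 := by gcongr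
          linarith
      exact_mod_cast hgoal
  · have a1 : s / 4 ≤ (⌊Uf⌋₊ : ℝ) := by rw [hU] at *; linarith
    have a2 : Lf / 2 ≤ (⌊Lf⌋₊ : ℝ) := by linarith
    calc (q : ℝ) / 32 = s / 4 * (Lf / 2) := by linarith
      _ ≤ _ := by gcongr
  · rw [hU] at *; linarith

/-- abstract multiplicity argument -/
lemma mult_count (G : Finset (Σ _ : ℕ, ℕ)) (z : ℕ) (D : ℝ) (hD : 1 < D) (b : ℕ)
    (hb : ∀ w ∈ G, b < w.1 ^ 2 + w.2 ^ 2)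
    (hnD : ∀ w ∈ G, ((w.1 ^ 2 + w.2 ^ 2 : ℕ) : ℝ) ≤ D ^ 100)
    (h1 : ∀ w ∈ G, ∀ p ∈ Pr 0 z, ¬ p ∣ w.1 ^ 2 + w.2 ^ 2)
    (h2 : ∀ w ∈ G, ∀ p ∈ Pr z D, ¬ p ^ 2 ∣ w.1 ^ 2 + w.2 ^ 2) (μ : ℝ)
    (hμ : ∑ w ∈ G, (((Pr z D).filter (fun p => p ∣ w.1 ^ 2 + w.2 ^ 2)).card : ℝ) ≤ μ * G.card) :
    (G.card : ℝ) * Real.exp (-(μ * Real.log 2)) ≤ 2 ^ 102 * ((G.image (fun w => w.1 ^ 2 + w.2 ^ 2 - b)).card : ℝ) := by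
  refine (jensen G _ μ hμ).trans ?_
  rw [← sum_fiberwise_of_maps_to (s := G) (t := G.image (fun w => w.1 ^ 2 + w.2 ^ 2 - b))
    (g := fun w => w.1 ^ 2 + w.2 ^ 2 - b) (fun w hw => mem_image_of_mem _ hw)]
  have key : ∀ a ∈ G.image (fun w => w.1 ^ 2 + w.2 ^ 2 - b),
      ∑ w ∈ G.filter (fun w => w.1 ^ 2 + w.2 ^ 2 - b = a),
        Real.exp (-((((Pr z D).filter (fun p => p ∣ w.1 ^ 2 + w.2 ^ 2)).card : ℝ) * Real.log 2)) ≤ 2 ^ 102 := by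
    intro a ha
    obtain ⟨w0, hw0, rfl⟩ := mem_image.mp ha
    set n := w0.1 ^ 2 + w0.2 ^ 2 with hn
    have hbn := hb w0 hw0
    have hF : ∀ w ∈ G.filter (fun w => w.1 ^ 2 + w.2 ^ 2 - b = n - b), w.1 ^ 2 + w.2 ^ 2 = n := by
      intro w hw
      rw [mem_filter] at hw
      have := hb w hw.1
      omega
    have hn0 : 0 < n := by omega
    have hc := rep_bound n hn0 _ hF
    have hO := Omega_bound n z D hn0 hD (hnD w0 hw0) (h1 w0 hw0) (h2 w0 hw0)
    set f := ((Pr z D).filter (fun p => p ∣ n)).card with hf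
    have e : ∑ w ∈ G.filter (fun w => w.1 ^ 2 + w.2 ^ 2 - b = n - b),
        Real.exp (-((((Pr z D).filter (fun p => p ∣ w.1 ^ 2 + w.2 ^ 2)).card : ℝ) * Real.log 2)) =
        ∑ w ∈ G.filter (fun w => w.1 ^ 2 + w.2 ^ 2 - b = n - b), ((2 : ℝ) ^ f)⁻¹ := by
      apply sum_congr rfl
      intro w hw
      rw [hF w hw, ← hf, Real.exp_neg, Real.exp_nat_mul, Real.exp_log (by norm_num)]
    rw [e, sum_const, nsmul_eq_mul]
    have h5 : ((G.filter (fun w => w.1 ^ 2 + w.2 ^ 2 - b = n - b)).card : ℝ) ≤ 4 * 2 ^ (f + 100) := by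
      calc ((G.filter (fun w => w.1 ^ 2 + w.2 ^ 2 - b = n - b)).card : ℝ) ≤ ((4 * 2 ^ (ArithmeticFunction.cardFactors n) : ℕ) : ℝ) := by
            exact_mod_cast hc
        _ = 4 * 2 ^ (ArithmeticFunction.cardFactors n) := by push_cast; rfl
        _ ≤ _ := by
            have : (2 : ℝ) ^ (ArithmeticFunction.cardFactors n) ≤ 2 ^ (f + 100) := pow_le_pow_right₀ (by norm_num) hO
            linarith
    calc _ ≤ 4 * (2 : ℝ) ^ (f + 100) * ((2 : ℝ) ^ f)⁻¹ := by gcongr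
      _ = 2 ^ 102 := by rw [pow_add]; field_simp; norm_num
  refine (sum_le_sum key).trans ?_
  rw [sum_const, nsmul_eq_mul, mul_comm]

end STS

namespace STS
open Finset
section
open Classical

/-- the sieve constant -/
noncomputable def C1c : ℕ := sieve.choose
lemma C1c_pos : 1 ≤ C1c := sieve.choose_spec.1

/-- density of the sieved `a` -/
noncomputable def VA (q k z : ℕ) : ℝ := ∏ p ∈ Pr 0 z, (1 - (kap (CA q k) p : ℝ) / p ^ 2)
/-- density of the sieved pairs -/
noncomputable def VB (q k z : ℕ) : ℝ := VA q k z * ∏ p ∈ Pr 0 z, (1 - chi p / p)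

lemma VB_eq (q k i0 z : ℕ) (hi : i0 < k) : ∏ p ∈ Pr 0 z, (1 - (kap (CB q k i0) p : ℝ) / p ^ 2) = VB q k z := by
  rw [VB, VA, ← prod_mul_distrib]
  apply prod_congr rfl
  intro p hp
  exact one_sub_CB q k i0 p (mem_filter.mp hp).2 hi

lemma one_sub_CA (q k p : ℕ) (hp : p.Prime) : 1 / (p : ℝ) ≤ 1 - (kap (CA q k) p : ℝ) / p ^ 2 := by
  rw [kap_CA q k p hp]
  have h0 : (0 : ℝ) < p := by exact_mod_cast hp.pos
  have h1 : (kappa q k p : ℝ) + 1 ≤ p := by exact_mod_cast kappa_lt q k p hp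
  push_cast
  have e : 1 - (kappa q k p : ℝ) * p / p ^ 2 = (p - kappa q k p) / p := by field_simp
  rw [e]
  gcongr
  linarith

lemma VA_pos (q k z : ℕ) : 0 < VA q k z := by
  apply prod_pos
  intro p hp
  have hpp := (mem_filter.mp hp).2
  have h0 : (0 : ℝ) < p := by exact_mod_cast hpp.pos
  have := one_sub_CA q k p hpp
  have : 0 < 1 / (p : ℝ) := by positivity
  linarith

lemma kapCB_le (q k i0 K p : ℕ) (hp : p.Prime) (hi : i0 < k) (hk : k ≤ K) : kap (CB q k i0) p ≤ 2 * K * p := by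
  have h := kap_CB q k i0 p hp hi
  have h1 : (kappa q k p : ℝ) + 1 ≤ p := by exact_mod_cast kappa_lt q k p hp
  have h2 : (kappa q k p : ℝ) ≤ K := by exact_mod_cast (kappa_le q k p).trans hk
  have h3 : (1 : ℝ) ≤ K := by exact_mod_cast (by omega : 1 ≤ K)
  have h4 := (abs_le.mp (chi_abs p)).2
  have h0 : (0 : ℝ) < p := by exact_mod_cast hp.pos
  have h5 : (0 : ℝ) ≤ kappa q k p := by positivity
  have : (kap (CB q k i0) p : ℝ) ≤ 2 * K * p := by
    rw [h]
    have h6 : chi p * (p - kappa q k p) ≤ 1 * (p - kappa q k p) := mul_le_mul_of_nonneg_right h4 (by linarith)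
    have h7 : (kappa q k p : ℝ) * p ≤ K * p := mul_le_mul_of_nonneg_right h2 h0.le
    have h8 : 1 * (p : ℝ) ≤ K * p := mul_le_mul_of_nonneg_right h3 h0.le
    nlinarith
  exact_mod_cast this

lemma kapCB_lt (q k i0 p : ℕ) (hp : p.Prime) (hi : i0 < k) : kap (CB q k i0) p + 1 ≤ p ^ 2 := by
  have h := one_sub_CB q k i0 p hp hi
  have h0 : (0 : ℝ) < p := by exact_mod_cast hp.pos
  have h1 := one_sub_CA q k p hp
  have h2 : (2 : ℝ) ≤ p := by exact_mod_cast hp.two_le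
  have h3 : 0 < 1 - chi p / p := by
    have h4 := (abs_le.mp (chi_abs p)).2
    rw [sub_pos, div_lt_one h0]; linarith
  have h5 : 0 < 1 - (kap (CB q k i0) p : ℝ) / p ^ 2 := by
    rw [h]
    have : 0 < 1 / (p : ℝ) := by positivity
    exact mul_pos (by linarith) h3
  rw [sub_pos, div_lt_one (by positivity)] at h5
  have : kap (CB q k i0) p < p ^ 2 := by exact_mod_cast h5
  omega

/-- mixed condition -/
def CM (q k i0 z : ℕ) (p u v : ℕ) : Prop := if p ≤ z then CB q k i0 p u v else C0 p u v

lemma kap_congr (C C' : ℕ → ℕ → ℕ → Prop) (p : ℕ) (h : ∀ u v, C p u v ↔ C' p u v) : kap C p = kap C' p := by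
  rw [kap, kap]
  congr 1
  apply filter_congr
  intro w _
  exact h _ _

lemma CM_per (q k i0 z : ℕ) : Per (CM q k i0 z) := by
  intro p u v u' v' hu hv
  simp only [CM]
  split_ifs
  · exact CB_per q k i0 p u v u' v' hu hv
  · exact C0_per p u v u' v' hu hv

lemma kap_CM_le (q k i0 z p : ℕ) (h : p ≤ z) : kap (CM q k i0 z) p = kap (CB q k i0) p :=
  kap_congr _ _ p fun u v => by simp [CM, h]
lemma kap_CM_gt (q k i0 z p : ℕ) (h : z < p) : kap (CM q k i0 z) p = kap C0 p :=
  kap_congr _ _ p fun u v => by simp [CM, h]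

/-- sieved pairs -/
noncomputable def SB (q k i0 z u0 U : ℕ) (V : ℕ → ℕ) (L : ℕ) : Finset (Σ _ : ℕ, ℕ) :=
  (Reg u0 U V L).filter (fun w => ∀ p ∈ Pr 0 z, ¬ CB q k i0 p w.1 w.2)

lemma mem_Pr0 (z p : ℕ) : p ∈ Pr 0 z ↔ p ≤ z ∧ p.Prime := by
  rw [mem_Pr le_rfl (by positivity)]
  constructor
  · rintro ⟨⟨_, h⟩, h'⟩; exact ⟨by exact_mod_cast h, h'⟩
  · rintro ⟨h, h'⟩; exact ⟨⟨by exact_mod_cast h'.pos, by exact_mod_cast h⟩, h'⟩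

lemma sieve_CB (K m k q i0 : ℕ) (D : ℝ) (hK : 7 ≤ K) (hk : k ≤ K) (hi : i0 < k)
    (hD : (Zn K m 0 : ℝ) ^ (20 * C1c * K) ≤ D) (hD1 : 1 ≤ D) (u0 U : ℕ) (V : ℕ → ℕ) (L : ℕ) :
    (1 - 1 / 100) * (U * L) * VB q k (Zn K m 0) - D ^ 6 * (U + L + 1) ≤
      ((SB q k i0 (Zn K m 0) u0 U V L).card : ℝ) := by
  have h := (sieve.choose_spec.2 K m D hK hD (CB q k i0) (CB_per q k i0)
    (fun p hp _ => kapCB_le q k i0 K p hp hi hk) (fun p hp _ => kapCB_lt q k i0 p hp hi) ∅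
    (by simp) (by simpa using hD1) u0 U V L).2
  rw [VB_eq q k i0 _ hi, prod_empty, mul_one] at h
  refine h.trans (le_of_eq ?_)
  congr 2
  rw [SB]
  apply filter_congr
  intro w _
  simp

lemma sieve_CBp (K m k q i0 : ℕ) (D : ℝ) (hK : 7 ≤ K) (hk : k ≤ K) (hi : i0 < k)
    (hD : (Zn K m 0 : ℝ) ^ (20 * C1c * K) ≤ D) (u0 U : ℕ) (V : ℕ → ℕ) (L : ℕ)
    (p0 : ℕ) (hp0 : p0.Prime) (hz : Zn K m 0 < p0) (hpD : (p0 : ℝ) ≤ D) :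
    (((SB q k i0 (Zn K m 0) u0 U V L).filter (fun w => p0 ∣ w.1 ^ 2 + w.2 ^ 2)).card : ℝ) ≤
    (1 + 1 / 100) * (U * L * ((kap C0 p0 : ℝ) / p0 ^ 2)) * VB q k (Zn K m 0) + D ^ 6 * (U + L + 1) := by
  have h := (sieve.choose_spec.2 K m D hK hD (CM q k i0 (Zn K m 0)) (CM_per q k i0 _)
    (fun p hp hle => by rw [kap_CM_le _ _ _ _ _ hle]; exact kapCB_le q k i0 K p hp hi hk)
    (fun p hp hle => by rw [kap_CM_le _ _ _ _ _ hle]; exact kapCB_lt q k i0 p hp hi) {p0}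
    (by simp [hp0, hz]) (by simpa using hpD) u0 U V L).1
  have e : ∏ p ∈ Pr 0 (Zn K m 0), (1 - (kap (CM q k i0 (Zn K m 0)) p : ℝ) / p ^ 2) = VB q k (Zn K m 0) := by
    rw [← VB_eq q k i0 _ hi]
    apply prod_congr rfl
    intro p hp
    rw [kap_CM_le _ _ _ _ _ ((mem_Pr0 _ _).mp hp).1]
  rw [e, prod_singleton, kap_CM_gt _ _ _ _ _ hz] at h
  refine le_trans (le_of_eq ?_) h
  congr 2
  rw [SB, filter_filter]
  apply filter_congr
  intro w _
  simp only [mem_singleton, forall_eq]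
  rw [and_comm]
  apply and_congr
  · simp only [CM, C0, if_neg (not_le.mpr hz)]
  · apply forall_congr'; intro p
    apply forall_congr'; intro hp
    simp only [CM, if_pos ((mem_Pr0 _ _).mp hp).1]

lemma kapC0_le (p : ℕ) (hp : p.Prime) : (kap C0 p : ℝ) / p ^ 2 ≤ 1 / p + chi p / p + 1 / (p : ℝ) ^ 2 := by
  rw [kap_C0 p hp]
  have h0 : (0 : ℝ) < p := by exact_mod_cast hp.pos
  have e : 1 / (p : ℝ) + chi p / p + 1 / (p : ℝ) ^ 2 = (p + chi p * p + 1) / p ^ 2 := by field_simp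
  rw [e]
  apply div_le_div_of_nonneg_right _ (by positivity)
  have := (abs_le.mp (chi_abs p)).1
  linarith

/-- the average number of prime factors -/
lemma kapC0_sum : ∃ B : ℝ, 0 < B ∧ ∀ (K z : ℕ) (D : ℝ), 7 ≤ K → 2 ≤ z → (z : ℝ) ≤ D →
    Real.log D ≤ 40 * C1c * K * Real.log z → ∑ p ∈ Pr z D, (kap C0 p : ℝ) / p ^ 2 ≤ Real.log K + B := by
  obtain ⟨Ca, hCa, ha⟩ := mertens2_one
  obtain ⟨Cb, hCb, hb⟩ := mertens2_chi
  have hC1 : (1 : ℝ) ≤ C1c := by exact_mod_cast C1c_pos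
  refine ⟨Real.log (40 * C1c) + Ca + Cb + 1, ?_, ?_⟩
  · have : 0 < Real.log (40 * C1c) := Real.log_pos (by linarith)
    linarith
  intro K z D hK hz hzD hlog
  have hz2 : (2 : ℝ) ≤ z := by exact_mod_cast hz
  have hK7 : (7 : ℝ) ≤ K := by exact_mod_cast hK
  have h1 := ha z D hz2 hzD
  have h2 := (abs_le.mp (hb z D hz2 hzD)).2
  have h3 := sum_Pr_inv_sq z D (by linarith)
  have h4 : 2 / (z : ℝ) ≤ 1 := by rw [div_le_one (by linarith)]; exact hz2
  have h5 : ∑ p ∈ Pr z D, (kap C0 p : ℝ) / p ^ 2 ≤ ∑ p ∈ Pr z D, (1 / (p : ℝ) + chi p / p + 1 / (p : ℝ) ^ 2) :=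
    sum_le_sum fun p hp => kapC0_le p (mem_filter.mp hp).2
  rw [sum_add_distrib, sum_add_distrib] at h5
  have hlz : 0 < Real.log z := Real.log_pos (by linarith)
  have hlD : 0 < Real.log D := Real.log_pos (by linarith)
  have h6 : Real.log (Real.log D / Real.log z) ≤ Real.log (40 * C1c) + Real.log K := by
    rw [← Real.log_mul (by positivity) (by positivity)]
    apply Real.log_le_log (by positivity)
    rw [div_le_iff₀ hlz]; exact hlog
  linarith

end
end STS

namespace STS
open Finset
section
open Classical

/-- sieved residues -/
noncomputable def Aset (q k z : ℕ) : Finset ℕ := (Icc 1 q).filter (fun a => ∀ p ∈ Pr 0 z, ¬ CA q k p a 0)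

/-- those with the given translate a sum of two squares -/
noncomputable def Aj (q k z i0 : ℕ) : Finset ℕ :=
  (Aset q k z).filter (fun a => ∃ u v : ℕ, a + 4 * i0 ^ 2 * q = u ^ 2 + v ^ 2)

lemma CB_CA (q k i0 p a u v : ℕ) (h : a + 4 * i0 ^ 2 * q = u ^ 2 + v ^ 2) (hA : CA q k p a 0) : CB q k i0 p u v := by
  obtain ⟨i, hi, hd⟩ := hA
  refine ⟨i, hi, ?_⟩
  have e : (u : ℤ) ^ 2 + (v : ℤ) ^ 2 + 4 * (i : ℤ) ^ 2 * q - 4 * (i0 : ℤ) ^ 2 * q = ((a + 4 * i ^ 2 * q : ℕ) : ℤ) := by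
    have : (a : ℤ) + 4 * (i0 : ℤ) ^ 2 * q = (u : ℤ) ^ 2 + (v : ℤ) ^ 2 := by exact_mod_cast h
    push_cast
    linarith
  rw [e]
  exact_mod_cast hd

lemma card_Pr_le (z : ℕ) (D : ℝ) (hD : 0 ≤ D) : ((Pr z D).card : ℝ) ≤ D := by
  have h : (Pr z D).card ≤ ⌊D⌋₊ := by
    rw [Pr]
    refine (card_filter_le _ _).trans ?_
    rw [Nat.card_Ioc]; omega
  calc ((Pr z D).card : ℝ) ≤ (⌊D⌋₊ : ℝ) := by exact_mod_cast h
    _ ≤ D := Nat.floor_le hD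

lemma sum_f_le (K m k q i0 : ℕ) (D : ℝ) (hK : 7 ≤ K) (hk : k ≤ K) (hi : i0 < k)
    (hD : (Zn K m 0 : ℝ) ^ (20 * C1c * K) ≤ D) (hD1 : 1 ≤ D) (u0 U : ℕ) (V : ℕ → ℕ) (L : ℕ) (hVB : 0 ≤ VB q k (Zn K m 0))
    (B : ℝ) (hB : ∑ p ∈ Pr (Zn K m 0) D, (kap C0 p : ℝ) / p ^ 2 ≤ B) :
    ∑ w ∈ SB q k i0 (Zn K m 0) u0 U V L, (((Pr (Zn K m 0) D).filter (fun p => p ∣ w.1 ^ 2 + w.2 ^ 2)).card : ℝ) ≤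
    (1 + 1 / 100) * (U * L * VB q k (Zn K m 0)) * B + D ^ 7 * (U + L + 1) := by
  have hz : (0 : ℝ) ≤ (Zn K m 0 : ℕ) := by positivity
  have e : ∑ w ∈ SB q k i0 (Zn K m 0) u0 U V L, (((Pr (Zn K m 0) D).filter (fun p => p ∣ w.1 ^ 2 + w.2 ^ 2)).card : ℝ) =
      ∑ p ∈ Pr (Zn K m 0) D, (((SB q k i0 (Zn K m 0) u0 U V L).filter (fun w => p ∣ w.1 ^ 2 + w.2 ^ 2)).card : ℝ) := by
    simp_rw [card_filter]
    push_cast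
    rw [sum_comm]
  rw [e]
  have h1 : ∀ p ∈ Pr (Zn K m 0) D, (((SB q k i0 (Zn K m 0) u0 U V L).filter (fun w => p ∣ w.1 ^ 2 + w.2 ^ 2)).card : ℝ) ≤
      (1 + 1 / 100) * (U * L * VB q k (Zn K m 0)) * ((kap C0 p : ℝ) / p ^ 2) + D ^ 6 * (U + L + 1) := by
    intro p hp
    rw [mem_Pr hz (by linarith)] at hp
    have := sieve_CBp K m k q i0 D hK hk hi hD u0 U V L p hp.2 (by exact_mod_cast hp.1.1) hp.1.2
    refine this.trans (le_of_eq ?_)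
    ring
  refine (sum_le_sum h1).trans ?_
  rw [sum_add_distrib, ← mul_sum, sum_const, nsmul_eq_mul]
  have h2 := card_Pr_le (Zn K m 0) D (by linarith)
  have h3 : (0 : ℝ) ≤ D ^ 6 * (U + L + 1) := by positivity
  have h4 := mul_le_mul_of_nonneg_right h2 h3
  have h5 : (0 : ℝ) ≤ (1 + 1 / 100) * (U * L * VB q k (Zn K m 0)) := by positivity
  have h6 := mul_le_mul_of_nonneg_left hB h5
  calc _ ≤ _ := add_le_add h6 h4
    _ = _ := by ring

lemma sq_bad (z : ℕ) (D : ℝ) (hz : 2 ≤ z) (hD : 1 ≤ D) (u0 U : ℕ) (V : ℕ → ℕ) (L : ℕ) :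
    (((Reg u0 U V L).filter (fun w => ∃ p ∈ Pr z D, p ^ 2 ∣ w.1 ^ 2 + w.2 ^ 2)).card : ℝ) ≤
      6 * (U * L) / z + 3 * D * (U + L + 1) := by
  have hz0 : (0 : ℝ) ≤ z := by positivity
  have hz2 : (2 : ℝ) ≤ z := by exact_mod_cast hz
  have hs : (Reg u0 U V L).filter (fun w => ∃ p ∈ Pr z D, p ^ 2 ∣ w.1 ^ 2 + w.2 ^ 2) ⊆
      (Pr z D).biUnion (fun p => (Reg u0 U V L).filter (fun w => p ^ 2 ∣ w.1 ^ 2 + w.2 ^ 2)) := by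
    intro w hw
    rw [mem_filter] at hw
    obtain ⟨hw1, p, hp, hpd⟩ := hw
    exact mem_biUnion.mpr ⟨p, hp, mem_filter.mpr ⟨hw1, hpd⟩⟩
  have h1 : (((Reg u0 U V L).filter (fun w => ∃ p ∈ Pr z D, p ^ 2 ∣ w.1 ^ 2 + w.2 ^ 2)).card : ℝ) ≤
      ∑ p ∈ Pr z D, (((Reg u0 U V L).filter (fun w => p ^ 2 ∣ w.1 ^ 2 + w.2 ^ 2)).card : ℝ) := by
    exact_mod_cast (card_le_card hs).trans card_biUnion_le
  have h2 : ∀ p ∈ Pr z D, (((Reg u0 U V L).filter (fun w => p ^ 2 ∣ w.1 ^ 2 + w.2 ^ 2)).card : ℝ) ≤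
      3 * (U * L) * (1 / (p : ℝ) ^ 2) + 3 * (U + L + 1) := by
    intro p hp
    rw [mem_Pr hz0 (by linarith)] at hp
    have : z < p := by exact_mod_cast hp.1.1
    refine (sqdiv_count p hp.2 (by omega) u0 U V L).trans (le_of_eq ?_)
    ring
  refine h1.trans ((sum_le_sum h2).trans ?_)
  rw [sum_add_distrib, ← mul_sum, sum_const, nsmul_eq_mul]
  have h3 := sum_Pr_inv_sq z D (by linarith)
  have h4 := card_Pr_le z D (by linarith)
  have h5 : (0 : ℝ) ≤ 3 * (U + L + 1) := by positivity
  have h6 : (0 : ℝ) ≤ 3 * (U * L) := by positivity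
  have h7 := mul_le_mul_of_nonneg_right h4 h5
  have h8 := mul_le_mul_of_nonneg_left h3 h6
  calc _ ≤ _ := add_le_add h8 h7
    _ = _ := by ring

set_option maxHeartbeats 2000000 in
theorem perj : ∃ M c : ℝ, 0 < M ∧ 0 < c ∧ ∀ (K m k q i0 : ℕ) (x D w : ℝ), 7 ≤ K → k ≤ K → i0 < k →
    (Zn K m 0 : ℝ) ^ (20 * C1c * K) ≤ D → Real.log D ≤ 40 * C1c * K * Real.log (Zn K m 0) →
    M ≤ D → 1 ≤ x → x ≤ D ^ 100 → 8 * √x ≤ q → (4 * (i0 : ℝ) ^ 2 + 1) * q ≤ x → 1 ≤ w →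
    D ^ 8 * √x * w ≤ q → M * w ≤ Zn K m 0 → 1 / w ≤ VA q k (Zn K m 0) →
    c * q * VA q k (Zn K m 0) * (K : ℝ) ^ (-(8 / 10 : ℝ)) ≤ ((Aj q k (Zn K m 0) i0).card : ℝ) := by
  obtain ⟨c1, hc1, hchi⟩ := chi_prod
  obtain ⟨B, hB0, hB⟩ := kapC0_sum
  refine ⟨64000 / c1 + 2, 98 / 100 / 32 * c1 * Real.exp (-((105 / 100 * B + 1) * Real.log 2)) / 2 ^ 102,
    by positivity, by positivity, ?_⟩
  intro K m k q i0 x D w hK hk hi hD hlog hMD hx1 hxD hqx hix hw hDq hMz hVw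
  have hcM : 0 < 64000 / c1 := by positivity
  have hD2 : 2 ≤ D := by linarith
  have hKr : (7 : ℝ) ≤ K := by exact_mod_cast hK
  set z := Zn K m 0 with hzdef
  have hz8 : 8 * K ≤ z := Zn_ge K m 0 (by omega)
  have hz8r : (8 : ℝ) * K ≤ z := by exact_mod_cast hz8
  have hzD : (z : ℝ) ≤ D := by
    refine le_trans ?_ hD
    apply le_self_pow₀ (by linarith)
    have := C1c_pos
    positivity
  have hVA := VA_pos q k z
  set va := VA q k z with hva
  have hVB : c1 * va ≤ VB q k z := by
    rw [VB, mul_comm]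
    exact mul_le_mul_of_nonneg_left (hchi z (by linarith)) hVA.le
  set vb := VB q k z with hvb
  have hvb0 : 0 < vb := lt_of_lt_of_le (by positivity) hVB
  -- geometry
  have hsx : 1 ≤ √x := by rw [Real.one_le_sqrt]; exact hx1
  have hq1 : (8 : ℝ) ≤ q := by linarith
  have hq1' : 1 ≤ q := by
    have : (1 : ℝ) ≤ q := by linarith
    exact_mod_cast this
  set j0 := 4 * i0 ^ 2 with hj0
  have hj0r : ((j0 : ℕ) : ℝ) = 4 * (i0 : ℝ) ^ 2 := by rw [hj0]; push_cast; ring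
  set s := √(((j0 : ℝ) + 1) * q) with hs
  have hs2 : s ^ 2 = ((j0 : ℝ) + 1) * q := Real.sq_sqrt (by positivity)
  have hs0 : 0 < s := Real.sqrt_pos.mpr (by positivity)
  have hsx' : s ≤ √x := Real.sqrt_le_sqrt (by rw [hj0r]; exact hix)
  obtain ⟨hg1, hg2, hg3⟩ := region_geom q j0 s hq1' hs0 hs2 (by linarith)
  set U := ⌊s / 2⌋₊ with hU
  set L := ⌊(q : ℝ) / (4 * s)⌋₊ with hL
  set V := Vst q j0 with hV
  set y : ℝ := (U : ℝ) * L with hy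
  have hy0 : 0 < y := by linarith
  have hyv : 0 < y * vb := mul_pos hy0 hvb0
  set E : ℝ := (U : ℝ) + L + 1 with hE
  have hE0 : 0 ≤ E := by positivity
  -- error terms
  have hw0 : 0 < w := by linarith
  have hD0 : 0 < D := by linarith
  have herr : D ^ 7 * E ≤ 1 / 1000 * (y * vb) := by
    have a1 : D ^ 7 * E ≤ D ^ 7 * (2 * √x) := by
      apply mul_le_mul_of_nonneg_left _ (by positivity)
      linarith
    have a2 : D ^ 7 * (2 * √x) ≤ 2 / D * (q * (1 / w)) := by
      have : 2 / D * (q * (1 / w)) = 2 * q / (D * w) := by field_simp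
      rw [this, le_div_iff₀ (by positivity)]
      calc D ^ 7 * (2 * √x) * (D * w) = 2 * (D ^ 8 * √x * w) := by ring
        _ ≤ _ := by linarith
    have a3 : (q : ℝ) * (1 / w) ≤ q * va := mul_le_mul_of_nonneg_left hVw (by positivity)
    have a4 : (q : ℝ) * va ≤ 32 / c1 * (y * vb) := by
      have b1 : (q : ℝ) / 32 * (c1 * va) ≤ y * vb := mul_le_mul hg2 hVB (by positivity) hy0.le
      rw [div_mul_eq_mul_div, le_div_iff₀ hc1]
      linarith
    have a5 : 2 / D * (32 / c1) ≤ 1 / 1000 := by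
      rw [div_mul_div_comm, div_le_div_iff₀ (by positivity) (by norm_num)]
      have : 64000 / c1 ≤ D := by linarith
      rw [div_le_iff₀ hc1] at this
      linarith
    have h2D : 0 ≤ 2 / D := by positivity
    calc D ^ 7 * E ≤ 2 / D * (q * (1 / w)) := a1.trans a2
      _ ≤ 2 / D * (32 / c1 * (y * vb)) := mul_le_mul_of_nonneg_left (a3.trans a4) h2D
      _ = (2 / D * (32 / c1)) * (y * vb) := by ring
      _ ≤ _ := mul_le_mul_of_nonneg_right a5 hyv.le
  have herr6 : D ^ 6 * E ≤ D ^ 7 * E :=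
    mul_le_mul_of_nonneg_right (pow_le_pow_right₀ (by linarith) (by norm_num)) hE0
  have herr1 : D * E ≤ D ^ 7 * E :=
    mul_le_mul_of_nonneg_right (le_self_pow₀ (by linarith) (by norm_num)) hE0
  have hz0 : (0 : ℝ) < z := by linarith
  have hsq : 6 * y / z ≤ 1 / 1000 * (y * vb) := by
    have b1 : 64000 / c1 * w ≤ z := le_trans (by nlinarith) hMz
    have b2 : c1 * (1 / w) ≤ vb := le_trans (mul_le_mul_of_nonneg_left hVw hc1.le) hVB
    have b3 : 6 / (z : ℝ) ≤ 1 / 1000 * vb := by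
      rw [div_le_iff₀ hz0]
      have : c1 * (1 / w) * (64000 / c1 * w) ≤ vb * z := mul_le_mul b2 b1 (by positivity) hvb0.le
      have e : c1 * (1 / w) * (64000 / c1 * w) = 64000 := by field_simp
      rw [e] at this
      linarith
    calc 6 * y / z = y * (6 / z) := by ring
      _ ≤ y * (1 / 1000 * vb) := mul_le_mul_of_nonneg_left b3 hy0.le
      _ = _ := by ring
  -- the sieved set
  have hlow := sieve_CB K m k q i0 D hK hk hi hD (by linarith) 1 U V L
  rw [← hzdef] at hlow
  set S := SB q k i0 z 1 U V L with hS
  have hsum := sum_f_le K m k q i0 D hK hk hi hD (by linarith) 1 U V L hvb0.le _ (hB K z D hK (by omega) hzD hlog)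
  rw [← hzdef, ← hS, ← hvb, ← hy, ← hE] at hsum
  have hbad := sq_bad z D (by omega) (by linarith) 1 U V L
  rw [← hy, ← hE] at hbad
  rw [← hvb, ← hy, ← hE] at hlow
  set Bd := (Reg 1 U V L).filter (fun w => ∃ p ∈ Pr z D, p ^ 2 ∣ w.1 ^ 2 + w.2 ^ 2) with hBd
  set G := S \ Bd with hG
  have hGS : G ⊆ S := sdiff_subset
  have hGc : (S.card : ℝ) ≤ G.card + Bd.card := by
    have : S.card ≤ G.card + Bd.card := by
      rw [hG]
      have := le_card_sdiff Bd S
      omega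
    exact_mod_cast this
  have hGlow : 98 / 100 * (y * vb) ≤ G.card := by linarith
  have hlK : 0 ≤ Real.log K := Real.log_nonneg (by linarith)
  set μ := 105 / 100 * (Real.log K + B) + 1 with hμ
  have hGsum : ∑ w ∈ G, (((Pr z D).filter (fun p => p ∣ w.1 ^ 2 + w.2 ^ 2)).card : ℝ) ≤ μ * G.card := by
    have h1 : ∑ w ∈ G, (((Pr z D).filter (fun p => p ∣ w.1 ^ 2 + w.2 ^ 2)).card : ℝ) ≤
        ∑ w ∈ S, (((Pr z D).filter (fun p => p ∣ w.1 ^ 2 + w.2 ^ 2)).card : ℝ) :=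
      sum_le_sum_of_subset_of_nonneg hGS (fun _ _ _ => Nat.cast_nonneg _)
    have h2 : μ * (98 / 100 * (y * vb)) ≤ μ * G.card := mul_le_mul_of_nonneg_left hGlow (by positivity)
    have h3 : 0 ≤ (y * vb) * (Real.log K + B) := by positivity
    have h4 : μ * (98 / 100 * (y * vb)) = 1029 / 1000 * ((y * vb) * (Real.log K + B)) + 98 / 100 * (y * vb) := by
      rw [hμ]; ring
    have h5 : (1 + 1 / 100) * (y * vb) * (Real.log K + B) = 101 / 100 * ((y * vb) * (Real.log K + B)) := by ring
    linarith
  have hSReg : ∀ w ∈ S, w ∈ Reg 1 U V L := fun w hw => (mem_filter.mp hw).1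
  have hSCB : ∀ w ∈ S, ∀ p ∈ Pr 0 z, ¬ CB q k i0 p w.1 w.2 := fun w hw => (mem_filter.mp hw).2
  have hmult := mult_count G z D (by linarith) (j0 * q)
    (fun w hw => (hg1 w (hSReg w (hGS hw))).1)
    (fun w hw => by
      have h1 := (hg1 w (hSReg w (hGS hw))).2
      have h2 : ((w.1 ^ 2 + w.2 ^ 2 : ℕ) : ℝ) ≤ (((j0 + 1) * q : ℕ) : ℝ) := by exact_mod_cast h1
      have h3 : (((j0 + 1) * q : ℕ) : ℝ) ≤ x := by push_cast; rw [hj0r]; exact hix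
      linarith)
    (fun w hw p hp hd => hSCB w (hGS hw) p hp ⟨i0, hi, by
      have : (p : ℤ) ∣ ((w.1 ^ 2 + w.2 ^ 2 : ℕ) : ℤ) := by exact_mod_cast hd
      push_cast at this
      have e : (w.1 : ℤ) ^ 2 + (w.2 : ℤ) ^ 2 + 4 * (i0 : ℤ) ^ 2 * q - 4 * (i0 : ℤ) ^ 2 * q =
        (w.1 : ℤ) ^ 2 + (w.2 : ℤ) ^ 2 := by ring
      rw [e]; exact this⟩)
    (fun w hw p hp hd => (mem_sdiff.mp hw).2 (mem_filter.mpr ⟨hSReg w (hGS hw), p, hp, hd⟩)) μ hGsum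
  have himg : G.image (fun w => w.1 ^ 2 + w.2 ^ 2 - j0 * q) ⊆ Aj q k z i0 := by
    intro a ha
    obtain ⟨w, hw, rfl⟩ := mem_image.mp ha
    obtain ⟨h1, h2⟩ := hg1 w (hSReg w (hGS hw))
    have e : w.1 ^ 2 + w.2 ^ 2 - j0 * q + 4 * i0 ^ 2 * q = w.1 ^ 2 + w.2 ^ 2 := by
      rw [← hj0]; omega
    rw [Aj, Aset, mem_filter, mem_filter, mem_Icc]
    refine ⟨⟨⟨by omega, ?_⟩, ?_⟩, w.1, w.2, e⟩
    · have : (j0 + 1) * q = j0 * q + q := by ring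
      omega
    · intro p hp hA
      exact hSCB w (hGS hw) p hp (CB_CA q k i0 p _ _ _ e hA)
  have hcard : ((G.image (fun w => w.1 ^ 2 + w.2 ^ 2 - j0 * q)).card : ℝ) ≤ (Aj q k z i0).card := by
    exact_mod_cast card_le_card himg
  -- final numerics
  have hexp : Real.exp (-((105 / 100 * B + 1) * Real.log 2)) * (K : ℝ) ^ (-(8 / 10 : ℝ)) ≤ Real.exp (-(μ * Real.log 2)) := by
    rw [Real.rpow_def_of_pos (by linarith), ← Real.exp_add]
    apply Real.exp_le_exp.mpr
    have := Real.log_two_lt_d9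
    have h8 := mul_le_mul_of_nonneg_right (by linarith : 105 / 100 * Real.log 2 ≤ 8 / 10) hlK
    have e1 : μ * Real.log 2 = 105 / 100 * Real.log 2 * Real.log K + (105 / 100 * B + 1) * Real.log 2 := by
      rw [hμ]; ring
    rw [e1]
    linarith
  have hGq : 98 / 100 / 32 * c1 * (q * va) ≤ G.card := by
    have b1 : (q : ℝ) / 32 * (c1 * va) ≤ y * vb := mul_le_mul hg2 hVB (by positivity) hy0.le
    linarith
  have hfin : 98 / 100 / 32 * c1 * (q * va) * (Real.exp (-((105 / 100 * B + 1) * Real.log 2)) * (K : ℝ) ^ (-(8 / 10 : ℝ))) ≤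
      2 ^ 102 * ((Aj q k z i0).card : ℝ) := by
    calc _ ≤ (G.card : ℝ) * Real.exp (-(μ * Real.log 2)) := by
          apply mul_le_mul hGq hexp (by positivity) (by positivity)
      _ ≤ _ := hmult
      _ ≤ _ := mul_le_mul_of_nonneg_left hcard (by positivity)
  have e : 98 / 100 / 32 * c1 * Real.exp (-((105 / 100 * B + 1) * Real.log 2)) / 2 ^ 102 * q * va * (K : ℝ) ^ (-(8 / 10 : ℝ)) =
    98 / 100 / 32 * c1 * (q * va) * (Real.exp (-((105 / 100 * B + 1) * Real.log 2)) * (K : ℝ) ^ (-(8 / 10 : ℝ))) / 2 ^ 102 := by ring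
  rw [e, div_le_iff₀ (by positivity)]
  linarith

end
end STS

namespace STS
open Finset
section
open Classical

lemma VA_ge : ∃ C : ℝ, 0 < C ∧ ∀ q k K z : ℕ, 7 ≤ K → k ≤ K → 8 * K ≤ z →
    Real.exp (-((K : ℝ) * (2 * Real.log (Real.log z) + C))) ≤ VA q k z := by
  obtain ⟨Cm, hCm0, hCm⟩ := mertens2_one
  refine ⟨2 * Cm + 16, by positivity, ?_⟩
  intro q k K z hK hk hz
  have hKr : (7 : ℝ) ≤ K := by exact_mod_cast hK
  have hzr : (8 : ℝ) * K ≤ z := by exact_mod_cast hz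
  have hun : Pr 0 (z : ℝ) = Pr 0 ((8 * K : ℕ) : ℝ) ∪ Pr ((8 * K : ℕ) : ℝ) z :=
    Pr_union 0 _ _ le_rfl (by positivity) (by exact_mod_cast hz)
  have hdis : Disjoint (Pr 0 ((8 * K : ℕ) : ℝ)) (Pr ((8 * K : ℕ) : ℝ) z) :=
    Pr_disj _ _ _ _ le_rfl (by positivity) le_rfl (by positivity)
  rw [VA, hun, prod_union hdis]
  have h1 : Real.exp (-(16 * K)) ≤ ∏ p ∈ Pr 0 ((8 * K : ℕ) : ℝ), (1 - (kap (CA q k) p : ℝ) / p ^ 2) := by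
    have hA : ∏ p ∈ Pr 0 ((8 * K : ℕ) : ℝ), (1 / (p : ℝ)) ≤
        ∏ p ∈ Pr 0 ((8 * K : ℕ) : ℝ), (1 - (kap (CA q k) p : ℝ) / p ^ 2) :=
      prod_le_prod (fun _ _ => by positivity) (fun p hp => one_sub_CA q k p ((mem_Pr0 _ _).mp hp).2)
    refine le_trans ?_ hA
    have hset : Pr 0 ((8 * K : ℕ) : ℝ) = (range (8 * K + 1)).filter Nat.Prime := by
      ext p
      rw [mem_Pr0, mem_filter, mem_range, Nat.lt_succ_iff]
    have hprim : ((∏ p ∈ Pr 0 ((8 * K : ℕ) : ℝ), (p : ℝ))) ≤ 4 ^ (8 * K) := by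
      have := primorial_le_four_pow (8 * K)
      rw [primorial, ← hset] at this
      have h2 : ((∏ p ∈ Pr 0 ((8 * K : ℕ) : ℝ), p : ℕ) : ℝ) ≤ ((4 ^ (8 * K) : ℕ) : ℝ) := by exact_mod_cast this
      push_cast at h2
      exact_mod_cast h2
    have hpos : 0 < ∏ p ∈ Pr 0 ((8 * K : ℕ) : ℝ), (p : ℝ) :=
      prod_pos (fun p hp => by exact_mod_cast ((mem_Pr0 _ _).mp hp).2.pos)
    have e : ∏ p ∈ Pr 0 ((8 * K : ℕ) : ℝ), (1 / (p : ℝ)) = 1 / ∏ p ∈ Pr 0 ((8 * K : ℕ) : ℝ), (p : ℝ) := by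
      simp
    rw [e, Real.exp_neg, inv_eq_one_div]
    apply one_div_le_one_div_of_le hpos
    refine hprim.trans ?_
    rw [← Real.log_le_iff_le_exp (by positivity), Real.log_pow]
    have l2 := Real.log_two_lt_d9
    have l4 : Real.log 4 = 2 * Real.log 2 := by
      rw [show (4 : ℝ) = 2 ^ 2 by norm_num, Real.log_pow]; norm_num
    rw [l4]
    push_cast
    nlinarith
  have h2 : Real.exp (-(2 * K * (Real.log (Real.log z) + Cm))) ≤
      ∏ p ∈ Pr ((8 * K : ℕ) : ℝ) z, (1 - (kap (CA q k) p : ℝ) / p ^ 2) := by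
    have hg : ∀ p ∈ Pr ((8 * K : ℕ) : ℝ) z, (kap (CA q k) p : ℝ) / p ^ 2 ≤ K * (1 / (p : ℝ)) := by
      intro p hp
      have hp2 := ((mem_Pr (by positivity) (by positivity)).mp hp).2
      rw [kap_CA q k p hp2]
      have hp0 : (0 : ℝ) < p := by exact_mod_cast hp2.pos
      have : (kappa q k p : ℝ) ≤ K := by exact_mod_cast (kappa_le q k p).trans hk
      push_cast
      rw [show (kappa q k p : ℝ) * p / p ^ 2 = kappa q k p * (1 / p) by field_simp]
      exact mul_le_mul_of_nonneg_right this (by positivity)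
    have hg2 : ∀ p ∈ Pr ((8 * K : ℕ) : ℝ) z, (kap (CA q k) p : ℝ) / p ^ 2 ≤ 1 / 2 := by
      intro p hp
      refine (hg p hp).trans ?_
      have hp1 := ((mem_Pr (by positivity) (by positivity)).mp hp).1.1
      push_cast at hp1
      rw [mul_one_div, div_le_div_iff₀ (by linarith) (by norm_num)]
      linarith
    refine le_trans ?_ (prod_ge_exp _ _ (fun p _ => by positivity) hg2)
    apply Real.exp_le_exp.mpr
    have hs : ∑ p ∈ Pr ((8 * K : ℕ) : ℝ) z, (kap (CA q k) p : ℝ) / p ^ 2 ≤ K * (Real.log (Real.log z) + Cm) := by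
      refine (sum_le_sum hg).trans ?_
      rw [← mul_sum]
      apply mul_le_mul_of_nonneg_left _ (by positivity)
      refine (hCm _ _ (by push_cast; linarith) (by exact_mod_cast hz)).trans ?_
      have hl8 : 1 ≤ Real.log ((8 * K : ℕ) : ℝ) := by
        rw [Real.le_log_iff_exp_le (by push_cast; linarith)]
        have := Real.exp_one_lt_d9
        push_cast
        linarith
      have hlz : Real.log ((8 * K : ℕ) : ℝ) ≤ Real.log z := Real.log_le_log (by push_cast; linarith) (by exact_mod_cast hz)
      have : Real.log (Real.log z / Real.log ((8 * K : ℕ) : ℝ)) ≤ Real.log (Real.log z) := by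
        apply Real.log_le_log (by apply div_pos <;> linarith)
        exact div_le_self (by linarith) hl8
      linarith
    linarith
  calc _ = Real.exp (-(16 * K)) * Real.exp (-(2 * K * (Real.log (Real.log z) + Cm))) := by
        rw [← Real.exp_add]; congr 1; ring
    _ ≤ _ := mul_le_mul h1 h2 (Real.exp_pos _).le (le_trans (Real.exp_pos _).le h1)

lemma Aset_upper (K m k q : ℕ) (x D w : ℝ) (hK : 7 ≤ K) (hk : k ≤ K)
    (hD : (Zn K m 0 : ℝ) ^ (20 * C1c * K) ≤ D) (hD2 : 2 ≤ D) (hx : 1 ≤ x) (hq : 1 ≤ q) (hw : 1 ≤ w)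
    (hDq : D ^ 8 * √x * w ≤ q) (hVw : 1 / w ≤ VA q k (Zn K m 0)) :
    ((Aset q k (Zn K m 0)).card : ℝ) ≤ 2 * q * VA q k (Zn K m 0) := by
  have hqr : (1 : ℝ) ≤ q := by exact_mod_cast hq
  have hs := (sieve.choose_spec.2 K m D hK hD (CA q k) (CA_per q k)
    (fun p hp _ => by
      rw [kap_CA q k p hp]
      have := kappa_le q k p
      exact Nat.mul_le_mul_right _ (by omega))
    (fun p hp _ => by
      rw [kap_CA q k p hp]
      have := kappa_lt q k p hp
      have h2 := hp.two_le
      nlinarith) ∅ (by simp) (by simp; linarith) 1 q (fun _ => 0) q).1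
  simp only [notMem_empty, IsEmpty.forall_iff, implies_true, true_and, prod_empty, mul_one] at hs
  have hinj : (Aset q k (Zn K m 0)).card * q ≤ ((Reg 1 q (fun _ => 0) q).filter
      (fun w => ∀ p ∈ Pr 0 (Zn K m 0), ¬ CA q k p w.1 w.2)).card := by
    have e : ((Aset q k (Zn K m 0)).sigma (fun _ => range q)).card = (Aset q k (Zn K m 0)).card * q := by simp
    rw [← e]
    apply card_le_card
    intro w hw
    rw [mem_sigma, Aset, mem_filter, mem_Icc, mem_range] at hw
    rw [mem_filter, mem_Reg]
    exact ⟨⟨⟨hw.1.1.1, by omega⟩, by omega, by omega⟩, hw.1.2⟩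
  have hinj' : ((Aset q k (Zn K m 0)).card : ℝ) * q ≤ (((Reg 1 q (fun _ => 0) q).filter
      (fun w => ∀ p ∈ Pr 0 (Zn K m 0), ¬ CA q k p w.1 w.2)).card : ℝ) := by exact_mod_cast hinj
  have hs2 := hinj'.trans hs
  rw [← VA] at hs2
  set va := VA q k (Zn K m 0)
  have hsx : 1 ≤ √x := by rw [Real.one_le_sqrt]; exact hx
  have h6 : 4 * D ^ 6 * w ≤ q := by
    refine le_trans ?_ hDq
    have : 4 * D ^ 6 ≤ D ^ 8 * √x := by
      have a : 4 * D ^ 6 ≤ D ^ 8 := by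
        have : (4 : ℝ) ≤ D ^ 2 := by nlinarith
        calc 4 * D ^ 6 ≤ D ^ 2 * D ^ 6 := mul_le_mul_of_nonneg_right this (by positivity)
          _ = _ := by ring
      nlinarith [pow_pos (by linarith : (0 : ℝ) < D) 8]
    exact mul_le_mul_of_nonneg_right this (by linarith)
  have h7 : 4 * D ^ 6 ≤ q * va := by
    have : (q : ℝ) * (1 / w) ≤ q * va := mul_le_mul_of_nonneg_left hVw (by linarith)
    refine le_trans ?_ this
    rw [mul_one_div, le_div_iff₀ (by linarith)]
    exact h6
  have hD6 : 0 < D ^ 6 := by positivity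
  have h8 : D ^ 6 * ((q : ℝ) + q + 1) ≤ 3 / 4 * (q * va) * q := by nlinarith
  have h0 : 0 ≤ (q : ℝ) * va * q := by
    have := VA_pos q k (Zn K m 0)
    positivity
  have h9 : ((Aset q k (Zn K m 0)).card : ℝ) * q ≤ 2 * q * va * q := by nlinarith
  exact le_of_mul_le_mul_right h9 (by linarith)

/-- averaging -/
lemma averaging (S : Finset ℕ) (k : ℕ) (hk : 0 < k) (A : ℕ → Finset ℕ) (hA : ∀ i < k, A i ⊆ S)
    (α β : ℝ) (hα : 0 < α) (hβ : 0 ≤ β) (hS : (S.card : ℝ) ≤ α) (hAc : ∀ i < k, β ≤ ((A i).card : ℝ)) :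
    β / 2 ≤ ((S.filter (fun a => β / (2 * α) * k ≤ (((range k).filter (fun i => a ∈ A i)).card : ℝ))).card : ℝ) := by
  set τ := β / (2 * α) * k with hτ
  set G := S.filter (fun a => τ ≤ (((range k).filter (fun i => a ∈ A i)).card : ℝ)) with hG
  have hk0 : (0 : ℝ) < k := by exact_mod_cast hk
  have hτ0 : 0 ≤ τ := by positivity
  have e : ∑ a ∈ S, (((range k).filter (fun i => a ∈ A i)).card : ℝ) = ∑ i ∈ range k, ((A i).card : ℝ) := by
    have : ∑ a ∈ S, ((range k).filter (fun i => a ∈ A i)).card = ∑ i ∈ range k, (A i).card := by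
      simp_rw [card_filter]
      rw [sum_comm]
      apply sum_congr rfl
      intro i hi
      rw [← card_filter]
      congr 1
      ext a
      rw [mem_filter]
      exact ⟨fun h => h.2, fun h => ⟨hA i (mem_range.mp hi) h, h⟩⟩
    exact_mod_cast this
  have h1 : (k : ℝ) * β ≤ ∑ i ∈ range k, ((A i).card : ℝ) := by
    have := card_nsmul_le_sum (range k) (fun i => ((A i).card : ℝ)) β (fun i hi => hAc i (mem_range.mp hi))
    simpa using this
  have h2 : ∑ a ∈ S, (((range k).filter (fun i => a ∈ A i)).card : ℝ) ≤ ∑ a ∈ S, (τ + if a ∈ G then (k : ℝ) else 0) := by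
    apply sum_le_sum
    intro a ha
    have hc : ((range k).filter (fun i => a ∈ A i)).card ≤ k := (card_filter_le _ _).trans (by simp)
    have hc' : (((range k).filter (fun i => a ∈ A i)).card : ℝ) ≤ k := by exact_mod_cast hc
    split_ifs with h
    · linarith
    · rw [hG, mem_filter, not_and] at h
      have := h ha
      push Not at this
      linarith
  have h3 : ∑ a ∈ S, (τ + if a ∈ G then (k : ℝ) else 0) = S.card * τ + G.card * k := by
    have hGG : S.filter (fun a => a ∈ G) = G := by
      ext a
      rw [mem_filter, hG, mem_filter]
      tauto
    rw [sum_add_distrib, sum_const, nsmul_eq_mul, ← sum_filter, hGG, sum_const, nsmul_eq_mul]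
  have h4 : (S.card : ℝ) * τ ≤ α * τ := mul_le_mul_of_nonneg_right hS hτ0
  have h5 : α * τ = β / 2 * k := by rw [hτ]; field_simp
  have h6 : β / 2 * k ≤ G.card * k := by linarith
  exact le_of_mul_le_mul_right h6 hk0

theorem main_count : ∃ M c : ℝ, 0 < M ∧ 0 < c ∧ ∀ (K m k q : ℕ) (x D w : ℝ), 7 ≤ K → k ≤ K → 0 < k →
    (Zn K m 0 : ℝ) ^ (20 * C1c * K) ≤ D → Real.log D ≤ 40 * C1c * K * Real.log (Zn K m 0) →
    M ≤ D → 1 ≤ x → x ≤ D ^ 100 → 8 * √x ≤ q → (4 * ((k : ℝ) - 1) ^ 2 + 1) * q ≤ x → 1 ≤ w →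
    D ^ 8 * √x * w ≤ q → M * w ≤ Zn K m 0 → 1 / w ≤ VA q k (Zn K m 0) →
    c * q / w * (K : ℝ) ^ (-(8 / 10 : ℝ)) ≤ (((Icc 1 q).filter (fun a =>
      c * (K : ℝ) ^ (-(8 / 10 : ℝ)) * k ≤
        (((range k).filter (fun i => ∃ u v : ℕ, a + 4 * i ^ 2 * q = u ^ 2 + v ^ 2)).card : ℝ))).card : ℝ) := by
  obtain ⟨M, c, hM, hc, h⟩ := perj
  refine ⟨M + 2, c / 4, by positivity, by positivity, ?_⟩
  intro K m k q x D w hK hk hk0 hD hlog hMD hx hxD hqx hix hw hDq hMz hVw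
  set z := Zn K m 0 with hz
  have hsx : 1 ≤ √x := by rw [Real.one_le_sqrt]; exact hx
  have hq1 : (1 : ℝ) ≤ q := by linarith
  have hq1' : 1 ≤ q := by exact_mod_cast hq1
  have hVA := VA_pos q k z
  have hKp : 0 < (K : ℝ) ^ (-(8 / 10 : ℝ)) := by
    apply Real.rpow_pos_of_pos
    have : 0 < K := by omega
    exact_mod_cast this
  have hup := Aset_upper K m k q x D w hK hk hD (by linarith) hx hq1' hw hDq hVw
  have hav := averaging (Aset q k z) k hk0 (Aj q k z) (fun i _ => filter_subset _ _) (2 * q * VA q k z)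
    (c * q * VA q k z * (K : ℝ) ^ (-(8 / 10 : ℝ))) (by positivity) (by positivity) hup (by
      intro i hi
      refine h K m k q i x D w hK hk hi hD hlog (by linarith) hx hxD hqx ?_ hw hDq (le_trans ?_ hMz) hVw
      · refine le_trans ?_ hix
        apply mul_le_mul_of_nonneg_right _ (by linarith)
        have h1 : (i : ℝ) ≤ k - 1 := by
          have : i + 1 ≤ k := hi
          have : (i : ℝ) + 1 ≤ k := by exact_mod_cast this
          linarith
        have h2 : (i : ℝ) ^ 2 ≤ ((k : ℝ) - 1) ^ 2 := pow_le_pow_left₀ (by positivity) h1 2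
        linarith
      · nlinarith)
  have e : c * q * VA q k z * (K : ℝ) ^ (-(8 / 10 : ℝ)) / (2 * (2 * q * VA q k z)) = c / 4 * (K : ℝ) ^ (-(8 / 10 : ℝ)) := by
    field_simp
    norm_num
  rw [e] at hav
  have h1 : c / 4 * q / w * (K : ℝ) ^ (-(8 / 10 : ℝ)) ≤ c * q * VA q k z * (K : ℝ) ^ (-(8 / 10 : ℝ)) / 2 := by
    have : c * q * (1 / w) ≤ c * q * VA q k z := mul_le_mul_of_nonneg_left hVw (by positivity)
    have h2 := mul_le_mul_of_nonneg_right this hKp.le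
    have h3 : c / 4 * q / w * (K : ℝ) ^ (-(8 / 10 : ℝ)) = c * q * (1 / w) * (K : ℝ) ^ (-(8 / 10 : ℝ)) / 4 := by ring
    have h4 : 0 < c * q * VA q k z * (K : ℝ) ^ (-(8 / 10 : ℝ)) := by positivity
    rw [h3]
    linarith
  refine h1.trans (hav.trans ?_)
  have : ∀ s t : Finset ℕ, s ⊆ t → (s.card : ℝ) ≤ t.card := fun s t h => by exact_mod_cast card_le_card h
  apply this
  intro a ha
  rw [mem_filter, Aset, mem_filter] at ha
  rw [mem_filter]
  refine ⟨ha.1.1, ha.2.trans ?_⟩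
  apply this
  intro i hi
  rw [mem_filter] at hi ⊢
  exact ⟨hi.1, (mem_filter.mp hi.2).2⟩

end
end STS

namespace STS
open Finset

lemma phiS_bound (l : ℝ) (q : ℕ) (hq : 1 ≤ q) (hl : 1 < Real.log l) (hY : 2 < l / Real.log l) (hql : Real.log q ≤ l)
    (hp : ∀ p : ℕ, p.Prime → p ∣ q → l / Real.log l ≤ (p : ℝ)) :
    0 < phiS q ∧ (q : ℝ) ≤ Real.exp 2 * phiS q := by
  have hl0 : 0 < l := by
    by_contra h
    have : l / Real.log l ≤ 0 := div_nonpos_of_nonpos_of_nonneg (by linarith) (by linarith)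
    linarith
  set Y := l / Real.log l with hYd
  have hpr : ∀ p ∈ q.primeFactors, p.Prime ∧ Y ≤ (p : ℝ) ∧ p ≠ 2 := by
    intro p hpq
    rw [Nat.mem_primeFactors] at hpq
    have h1 := hp p hpq.1 hpq.2.1
    refine ⟨hpq.1, h1, ?_⟩
    rintro rfl
    norm_num at h1
    linarith
  have hpos : 0 < phiS q := by
    rw [phiS]
    apply prod_pos
    intro p hpq
    have h0 : (0 : ℝ) < p := by exact_mod_cast (hpr p hpq).1.pos
    split_ifs <;> positivity
  refine ⟨hpos, ?_⟩
  have hqprod : (q : ℝ) = ∏ p ∈ q.primeFactors, (p : ℝ) ^ (q.factorization p) := by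
    have := Nat.prod_factorization_pow_eq_self (n := q) (by omega)
    conv_lhs => rw [← this]
    rw [Finsupp.prod]
    push_cast
    rfl
  have hcard : ((q.primeFactors.card : ℕ) : ℝ) * Real.log Y ≤ Real.log q := by
    have h1 : Y ^ q.primeFactors.card ≤ (q : ℝ) := by
      have h2 : ∏ _p ∈ q.primeFactors, Y ≤ ∏ p ∈ q.primeFactors, (p : ℝ) :=
        prod_le_prod (fun _ _ => by linarith) (fun p hpq => (hpr p hpq).2.1)
      rw [prod_const] at h2
      refine h2.trans ?_
      have := Nat.le_of_dvd (by omega) (Nat.prod_primeFactors_dvd q)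
      have h3 : ((∏ p ∈ q.primeFactors, p : ℕ) : ℝ) ≤ q := by exact_mod_cast this
      rwa [Nat.cast_prod] at h3
    have := Real.log_le_log (by positivity) h1
    rwa [Real.log_pow] at this
  have hlogY : Real.log l / 2 ≤ Real.log Y := by
    rw [hYd, Real.log_div hl0.ne' (by linarith)]
    have h1 : Real.log (Real.log l / 2) ≤ Real.log l / 2 - 1 := Real.log_le_sub_one_of_pos (by linarith)
    rw [Real.log_div (by linarith) (by norm_num)] at h1
    have := Real.log_two_lt_d9
    linarith
  have hom : ((q.primeFactors.card : ℕ) : ℝ) * (1 / Y) ≤ 2 := by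
    have h1 : ((q.primeFactors.card : ℕ) : ℝ) * (Real.log l / 2) ≤ l :=
      (mul_le_mul_of_nonneg_left hlogY (by positivity)).trans (hcard.trans hql)
    rw [hYd, one_div_div, mul_div_assoc', div_le_iff₀ hl0]
    linarith
  have hexp : ∏ p ∈ q.primeFactors, (1 + 1 / (p : ℝ)) ≤ Real.exp 2 := by
    have h1 : ∏ p ∈ q.primeFactors, (1 + 1 / (p : ℝ)) ≤ ∏ _p ∈ q.primeFactors, Real.exp (1 / Y) := by
      apply prod_le_prod (fun _ _ => by positivity)
      intro p hpq
      have h2 : 1 / (p : ℝ) ≤ 1 / Y := one_div_le_one_div_of_le (by linarith) (hpr p hpq).2.1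
      have h3 := Real.add_one_le_exp (1 / Y)
      linarith
    refine h1.trans ?_
    rw [prod_const, ← Real.exp_nat_mul]
    exact Real.exp_le_exp.mpr hom
  calc (q : ℝ) = ∏ p ∈ q.primeFactors, (p : ℝ) ^ (q.factorization p) := hqprod
    _ ≤ ∏ p ∈ q.primeFactors, ((1 + 1 / (p : ℝ)) * (if p = 2 then (if 2 ≤ q.factorization 2 then (2 : ℝ) ^ (q.factorization 2 - 1) else 2)
     else if p % 4 = 1 then (p : ℝ) ^ (q.factorization p)
     else (p : ℝ) ^ (q.factorization p + 1) / ((p : ℝ) + 1))) := by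
        apply prod_le_prod (fun _ _ => by positivity)
        intro p hpq
        have h0 : (0 : ℝ) < p := by exact_mod_cast (hpr p hpq).1.pos
        rw [if_neg (hpr p hpq).2.2]
        split_ifs
        · have : 0 < (p : ℝ) ^ (q.factorization p) := by positivity
          have h5 : 0 < 1 / (p : ℝ) := by positivity
          nlinarith
        · apply le_of_eq
          rw [pow_succ]
          field_simp
    _ = (∏ p ∈ q.primeFactors, (1 + 1 / (p : ℝ))) * phiS q := by rw [prod_mul_distrib, phiS]
    _ ≤ _ := mul_le_mul_of_nonneg_right hexp hpos.le

lemma SAP_ge (x : ℝ) (q a k : ℕ) (hq : 1 ≤ q) (ha : 1 ≤ a) (haq : a ≤ q) (hk : 0 < k)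
    (hx : (4 * ((k : ℝ) - 1) ^ 2 + 1) * q ≤ x) (T : Finset ℕ)
    (hT : ∀ i ∈ T, i < k ∧ ∃ u v : ℕ, a + 4 * i ^ 2 * q = u ^ 2 + v ^ 2) :
    T.card ≤ SAP x q a := by
  rw [SAP]
  have hfin : {n : ℕ | (n : ℝ) ≤ x ∧ IsSumTwoSquares n ∧ n % q = a % q}.Finite := by
    apply (Set.finite_Iic ⌊x⌋₊).subset
    intro n hn
    exact Nat.le_floor hn.1
  have hinj : Set.InjOn (fun i : ℕ => a + 4 * i ^ 2 * q) T := by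
    intro i _ j _ h
    simp only at h
    have h1 : 4 * i ^ 2 * q = 4 * j ^ 2 * q := by omega
    have h2 : 4 * i ^ 2 = 4 * j ^ 2 := Nat.eq_of_mul_eq_mul_right (by omega) h1
    have h3 : i ^ 2 = j ^ 2 := by omega
    exact Nat.pow_left_injective (by norm_num) h3
  rw [← card_image_of_injOn hinj, ← Set.ncard_coe_finset]
  apply Set.ncard_le_ncard _ hfin
  intro n hn
  rw [mem_coe, mem_image] at hn
  obtain ⟨i, hi, rfl⟩ := hn
  obtain ⟨hik, u, v, huv⟩ := hT i hi
  refine ⟨?_, ⟨by omega, u, v, huv⟩, by simp⟩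
  refine le_trans ?_ hx
  have h1 : (i : ℝ) ≤ k - 1 := by
    have : i + 1 ≤ k := hik
    have : (i : ℝ) + 1 ≤ k := by exact_mod_cast this
    linarith
  have h2 : (i : ℝ) ^ 2 ≤ ((k : ℝ) - 1) ^ 2 := pow_le_pow_left₀ (by positivity) h1 2
  have haq' : (a : ℝ) ≤ q := by exact_mod_cast haq
  have hq0 : (0 : ℝ) ≤ q := by positivity
  push_cast
  nlinarith

end STS

namespace STS
open Finset

lemma params (C M : ℝ) (hM : 0 < M) : ∃ A : ℝ, ∀ (l y : ℝ) (K : ℕ), A ≤ y → l = y ^ 60 → Real.log l ≤ y →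
    7 ≤ K → (K : ℝ) ≤ y ^ 18 → ∃ m : ℕ,
      (Zn K m 0 : ℝ) ^ (20 * C1c * K) ≤ Real.exp (l / 100) ∧
      l / 100 ≤ 40 * C1c * K * Real.log (Zn K m 0) ∧
      M * Real.exp (y ^ 20) ≤ Zn K m 0 ∧
      (K : ℝ) * (2 * Real.log (Real.log (Zn K m 0)) + C) ≤ y ^ 20 := by
  have hC1 : (1 : ℝ) ≤ C1c := by exact_mod_cast C1c_pos
  refine ⟨16000 * C1c + |C| + |Real.log M| + 3, ?_⟩
  intro l y K hA hl hly hK hKy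
  have hCa := abs_nonneg C
  have hCb := le_abs_self C
  have hMa := abs_nonneg (Real.log M)
  have hMb := le_abs_self (Real.log M)
  have hy1 : 1 ≤ y := by linarith
  have hKr : (7 : ℝ) ≤ K := by exact_mod_cast hK
  have hl0 : 0 < l := by rw [hl]; positivity
  set lg := Real.log (8 * K) with hlg
  have hlg1 : 1 ≤ lg := by
    rw [hlg, Real.le_log_iff_exp_le (by linarith)]
    have := Real.exp_one_lt_d9
    linarith
  have hlgK : lg ≤ 8 * K := by
    have := Real.log_le_sub_one_of_pos (x := 8 * K) (by linarith)
    linarith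
  have hden : 0 < 2000 * C1c * K * lg := by positivity
  have ht : 1 ≤ l / (2000 * C1c * K * lg) := by
    rw [le_div_iff₀ hden, one_mul]
    calc 2000 * C1c * K * lg ≤ 2000 * C1c * K * (8 * K) := mul_le_mul_of_nonneg_left hlgK (by positivity)
      _ = 16000 * C1c * (K * K) := by ring
      _ ≤ y * (y ^ 18 * y ^ 18) := by
        apply mul_le_mul (by linarith) (mul_le_mul hKy hKy (by positivity) (by positivity)) (by positivity) (by linarith)
      _ = y ^ 37 := by ring
      _ ≤ l := by rw [hl]; exact pow_le_pow_right₀ hy1 (by norm_num)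
  obtain ⟨m, hm1, hm2⟩ := exists_nat_pow_near ht (by norm_num : (1 : ℝ) < 2)
  refine ⟨m, ?_⟩
  have hlogz : Real.log (Zn K m 0) = 2 ^ m * lg := by
    rw [Zn]
    push_cast
    rw [Real.log_pow]
    push_cast
    rfl
  have hz0 : (0 : ℝ) < Zn K m 0 := by
    have := Zn_ge K m 0 (by omega)
    have h2 : 0 < Zn K m 0 := by omega
    exact_mod_cast h2
  rw [le_div_iff₀ hden] at hm1
  rw [div_lt_iff₀ hden, pow_succ] at hm2
  set lz := Real.log (Zn K m 0) with hlz
  have h20 : 20 * C1c * K * lz ≤ l / 100 := by rw [hlogz]; linarith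
  have h40 : l / 100 ≤ 40 * C1c * K * lz := by rw [hlogz]; linarith
  have hlz1 : 1 ≤ lz := by
    rw [hlogz]
    have : (1 : ℝ) ≤ 2 ^ m := one_le_pow₀ (by norm_num)
    nlinarith
  refine ⟨?_, h40, ?_, ?_⟩
  · rw [← Real.log_le_iff_le_exp (by positivity), Real.log_pow]
    push_cast
    exact h20
  · have h3 : 4000 * C1c * y ^ 18 * lz ≥ l := by
      have : 4000 * C1c * K * lz ≤ 4000 * C1c * y ^ 18 * lz := by gcongr
      linarith
    have h4 : y ^ 41 ≤ lz := by
      by_contra hcon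
      push Not at hcon
      have h5 : 4000 * C1c * y ^ 18 * lz < 4000 * C1c * y ^ 18 * y ^ 41 := by gcongr
      have h6 : 4000 * C1c * y ^ 18 * y ^ 41 ≤ y * y ^ 18 * y ^ 41 := by gcongr; linarith
      have h7 : y * y ^ 18 * y ^ 41 = l := by rw [hl]; ring
      linarith
    have h8 : Real.log M + y ^ 20 ≤ lz := by
      have a1 : Real.log M ≤ y := by linarith
      have a2 : y ≤ y ^ 20 := le_self_pow₀ hy1 (by norm_num)
      have a3 : 2 * y ^ 20 ≤ y * y ^ 20 := by gcongr; linarith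
      have a4 : y * y ^ 20 = y ^ 21 := by ring
      have a5 : y ^ 21 ≤ y ^ 41 := pow_le_pow_right₀ hy1 (by norm_num)
      linarith
    calc M * Real.exp (y ^ 20) = Real.exp (Real.log M + y ^ 20) := by rw [Real.exp_add, Real.exp_log hM]
      _ ≤ Real.exp lz := Real.exp_le_exp.mpr h8
      _ = _ := Real.exp_log hz0
  · have h1 : lz ≤ l := by
      have : 1 * lz ≤ 20 * C1c * K * lz := by
        apply mul_le_mul_of_nonneg_right _ (by linarith)
        nlinarith
      linarith
    have h2 : Real.log lz ≤ y := (Real.log_le_log (by linarith) h1).trans hly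
    calc (K : ℝ) * (2 * Real.log lz + C) ≤ K * (3 * y) := by
          apply mul_le_mul_of_nonneg_left _ (by positivity)
          linarith
      _ ≤ y ^ 18 * (y * y) := by
          apply mul_le_mul hKy _ (by positivity) (by positivity)
          apply mul_le_mul_of_nonneg_right _ (by linarith)
          linarith
      _ = y ^ 20 := by ring

end STS

namespace STS
open Finset

lemma large_y (A : ℝ) : ∃ x0 : ℝ, ∀ x : ℝ, x0 ≤ x → 1 ≤ x ∧ 1 ≤ Real.log x ∧ A ≤ Real.log x ^ (1 / 60 : ℝ) ∧
    Real.log (Real.log x) ≤ Real.log x ^ (1 / 60 : ℝ) := by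
  have h1 : ∀ᶠ l : ℝ in Filter.atTop, A ≤ l ^ (1 / 60 : ℝ) :=
    (tendsto_rpow_atTop (by norm_num : (0 : ℝ) < 1 / 60)).eventually_ge_atTop A
  have h2 : ∀ᶠ l : ℝ in Filter.atTop, Real.log l ≤ l ^ (1 / 60 : ℝ) := by
    have := (isLittleO_log_rpow_atTop (by norm_num : (0 : ℝ) < 1 / 60)).bound (by norm_num : (0 : ℝ) < 1)
    filter_upwards [this, Filter.eventually_ge_atTop 1] with l hl hl1
    rw [one_mul, Real.norm_of_nonneg (Real.log_nonneg hl1), Real.norm_of_nonneg (by positivity)] at hl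
    exact hl
  have h3 := Real.tendsto_log_atTop.eventually (h1.and (h2.and (Filter.eventually_ge_atTop 1)))
  obtain ⟨x0, hx0⟩ := Filter.eventually_atTop.mp (h3.and (Filter.eventually_ge_atTop (1 : ℝ)))
  exact ⟨x0, fun x hx => ⟨(hx0 x hx).2, (hx0 x hx).1.2.2, (hx0 x hx).1.1, (hx0 x hx).1.2.1⟩⟩

lemma rpow_k (k K : ℕ) (X : ℝ) (hk : 0 < k) (hX : 0 < X) (hK : K ≤ 7 * k) (hK0 : 0 < K) (hkX : √X / 4 ≤ k) :
    X ^ (1 / 10 : ℝ) / 28 ≤ (K : ℝ) ^ (-(8 / 10 : ℝ)) * k := by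
  have hk0 : (0 : ℝ) < k := by exact_mod_cast hk
  have hKr : (0 : ℝ) < K := by exact_mod_cast hK0
  have hK7 : (K : ℝ) ≤ 7 * k := by exact_mod_cast hK
  have h1 : (7 * (k : ℝ)) ^ (-(8 / 10 : ℝ)) ≤ (K : ℝ) ^ (-(8 / 10 : ℝ)) :=
    Real.rpow_le_rpow_of_nonpos hKr hK7 (by norm_num)
  have h2 : (1 / 7 : ℝ) ≤ 7 ^ (-(8 / 10 : ℝ)) := by
    have : (7 : ℝ) ^ (-1 : ℝ) ≤ 7 ^ (-(8 / 10 : ℝ)) := Real.rpow_le_rpow_of_exponent_le (by norm_num) (by norm_num)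
    rw [Real.rpow_neg_one] at this
    linarith
  have h3 : (k : ℝ) ^ (-(8 / 10 : ℝ)) * k = (k : ℝ) ^ (2 / 10 : ℝ) := by
    nth_rewrite 2 [← Real.rpow_one (k : ℝ)]
    rw [← Real.rpow_add hk0]
    norm_num
  have h4 : (√X / 4) ^ (2 / 10 : ℝ) ≤ (k : ℝ) ^ (2 / 10 : ℝ) := Real.rpow_le_rpow (by positivity) hkX (by norm_num)
  have h5 : (√X / 4) ^ (2 / 10 : ℝ) = X ^ (1 / 10 : ℝ) / 4 ^ (2 / 10 : ℝ) := by
    rw [Real.div_rpow (by positivity) (by norm_num), Real.sqrt_eq_rpow, ← Real.rpow_mul hX.le]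
    norm_num
  have h6 : (4 : ℝ) ^ (2 / 10 : ℝ) ≤ 4 := by
    have : (4 : ℝ) ^ (2 / 10 : ℝ) ≤ 4 ^ (1 : ℝ) := Real.rpow_le_rpow_of_exponent_le (by norm_num) (by norm_num)
    rwa [Real.rpow_one] at this
  have hXp : 0 < X ^ (1 / 10 : ℝ) := by positivity
  have h7 : X ^ (1 / 10 : ℝ) / 4 ≤ (k : ℝ) ^ (2 / 10 : ℝ) := by
    refine le_trans ?_ h4
    rw [h5]
    exact div_le_div_of_nonneg_left hXp.le (by positivity) h6
  calc X ^ (1 / 10 : ℝ) / 28 = 1 / 7 * (X ^ (1 / 10 : ℝ) / 4) := by ring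
    _ ≤ 7 ^ (-(8 / 10 : ℝ)) * (k : ℝ) ^ (2 / 10 : ℝ) := mul_le_mul h2 h7 (by positivity) (by positivity)
    _ = (7 * (k : ℝ)) ^ (-(8 / 10 : ℝ)) * k := by
      rw [Real.mul_rpow (by norm_num) hk0.le, mul_assoc, h3]
    _ ≤ _ := mul_le_mul_of_nonneg_right h1 hk0.le

section
open Classical
set_option maxHeartbeats 1000000 in
theorem main_aux : ∃ c : ℝ, 0 < c ∧ ∃ x0 : ℝ, ∀ x : ℝ, x0 ≤ x →
      ∀ q : ℕ, x * Real.log x ^ (-(5 : ℝ) / 9) ≤ (q : ℝ) → (q : ℝ) ≤ x / 2 →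
        (∀ p : ℕ, p.Prime → p ∣ q → Real.log x / Real.log (Real.log x) ≤ (p : ℝ)) →
          (q : ℝ) ^ (1 - 1 / Real.log (Real.log q)) ≤
            (({a : ℕ | 1 ≤ a ∧ a ≤ q ∧
              c * frakS * x / (phiS q * (x / (q : ℝ)) ^ ((9 : ℝ) / 10)) ≤ (SAP x q a : ℝ)}).ncard : ℝ) := by
  obtain ⟨M, c, hM, hc, hmain⟩ := main_count
  obtain ⟨C, hC, hVA⟩ := VA_ge
  obtain ⟨A, hpar⟩ := params C M hM
  obtain ⟨x0, hx0⟩ := large_y (|A| + |Real.log M| + |Real.log c| + 100)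
  refine ⟨c / (28 * Real.exp 2 * (|frakS| + 1)), by positivity, x0, ?_⟩
  intro x hx q hq1 hq2 hpq
  obtain ⟨hx1, hl1, hAy, hly⟩ := hx0 x hx
  set l := Real.log x with hl
  set y := l ^ (1 / 60 : ℝ) with hy
  have hxl : x = Real.exp l := (Real.exp_log (by linarith)).symm
  have hly60 : l = y ^ 60 := by
    rw [hy, ← Real.rpow_natCast, ← Real.rpow_mul (by linarith)]
    norm_num
  have hA1 := abs_nonneg A
  have hA2 := le_abs_self A
  have hM1 := abs_nonneg (Real.log M)
  have hM2 := le_abs_self (Real.log M)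
  have hc1 := abs_nonneg (Real.log c)
  have hc2 := neg_abs_le (Real.log c)
  have hy100 : 100 ≤ y := by linarith
  have hy1 : 1 ≤ y := by linarith
  have hy0 : 0 < y := by linarith
  have hyp : ∀ n : ℕ, 1 ≤ y ^ n := fun n => one_le_pow₀ hy1
  have hy20 : 100 * y ^ 20 ≤ l := by
    rw [hly60]
    calc 100 * y ^ 20 ≤ y * y ^ 20 := by gcongr
      _ = y ^ 21 := by ring
      _ ≤ _ := pow_le_pow_right₀ hy1 (by norm_num)
  have hyy : y ≤ y ^ 20 := le_self_pow₀ hy1 (by norm_num)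
  -- size of q
  have hlpos : 0 < l := by linarith
  have hqexp : Real.exp (l - y) ≤ q := by
    refine le_trans ?_ hq1
    rw [Real.exp_sub, ← hxl, div_eq_mul_inv, ← Real.exp_neg]
    apply mul_le_mul_of_nonneg_left _ (by linarith)
    rw [Real.rpow_def_of_pos hlpos]
    apply Real.exp_le_exp.mpr
    have : 0 ≤ Real.log l := Real.log_nonneg hl1
    linarith
  have hq0 : (0 : ℝ) < q := lt_of_lt_of_le (Real.exp_pos _) hqexp
  have hqn : 1 ≤ q := by
    have : 0 < q := by exact_mod_cast hq0
    omega
  set X := x / q with hX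
  have hX2 : 2 ≤ X := by rw [hX, le_div_iff₀ hq0]; linarith
  have hXq : X * q = x := by rw [hX]; field_simp
  have hXy : X ≤ y ^ 34 := by
    have h1 : X ≤ l ^ (5 / 9 : ℝ) := by
      rw [hX, div_le_iff₀ hq0]
      have h2 : l ^ (5 / 9 : ℝ) * (x * l ^ (-(5 : ℝ) / 9)) ≤ l ^ (5 / 9 : ℝ) * q :=
        mul_le_mul_of_nonneg_left hq1 (by positivity)
      have h3 : l ^ (5 / 9 : ℝ) * l ^ (-(5 : ℝ) / 9) = 1 := by
        rw [← Real.rpow_add hlpos]; norm_num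
      calc x = x * (l ^ (5 / 9 : ℝ) * l ^ (-(5 : ℝ) / 9)) := by rw [h3, mul_one]
        _ = l ^ (5 / 9 : ℝ) * (x * l ^ (-(5 : ℝ) / 9)) := by ring
        _ ≤ _ := h2
    refine h1.trans ?_
    have h4 : y ^ 34 = l ^ (34 / 60 : ℝ) := by
      rw [hy, ← Real.rpow_natCast, ← Real.rpow_mul (by linarith)]
      norm_num
    rw [h4]
    exact Real.rpow_le_rpow_of_exponent_le hl1 (by norm_num)
  have hsX : √X ≤ y ^ 17 := by
    rw [Real.sqrt_le_left (by positivity)]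
    calc X ≤ y ^ 34 := hXy
      _ = (y ^ 17) ^ 2 := by ring
  set k := ⌊√X / 4⌋₊ + 1 with hk
  have hk1 : (k : ℝ) - 1 ≤ √X / 4 := by
    rw [hk]; push_cast
    have := Nat.floor_le (by positivity : 0 ≤ √X / 4)
    linarith
  have hk2 : √X / 4 ≤ k := by
    rw [hk]; push_cast
    exact (Nat.lt_floor_add_one _).le
  have hk0 : 0 < k := by omega
  have hk1' : (0 : ℝ) ≤ (k : ℝ) - 1 := by
    rw [hk]; push_cast; simp
  have hix : (4 * ((k : ℝ) - 1) ^ 2 + 1) * q ≤ x := by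
    rw [← hXq]
    apply mul_le_mul_of_nonneg_right _ hq0.le
    have h1 : ((k : ℝ) - 1) ^ 2 ≤ (√X / 4) ^ 2 := pow_le_pow_left₀ hk1' hk1 2
    have h2 : (√X / 4) ^ 2 = X / 16 := by
      rw [div_pow, Real.sq_sqrt (by linarith)]; norm_num
    linarith
  set K := max 7 k with hK
  have hK7 : 7 ≤ K := le_max_left _ _
  have hkK : k ≤ K := le_max_right _ _
  have hK7k : K ≤ 7 * k := by omega
  have hKy : (K : ℝ) ≤ y ^ 18 := by
    have h17 : y ^ 17 + 7 ≤ y ^ 18 := by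
      have : 100 * y ^ 17 ≤ y * y ^ 17 := by gcongr
      have e : y * y ^ 17 = y ^ 18 := by ring
      have := hyp 17
      linarith
    have : (K : ℝ) = max 7 (k : ℝ) := by rw [hK]; push_cast; rfl
    rw [this]
    have := hyp 17
    apply max_le <;> linarith
  obtain ⟨m, hz1, hz2, hz3, hz4⟩ := hpar l y K (by linarith) hly60 hly hK7 hKy
  have hsqx : √x = Real.exp (l / 2) := by rw [hxl]; exact (Real.exp_half l).symm
  have hDq : Real.exp (l / 100) ^ 8 * √x * Real.exp (y ^ 20) ≤ q := by
    refine le_trans ?_ hqexp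
    rw [hsqx, ← Real.exp_nat_mul, ← Real.exp_add, ← Real.exp_add]
    apply Real.exp_le_exp.mpr
    push_cast
    linarith
  have h8q : 8 * √x ≤ q := by
    refine le_trans ?_ hDq
    have h1 : 8 ≤ Real.exp (y ^ 20) := by
      have := Real.add_one_le_exp (y ^ 20)
      linarith
    have h2 : 1 ≤ Real.exp (l / 100) ^ 8 := one_le_pow₀ (Real.one_le_exp (by linarith))
    have h3 : 0 ≤ √x := Real.sqrt_nonneg x
    calc 8 * √x ≤ Real.exp (y ^ 20) * √x := by gcongr
      _ = 1 * √x * Real.exp (y ^ 20) := by ring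
      _ ≤ _ := by gcongr
  have hcount := hmain K m k q x (Real.exp (l / 100)) (Real.exp (y ^ 20)) hK7 hkK hk0 hz1
    (by rw [Real.log_exp]; exact hz2)
    (by
      rw [← Real.log_le_iff_le_exp hM]
      linarith)
    hx1
    (by
      rw [← Real.exp_nat_mul, hxl]
      apply Real.exp_le_exp.mpr
      push_cast
      linarith)
    h8q hix (Real.one_le_exp (by positivity)) hDq hz3
    (by
      rw [one_div, ← Real.exp_neg]
      refine le_trans ?_ (hVA q k K (Zn K m 0) hK7 hkK (Zn_ge K m 0 (by omega)))
      apply Real.exp_le_exp.mpr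
      linarith)
  -- number of residues
  have hlam1 : l / 2 ≤ Real.log q := by
    rw [Real.le_log_iff_exp_le hq0, ← hsqx]
    have := Real.sqrt_nonneg x
    linarith
  have hlam2 : Real.log q ≤ l := by
    apply Real.log_le_log hq0
    linarith
  have hnum : (q : ℝ) ^ (1 - 1 / Real.log (Real.log q)) ≤
      c * q / Real.exp (y ^ 20) * (K : ℝ) ^ (-(8 / 10 : ℝ)) := by
    set lam := Real.log q with hlam
    have hll : 0 < Real.log lam := Real.log_pos (by linarith)
    have hll2 : Real.log lam ≤ y := (Real.log_le_log (by linarith) hlam2).trans hly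
    have hKpos : (0 : ℝ) < K := by
      have : 0 < K := by omega
      exact_mod_cast this
    have hlK : Real.log K ≤ y := by
      refine le_trans (Real.log_le_log hKpos ?_) hly
      rw [hly60]
      exact hKy.trans (pow_le_pow_right₀ hy1 (by norm_num))
    have e : c * q / Real.exp (y ^ 20) * (K : ℝ) ^ (-(8 / 10 : ℝ)) =
        Real.exp (Real.log c + lam - y ^ 20 + Real.log K * (-(8 / 10 : ℝ))) := by
      rw [Real.exp_add, Real.exp_sub, Real.exp_add, Real.exp_log hc, hlam, Real.exp_log hq0,
        ← Real.rpow_def_of_pos hKpos]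
    rw [e, Real.rpow_def_of_pos hq0, ← hlam]
    apply Real.exp_le_exp.mpr
    have h1 : 1 / y ≤ 1 / Real.log lam := one_div_le_one_div_of_le hll hll2
    have h2 : lam * (1 / y) ≤ lam * (1 / Real.log lam) := mul_le_mul_of_nonneg_left h1 (by linarith)
    have h3 : l / 2 * (1 / y) ≤ lam * (1 / y) := mul_le_mul_of_nonneg_right hlam1 (by positivity)
    have h4 : l / 2 * (1 / y) = y ^ 59 / 2 := by
      rw [hly60]; field_simp
    have h5 : 100 * y ^ 20 ≤ y ^ 59 := by
      calc 100 * y ^ 20 ≤ y * y ^ 20 := by gcongr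
        _ = y ^ 21 := by ring
        _ ≤ _ := pow_le_pow_right₀ hy1 (by norm_num)
    have h6 : lam * (1 - 1 / Real.log lam) = lam - lam * (1 / Real.log lam) := by ring
    rw [h6]
    linarith
  refine hnum.trans (hcount.trans ?_)
  -- inclusion
  have hfin : {a : ℕ | 1 ≤ a ∧ a ≤ q ∧ c / (28 * Real.exp 2 * (|frakS| + 1)) * frakS * x / (phiS q * X ^ ((9 : ℝ) / 10)) ≤
      (SAP x q a : ℝ)}.Finite := (Set.finite_Iic q).subset (fun a ha => ha.2.1)
  rw [← Set.ncard_coe_finset]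
  have : ∀ s t : ℕ, s ≤ t → (s : ℝ) ≤ t := fun s t h => by exact_mod_cast h
  apply this
  apply Set.ncard_le_ncard _ hfin
  intro a ha
  rw [mem_coe, mem_filter, mem_Icc] at ha
  refine ⟨ha.1.1, ha.1.2, ?_⟩
  have hSAP := SAP_ge x q a k hqn ha.1.1 ha.1.2 hk0 hix
    ((range k).filter (fun i => ∃ u v : ℕ, a + 4 * i ^ 2 * q = u ^ 2 + v ^ 2))
    (fun i hi => ⟨mem_range.mp (mem_filter.mp hi).1, (mem_filter.mp hi).2⟩)
  have hY2 : 2 < l / Real.log l ∧ 1 < Real.log l := by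
    have hb : 1 < Real.log l := by
      rw [Real.lt_log_iff_exp_lt hlpos]
      have := Real.exp_one_lt_d9
      have := hyp 20
      linarith
    refine ⟨?_, hb⟩
    rw [lt_div_iff₀ (by linarith)]
    linarith
  obtain ⟨hphi0, hphi⟩ := phiS_bound l q hqn hY2.2 hY2.1 hlam2 hpq
  have hX0 : 0 < X := by linarith
  have hR : x / (phiS q * X ^ ((9 : ℝ) / 10)) ≤ Real.exp 2 * X ^ (1 / 10 : ℝ) := by
    rw [div_le_iff₀ (by positivity)]
    have h1 : X ^ (1 / 10 : ℝ) * X ^ ((9 : ℝ) / 10) = X := by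
      rw [← Real.rpow_add hX0]; norm_num
    calc x = X * q := hXq.symm
      _ ≤ X * (Real.exp 2 * phiS q) := by gcongr
      _ = (X ^ (1 / 10 : ℝ) * X ^ ((9 : ℝ) / 10)) * (Real.exp 2 * phiS q) := by rw [h1]
      _ = _ := by ring
  have hR0 : 0 ≤ x / (phiS q * X ^ ((9 : ℝ) / 10)) := by positivity
  have hk3 := rpow_k k K X hk0 hX0 hK7k (by omega) hk2
  have hf : frakS ≤ |frakS| + 1 := by linarith [le_abs_self frakS]
  have hf0 : 0 < |frakS| + 1 := by positivity
  calc c / (28 * Real.exp 2 * (|frakS| + 1)) * frakS * x / (phiS q * X ^ ((9 : ℝ) / 10))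
      = c / (28 * Real.exp 2 * (|frakS| + 1)) * frakS * (x / (phiS q * X ^ ((9 : ℝ) / 10))) := by ring
    _ ≤ c / (28 * Real.exp 2 * (|frakS| + 1)) * (|frakS| + 1) * (x / (phiS q * X ^ ((9 : ℝ) / 10))) := by gcongr
    _ ≤ c / (28 * Real.exp 2 * (|frakS| + 1)) * (|frakS| + 1) * (Real.exp 2 * X ^ (1 / 10 : ℝ)) := by gcongr
    _ = c * (X ^ (1 / 10 : ℝ) / 28) := by field_simp
    _ ≤ c * ((K : ℝ) ^ (-(8 / 10 : ℝ)) * k) := by gcongr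
    _ = c * (K : ℝ) ^ (-(8 / 10 : ℝ)) * k := by ring
    _ ≤ _ := ha.2
    _ ≤ _ := by exact_mod_cast hSAP

end
end STS

theorem sums_of_two_squares_in_progressions_varying_residue :
    ∃ c : ℝ, 0 < c ∧ ∃ c0 : ℝ, 0 < c0 ∧ ∃ x0 : ℝ, ∀ x : ℝ, x0 ≤ x →
      ∀ q : ℕ, c0 ≤ (q : ℝ) → x * Real.log x ^ (-(5 : ℝ) / 9) ≤ (q : ℝ) → (q : ℝ) ≤ x / 2 →
        (∀ p : ℕ, p.Prime → p ∣ q → Real.log x / Real.log (Real.log x) ≤ (p : ℝ)) →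
          (q : ℝ) ^ (1 - 1 / Real.log (Real.log q)) ≤
            (({a : ℕ | 1 ≤ a ∧ a ≤ q ∧
              c * frakS * x / (phiS q * (x / (q : ℝ)) ^ ((9 : ℝ) / 10)) ≤ (SAP x q a : ℝ)}).ncard : ℝ) := by
  obtain ⟨c, hc, x0, h⟩ := STS.main_aux
  exact ⟨c, hc, 1, one_pos, x0, fun x hx q _ h1 h2 h3 => h x hx q h1 h2 h3⟩
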